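/- arXiv:math/0205077 — 4 statements merged into one kernel-verified Lean document; each statement's English description precedes it below -/
import Mathlib

section
/- Fix 0 < θ < π/2 and n ≥ 1. Let Λ denote Lebesgue measure on the space M_n(ℂ) of n×n complex matrices (the product of Lebesgue measures on the real and imaginary parts of all entries). Define ψ_θ : M_n(ℂ) → (0,∞) by ψ_θ(M) = exp(−(n/2)·Tr(A²/cos²θ + B²/sin²θ)) where A = (M+M*)/2 and B = (M−M*)/(2i). Let κ_Y be the probability measure on M_n(ℂ) proportional to ψ_θ·Λ, i.e., κ_Y = (∫ψ_θ dΛ)^{−1}·ψ_θ·Λ. Let h be the Haar probability measure on the unitary group U(n), let ν_n be the probability measure on ℂⁿ with density proportional to ∏_{1≤i<j≤n}|d_i−d_j|²·exp(−(n/2)·Σ_{i=1}^n((Re d_i)²/cos²θ + (Im d_i)²/sin²θ)) with respect to Lebesgue measure on ℂⁿ, and let GT(n) be the law of a strictly upper triangular n×n random matrix with i.i.d. complex Gaussian N_ℂ(0,1/n) entries above the diagonal. Then the pushforward of the product measure h ⊗ ν_n ⊗ GT(n) under the map (U, d, S) ↦ U*·(diag(d₁,…,d_n) + sin(2θ)·S)·U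 equals κ_Y. (Equivalently, (cos θ)H₁ + i(sin θ)H₂ with independent GUE matrices H₁, H₂ of variance 1/n has the same distribution as U*(D_θ + sin(2θ)T)U.) -/
open MeasureTheory ProbabilityTheory Real Matrix
open scoped ENNReal NNReal ComplexOrder

/-- The complex Gaussian measure `N_ℂ(0,v)`: the pushforward of `N(0,v/2) × N(0,v/2)` under
`(x,y) ↦ x + iy`. -/
noncomputable def complexGaussian (v : ℝ≥0) : Measure ℂ :=
  ((gaussianReal 0 (v / 2)).prod (gaussianReal 0 (v / 2))).map
    fun p => (p.1 : ℂ) + (p.2 : ℂ) * Complex.I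

/-- The law `GT(n)` of a strictly upper triangular `n×n` random matrix with i.i.d. complex
Gaussian `N_ℂ(0,1/n)` entries above the diagonal (and zeros elsewhere). -/
noncomputable def GTlaw (n : ℕ) : Measure (Fin n → Fin n → ℂ) :=
  Measure.pi fun i => Measure.pi fun j =>
    if (i : ℕ) < (j : ℕ) then complexGaussian ((n : ℝ≥0))⁻¹ else Measure.dirac 0

/-- The elliptic Gaussian density `ψ_θ(M) = exp(−(n/2)·Tr(A²/cos²θ + B²/sin²θ))`, where
`A = (M+M*)/2` and `B = (M−M*)/(2i)` are the real and imaginary parts of `M`. -/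
noncomputable def psiTheta (θ : ℝ) (n : ℕ) (M : Matrix (Fin n) (Fin n) ℂ) : ℝ :=
  Real.exp ((-(n : ℂ) / 2 *
    (((((2 : ℂ)⁻¹ • (M + Mᴴ)) ^ 2).trace / (Real.cos θ : ℂ) ^ 2) +
      (((((2 : ℂ) * Complex.I)⁻¹ • (M - Mᴴ)) ^ 2).trace / (Real.sin θ : ℂ) ^ 2))).re)

/-- The probability measure `κ_Y` on `n×n` complex matrices proportional to `ψ_θ·Λ`, where
`Λ` is Lebesgue measure on the space of matrices. -/
noncomputable def kappaY (θ : ℝ) (n : ℕ) : Measure (Fin n → Fin n → ℂ) :=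
  (ENNReal.ofReal (∫ t : Fin n → Fin n → ℂ, psiTheta θ n (Matrix.of t)))⁻¹ •
    volume.withDensity fun t => ENNReal.ofReal (psiTheta θ n (Matrix.of t))

/-- The (unnormalized) eigenvalue density on `ℂⁿ`. -/
noncomputable def thetaDensity (θ : ℝ) (n : ℕ) (d : Fin n → ℂ) : ℝ :=
  (∏ i : Fin n, ∏ j : Fin n, if i < j then ‖d i - d j‖ ^ 2 else 1) *
    Real.exp (-((n : ℝ) / 2) *
      ∑ i : Fin n, ((d i).re ^ 2 / Real.cos θ ^ 2 + (d i).im ^ 2 / Real.sin θ ^ 2))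

/-- The eigenvalue distribution `ν_n` on `ℂⁿ`. -/
noncomputable def nuTheta (θ : ℝ) (n : ℕ) : Measure (Fin n → ℂ) :=
  (ENNReal.ofReal (∫ d : Fin n → ℂ, thetaDensity θ n d))⁻¹ •
    volume.withDensity fun d => ENNReal.ofReal (thetaDensity θ n d)

theorem blk_det {m : Type*} [Fintype m] [DecidableEq m] (A : Matrix m m ℂ) (w : m → ℤ)
    (hA : ∀ p q, p ≠ q → w q ≤ w p → A p q = 0) : A.det = ∏ p, A p p := by
  have hb : A.BlockTriangular w := fun p q hpq => hA p q (by rintro rfl; exact lt_irrefl _ hpq) hpq.le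
  rw [hb.det]
  have : ∀ a, (A.toSquareBlock w a).det = ∏ x : {x // w x = a}, A x x := by
    intro a
    have : A.toSquareBlock w a = Matrix.diagonal (fun x : {x // w x = a} => A x x) := by
      ext x y
      by_cases hxy : x = y
      · subst hxy; simp [toSquareBlock_def]
      · rw [Matrix.diagonal_apply_ne _ hxy]
        exact hA _ _ (fun h => hxy (Subtype.ext h)) (by rw [x.2, y.2])
    rw [this, det_diagonal]
  simp_rw [this]
  rw [← Finset.prod_fiberwise_of_maps_to (s := Finset.univ) (t := Finset.univ.image w) (g := w)
    (fun x _ => Finset.mem_image_of_mem _ (Finset.mem_univ _))]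
  refine Finset.prod_congr rfl fun a _ => ?_
  exact (Finset.prod_subtype (F := inferInstance) _ (by simp) (fun x => A x x)).symm

/-- triangular linear maps on matrices -/
theorem lin_det {n : ℕ} (φ : Matrix (Fin n) (Fin n) ℂ →ₗ[ℂ] Matrix (Fin n) (Fin n) ℂ)
    (w : Fin n × Fin n → ℤ) (d : Fin n → Fin n → ℂ)
    (h : ∀ i j k l, (i,j) ≠ (k,l) → w (k,l) ≤ w (i,j) → φ (Matrix.single k l 1) i j = 0)
    (hd : ∀ i j, φ (Matrix.single i j 1) i j = d i j) :
    LinearMap.det φ = ∏ i, ∏ j, d i j := by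
  rw [← LinearMap.det_toMatrix (Matrix.stdBasis ℂ (Fin n) (Fin n)), blk_det _ w]
  · rw [Fintype.prod_prod_type]
    refine Finset.prod_congr rfl fun i _ => Finset.prod_congr rfl fun j _ => ?_
    rw [LinearMap.toMatrix_apply, ← hd, Matrix.stdBasis_eq_single]
    rfl
  · rintro ⟨i, j⟩ ⟨k, l⟩ hne hw
    rw [LinearMap.toMatrix_apply, Matrix.stdBasis_eq_single]
    exact h i j k l hne hw

/-- conjugation as linear map -/
noncomputable def conjL {n : ℕ} (g h : Matrix (Fin n) (Fin n) ℂ) :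
    Matrix (Fin n) (Fin n) ℂ →ₗ[ℂ] Matrix (Fin n) (Fin n) ℂ :=
  LinearMap.mulLeft ℂ g ∘ₗ LinearMap.mulRight ℂ h

theorem det_mulR {n : ℕ} (g : Matrix (Fin n) (Fin n) ℂ) :
    LinearMap.det (LinearMap.mulRight ℂ g) = g.det ^ n := by
  rw [← LinearMap.det_conj (LinearMap.mulRight ℂ g) (Matrix.ofLinearEquiv ℂ).symm]
  have : ((Matrix.ofLinearEquiv ℂ).symm.toLinearMap ∘ₗ LinearMap.mulRight ℂ g ∘ₗ
      ((Matrix.ofLinearEquiv ℂ).symm.symm : _ ≃ₗ[ℂ] Matrix (Fin n) (Fin n) ℂ).toLinearMap) =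
      LinearMap.pi (fun i : Fin n => (Matrix.toLin' gᵀ).comp (LinearMap.proj i)) := by
    refine LinearMap.ext fun X => ?_
    ext i j
    simp [Matrix.mul_apply, mulVec, dotProduct, mul_comm]
  rw [this, LinearMap.det_pi]
  simp

theorem det_mulL {n : ℕ} (g : Matrix (Fin n) (Fin n) ℂ) :
    LinearMap.det (LinearMap.mulLeft ℂ g) = g.det ^ n := by
  rw [← LinearMap.det_conj (LinearMap.mulLeft ℂ g) (Matrix.transposeLinearEquiv (Fin n) (Fin n) ℂ ℂ)]
  rw [← det_transpose, ← det_mulR]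
  congr 1
  refine LinearMap.ext fun X => ?_
  simp

theorem det_conjL {n : ℕ} (g h : Matrix (Fin n) (Fin n) ℂ) (hg : g * h = 1) :
    LinearMap.det (conjL g h) = 1 := by
  rw [conjL, LinearMap.det_comp, det_mulL, det_mulR, ← mul_pow, ← det_mul, hg]; simp

theorem tri_basis : ∀ (n : ℕ) (V : Type) [AddCommGroup V] [Module ℂ V] [FiniteDimensional ℂ V],
    Module.finrank ℂ V = n → ∀ f : Module.End ℂ V,
    ∃ b : Module.Basis (Fin n) ℂ V, ∀ j, f (b j) ∈ Submodule.span ℂ (b '' Set.Iic j) := by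
  intro n
  induction n with
  | zero =>
    intro V _ _ _ hV f
    exact ⟨Module.finBasisOfFinrankEq ℂ V hV, fun j => j.elim0⟩
  | succ n ih =>
    intro V _ _ _ hV f
    have : Nontrivial V := Module.nontrivial_of_finrank_pos (R := ℂ) (by omega)
    obtain ⟨c, hc⟩ := Module.End.exists_eigenvalue f
    have hlt : LinearMap.range (f - algebraMap ℂ (Module.End ℂ V) c) < ⊤ := by
      rw [lt_top_iff_ne_top]
      intro htop
      have hs := LinearMap.range_eq_top.1 htop
      have hi := LinearMap.injective_iff_surjective.2 hs
      obtain ⟨v, hv⟩ := hc.exists_hasEigenvector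
      apply hv.2
      apply hi
      simp [hv.apply_eq_smul]
    obtain ⟨φ, hφ, hle⟩ := Submodule.exists_le_ker_of_lt_top _ hlt
    have hφs : Function.Surjective φ := LinearMap.surjective hφ
    obtain ⟨y, hy⟩ := hφs 1
    have hW : Module.finrank ℂ (LinearMap.ker φ) = n := by
      have := LinearMap.finrank_range_add_finrank_ker φ
      rw [LinearMap.range_eq_top.2 hφs, finrank_top, Module.finrank_self, hV] at this
      omega
    have hinv : ∀ x ∈ LinearMap.ker φ, f x ∈ LinearMap.ker φ := by
      intro x hx
      have := hle ⟨x, rfl⟩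
      rw [LinearMap.mem_ker] at *
      simp [hx] at this
      exact this
    obtain ⟨b, hb⟩ := ih (LinearMap.ker φ) hW (f.restrict hinv)
    refine ⟨Module.Basis.mkFinSnoc b y ?_ ?_, ?_⟩
    · intro c x hx h
      have := congrArg φ h
      rw [LinearMap.mem_ker] at hx
      simpa [hx, hy] using this
    · intro z
      exact ⟨-φ z, by simp [hy]⟩
    · intro j
      refine Fin.lastCases ?_ (fun j => ?_) j
      · have : Set.Iic (Fin.last n) = Set.univ := by
          ext x; simp [Fin.le_last]
        rw [this, Set.image_univ, Module.Basis.span_eq]; trivial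
      · rw [Module.Basis.coe_mkFinSnoc]
        simp only [Fin.snoc_castSucc, Function.comp]
        have h1 := Submodule.mem_map_of_mem (f := (LinearMap.ker φ).subtype) (hb j)
        rw [Submodule.map_span] at h1
        refine Submodule.span_mono ?_ h1
        rintro _ ⟨_, ⟨k, hk, rfl⟩, rfl⟩
        exact ⟨k.castSucc, by simpa using hk, by simp⟩

theorem exists_tri {n : ℕ} (M : Matrix (Fin n) (Fin n) ℂ) :
    ∃ g T : Matrix (Fin n) (Fin n) ℂ, IsUnit g.det ∧ T.IsUpperTriangular ∧ M * g = g * T := by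
  obtain ⟨b, hb⟩ := tri_basis n (Fin n → ℂ) (by simp) (Matrix.toLin' M)
  refine ⟨(Pi.basisFun ℂ (Fin n)).toMatrix b, LinearMap.toMatrix b b (Matrix.toLin' M), ?_, ?_, ?_⟩
  · rw [← Matrix.isUnit_iff_isUnit_det]
    have := (Pi.basisFun ℂ (Fin n)).invertibleToMatrix b
    exact isUnit_of_invertible _
  · intro i j hij
    rw [LinearMap.toMatrix_apply]
    have := b.repr_support_subset_of_mem_span _ (hb j)
    by_contra hne
    have h2 := this (Finsupp.mem_support_iff.2 hne)
    exact absurd h2 (not_le.2 hij)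
  · have h1 := basis_toMatrix_mul_linearMap_toMatrix (c := Pi.basisFun ℂ (Fin n)) (c' := b) (b' := b) (f := Matrix.toLin' M)
    have h2 := linearMap_toMatrix_mul_basis_toMatrix (b := b) (b' := Pi.basisFun ℂ (Fin n)) (c' := Pi.basisFun ℂ (Fin n)) (f := Matrix.toLin' M)
    rw [h1, ← h2]
    congr 1
    simp [LinearMap.toMatrix_eq_toMatrix']

/-- unit lower triangular -/
def UL {n : ℕ} (g : Matrix (Fin n) (Fin n) ℂ) : Prop :=
  (∀ i, g i i = 1) ∧ ∀ i j, i < j → g i j = 0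

theorem upper_mul_diag {n : ℕ} {A B : Matrix (Fin n) (Fin n) ℂ} (hA : A.IsUpperTriangular)
    (hB : B.IsUpperTriangular) (i : Fin n) : (A * B) i i = A i i * B i i := by
  rw [Matrix.mul_apply, Finset.sum_eq_single i]
  · intro k _ hk
    rcases lt_or_gt_of_ne hk with h | h
    · rw [hA h, zero_mul]
    · rw [hB h, mul_zero]
  · simp

theorem upper_inv {n : ℕ} {A : Matrix (Fin n) (Fin n) ℂ} (hA : A.IsUpperTriangular)
    (hd : IsUnit A.det) : A⁻¹.IsUpperTriangular := by
  have := Matrix.invertibleOfIsUnitDet A hd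
  exact blockTriangular_inv_of_blockTriangular hA

theorem UL_iff {n : ℕ} (g : Matrix (Fin n) (Fin n) ℂ) : UL g ↔ gᵀ.IsUpperTriangular ∧ ∀ i, g i i = 1 := by
  constructor
  · rintro ⟨h1, h2⟩
    exact ⟨fun i j hij => h2 _ _ hij, h1⟩
  · rintro ⟨h1, h2⟩
    exact ⟨h2, fun i j hij => h1 hij⟩

theorem UL_det {n : ℕ} {g : Matrix (Fin n) (Fin n) ℂ} (h : UL g) : g.det = 1 := by
  rw [← det_transpose, det_of_isUpperTriangular ((UL_iff g).1 h).1]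
  simp [h.1]

theorem UL_mul {n : ℕ} {g g' : Matrix (Fin n) (Fin n) ℂ} (h : UL g) (h' : UL g') : UL (g * g') := by
  rw [UL_iff] at *
  refine ⟨?_, fun i => ?_⟩
  · rw [transpose_mul]; exact h'.1.mul h.1
  · have := upper_mul_diag h'.1 h.1 i
    rw [← transpose_mul] at this
    simpa [h.2, h'.2] using this

theorem UL_inv {n : ℕ} {g : Matrix (Fin n) (Fin n) ℂ} (h : UL g) : UL g⁻¹ := by
  have hd := UL_det h
  rw [UL_iff] at *
  have h1 : (g⁻¹)ᵀ.IsUpperTriangular := by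
    rw [transpose_nonsing_inv]
    exact upper_inv h.1 (by rw [det_transpose, hd]; exact isUnit_one)
  refine ⟨h1, fun i => ?_⟩
  have := upper_mul_diag h.1 h1 i
  rw [← transpose_mul, nonsing_inv_mul _ (by rw [hd]; exact isUnit_one)] at this
  simpa [h.2] using this.symm

theorem inj_core {n : ℕ} {P T T' : Matrix (Fin n) (Fin n) ℂ} (hP : UL P)
    (hT : T.IsUpperTriangular) (hT' : T'.IsUpperTriangular) (hd : ∀ i, T i i = T' i i)
    (hinj : ∀ i j, T i i = T j j → i = j) (h : P * T = T' * P) : P = 1 := by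
  have key : ∀ m : ℕ, ∀ i j : Fin n, j < i → (n - (i - j : ℕ)) = m → P i j = 0 := by
    intro m
    induction m using Nat.strong_induction_on with
    | _ m ih =>
      intro i j hij hm
      have h1 : (P * T) i j = P i j * T j j := by
        rw [Matrix.mul_apply, Finset.sum_eq_single j]
        · intro k _ hk
          rcases lt_or_gt_of_ne hk with h | h
          · rw [ih (n - (i - k : ℕ)) (by omega) i k (h.trans hij) rfl, zero_mul]
          · rw [hT h, mul_zero]
        · simp
      have h2 : (T' * P) i j = T' i i * P i j := by
        rw [Matrix.mul_apply, Finset.sum_eq_single i]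
        · intro k _ hk
          rcases lt_or_gt_of_ne hk with h | h
          · rw [hT' h, zero_mul]
          · rw [ih (n - (k - j : ℕ)) (by omega) k j (hij.trans h) rfl, mul_zero]
        · simp
      rw [h, h2, ← hd] at h1
      have h3 : (T i i - T j j) * P i j = 0 := by linear_combination h1
      rcases mul_eq_zero.1 h3 with h4 | h4
      · exact absurd (hinj _ _ (sub_eq_zero.1 h4)) hij.ne'
      · exact h4
  ext i j
  rcases lt_trichotomy i j with h | h | h
  · rw [hP.2 _ _ h, Matrix.one_apply_ne h.ne]
  · subst h; simp [hP.1]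
  · rw [key _ i j h rfl, Matrix.one_apply_ne h.ne']

theorem exists_LU {n : ℕ} (A : Matrix (Fin n) (Fin n) ℂ)
    (hA : ∀ i : Fin n, (A.submatrix (Subtype.val : {k // k < i} → Fin n) (Subtype.val : {k // k < i} → Fin n)).det ≠ 0) :
    ∃ g b : Matrix (Fin n) (Fin n) ℂ, UL g ∧ b.IsUpperTriangular ∧ A = g * b := by
  have hx : ∀ i : Fin n, ∃ x : Fin n → ℂ, x i = 1 ∧ (∀ j, i < j → x j = 0) ∧
      ∀ j, j < i → ∑ k, x k * A k j = 0 := by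
    intro i
    set B : Matrix {k // k < i} {k // k < i} ℂ := A.submatrix Subtype.val Subtype.val with hB
    set z : {k // k < i} → ℂ := (fun j : {k // k < i} => - A i j.1) ᵥ* B⁻¹ with hz
    have hzB : z ᵥ* B = fun j => - A i j.1 := by
      rw [hz, vecMul_vecMul, nonsing_inv_mul _ (isUnit_iff_ne_zero.2 (hA i)), vecMul_one]
    refine ⟨fun k => if h : k < i then z ⟨k, h⟩ else if k = i then 1 else 0, by simp, ?_, ?_⟩
    · intro j hj
      simp [hj.not_gt, hj.ne']
    · intro j hj
      have h1 := congrFun hzB ⟨j, hj⟩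
      simp only [vecMul, dotProduct, hB, submatrix_apply] at h1
      have h2 : ∀ k, (if h : k < i then z ⟨k, h⟩ else if k = i then 1 else 0) * A k j =
          (if h : k < i then z ⟨k, h⟩ * A k j else 0) + (if k = i then A i j else 0) := by
        intro k
        by_cases h : k < i
        · simp [h, h.ne]
        · by_cases h' : k = i <;> simp [h, h']
      simp_rw [h2, Finset.sum_add_distrib]
      rw [Finset.sum_dite]
      simp only [Finset.sum_const_zero, add_zero, Finset.sum_ite_eq', Finset.mem_univ, if_true]
      have h3 : ∑ x : {x // x ∈ Finset.univ.filter (fun k => k < i)}, z ⟨x.1, (Finset.mem_filter.1 x.2).2⟩ * A x.1 j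
          = ∑ x : {k // k < i}, z x * A x j := by
        refine Fintype.sum_equiv (Equiv.subtypeEquivRight (by simp)) _ _ ?_
        intro x; rfl
      have h4 := h3.trans h1
      refine (congrArg (· + A i j) h4).trans ?_
      simp
  choose x hx1 hx2 hx3 using hx
  have hU : UL (Matrix.of x) := ⟨hx1, fun i j h => hx2 i j h⟩
  refine ⟨(Matrix.of x)⁻¹, Matrix.of x * A, UL_inv hU, ?_, ?_⟩
  · intro i j hij
    rw [Matrix.mul_apply]
    exact hx3 i j hij
  · rw [nonsing_inv_mul_cancel_left _ _ (by rw [UL_det hU]; exact isUnit_one)]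

theorem exists_QR {n : ℕ} (A : Matrix (Fin n) (Fin n) ℂ) :
    ∃ U b : Matrix (Fin n) (Fin n) ℂ, U ∈ Matrix.unitaryGroup (Fin n) ℂ ∧ b.IsUpperTriangular ∧
      A = U * b := by
  have hc : Module.finrank ℂ (EuclideanSpace ℂ (Fin n)) = Fintype.card (Fin n) := by simp
  set f : Fin n → EuclideanSpace ℂ (Fin n) := fun j => WithLp.toLp 2 (fun i => A i j) with hf
  set e := InnerProductSpace.gramSchmidtOrthonormalBasis hc f with he
  refine ⟨(EuclideanSpace.basisFun (Fin n) ℂ).toBasis.toMatrix e, e.toBasis.toMatrix f, ?_, ?_, ?_⟩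
  · exact (EuclideanSpace.basisFun (Fin n) ℂ).toMatrix_orthonormalBasis_mem_unitary e
  · exact InnerProductSpace.gramSchmidtOrthonormalBasis_inv_isUpperTriangular hc f
  · have := (EuclideanSpace.basisFun (Fin n) ℂ).toBasis.toMatrix_mul_toMatrix e.toBasis f
    rw [OrthonormalBasis.coe_toBasis] at this
    rw [this]
    ext i j
    simp [Module.Basis.toMatrix_apply, hf]

theorem exists_diag {n : ℕ} {M g T : Matrix (Fin n) (Fin n) ℂ} (hg : IsUnit g.det)
    (hT : T.IsUpperTriangular) (hM : M * g = g * T) (hinj : ∀ i j, T i i = T j j → i = j)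
    (τ : Equiv.Perm (Fin n)) :
    ∃ g' : Matrix (Fin n) (Fin n) ℂ, IsUnit g'.det ∧
      M * g' = g' * Matrix.diagonal (fun i => T (τ i) (τ i)) := by
  have hM' : M = g * T * g⁻¹ := by rw [← hM, mul_nonsing_inv_cancel_right _ _ hg]
  have hv : ∀ i, ∃ v : Fin n → ℂ, v ≠ 0 ∧ M *ᵥ v = T (τ i) (τ i) • v := by
    intro i
    have h0 : (M - T (τ i) (τ i) • (1 : Matrix (Fin n) (Fin n) ℂ)).det = 0 := by
      have : M - T (τ i) (τ i) • (1 : Matrix (Fin n) (Fin n) ℂ) =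
          g * (T - T (τ i) (τ i) • (1 : Matrix (Fin n) (Fin n) ℂ)) * g⁻¹ := by
        rw [hM', mul_sub, sub_mul]
        simp [mul_nonsing_inv _ hg]
      have hu : (T - T (τ i) (τ i) • (1 : Matrix (Fin n) (Fin n) ℂ)).IsUpperTriangular := by
        refine hT.sub ?_
        intro a b hab
        have : b < a := hab
        simp [Matrix.one_apply_ne this.ne']
      rw [this, det_mul, det_mul, det_of_isUpperTriangular hu, Finset.prod_eq_zero (Finset.mem_univ (τ i))]
      · simp
      · simp
    obtain ⟨v, hv, hv0⟩ := Matrix.exists_mulVec_eq_zero_iff.2 h0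
    refine ⟨v, hv, ?_⟩
    rw [sub_mulVec, smul_mulVec, one_mulVec, sub_eq_zero] at hv0
    exact hv0
  choose v hv0 hv using hv
  have hli : LinearIndependent ℂ v := by
    refine Module.End.eigenvectors_linearIndependent' (Matrix.toLin' M) (fun i => T (τ i) (τ i))
      (fun i j h => τ.injective (hinj _ _ h)) v (fun i => ?_)
    rw [Module.End.hasEigenvector_iff, Module.End.mem_eigenspace_iff]
    exact ⟨by simpa using hv i, hv0 i⟩
  refine ⟨(Matrix.of v)ᵀ, ?_, ?_⟩
  · rw [det_transpose, ← isUnit_iff_isUnit_det]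
    exact linearIndependent_rows_iff_isUnit.1 hli
  · ext i j
    rw [Matrix.mul_diagonal]
    have := congrFun (hv j) i
    simp only [mulVec, dotProduct, Pi.smul_apply, smul_eq_mul] at this
    rw [Matrix.mul_apply]
    simpa [mul_comm] using this

abbrev EE (n : ℕ) := Fin n → Fin n → ℂ

noncomputable def lowL (n : ℕ) : Matrix (Fin n) (Fin n) ℂ →ₗ[ℂ] Matrix (Fin n) (Fin n) ℂ where
  toFun X := Matrix.of fun i j => if j < i then X i j else 0
  map_add' X Y := by ext i j; by_cases h : j < i <;> simp [h]
  map_smul' c X := by ext i j; by_cases h : j < i <;> simp [h]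

noncomputable def uppL (n : ℕ) : Matrix (Fin n) (Fin n) ℂ →ₗ[ℂ] Matrix (Fin n) (Fin n) ℂ where
  toFun X := Matrix.of fun i j => if i ≤ j then X i j else 0
  map_add' X Y := by ext i j; by_cases h : i ≤ j <;> simp [h]
  map_smul' c X := by ext i j; by_cases h : i ≤ j <;> simp [h]

theorem lowL_apply {n : ℕ} (X : Matrix (Fin n) (Fin n) ℂ) (i j : Fin n) :
    lowL n X i j = if j < i then X i j else 0 := rfl
theorem uppL_apply {n : ℕ} (X : Matrix (Fin n) (Fin n) ℂ) (i j : Fin n) :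
    uppL n X i j = if i ≤ j then X i j else 0 := rfl

theorem low_add_upp {n : ℕ} (X : Matrix (Fin n) (Fin n) ℂ) : lowL n X + uppL n X = X := by
  ext i j
  rw [Matrix.add_apply, lowL_apply, uppL_apply]
  by_cases h : j < i
  · simp [h, not_le.2 h]
  · simp [h, not_lt.1 h]

theorem upp_tri {n : ℕ} (X : Matrix (Fin n) (Fin n) ℂ) : (uppL n X).IsUpperTriangular := by
  intro i j h
  have : j < i := h
  rw [uppL_apply, if_neg (not_le.2 this)]

theorem upp_diag {n : ℕ} (X : Matrix (Fin n) (Fin n) ℂ) (i) : uppL n X i i = X i i := by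
  simp [uppL_apply]

theorem upp_of_tri {n : ℕ} {T : Matrix (Fin n) (Fin n) ℂ} (h : T.IsUpperTriangular) :
    uppL n T = T := by
  ext i j
  rw [uppL_apply]
  split_ifs with h1
  · rfl
  · exact (h (not_le.1 h1)).symm

theorem low_of_tri {n : ℕ} {T : Matrix (Fin n) (Fin n) ℂ} (h : T.IsUpperTriangular) :
    lowL n T = 0 := by
  ext i j
  rw [lowL_apply]
  split_ifs with h1
  · exact h h1
  · rfl

theorem UL_low {n : ℕ} (X : Matrix (Fin n) (Fin n) ℂ) : UL (1 + lowL n X) := by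
  constructor
  · intro i; simp [lowL_apply]
  · intro i j h; simp [lowL_apply, h.not_gt, Matrix.one_apply_ne h.ne]

noncomputable def PhiL {n : ℕ} (T : Matrix (Fin n) (Fin n) ℂ) :
    Matrix (Fin n) (Fin n) ℂ →ₗ[ℂ] Matrix (Fin n) (Fin n) ℂ :=
  uppL n + (LinearMap.mulRight ℂ T - LinearMap.mulLeft ℂ T) ∘ₗ lowL n

noncomputable def PsiL {n : ℕ} (K : Matrix (Fin n) (Fin n) ℂ) :
    Matrix (Fin n) (Fin n) ℂ →ₗ[ℂ] Matrix (Fin n) (Fin n) ℂ :=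
  uppL n + LinearMap.mulLeft ℂ K ∘ₗ lowL n

theorem low_single {n : ℕ} (k l : Fin n) :
    lowL n (Matrix.single k l 1) = if l < k then Matrix.single k l 1 else 0 := by
  ext i j
  rw [lowL_apply]
  by_cases h : k = i ∧ l = j
  · obtain ⟨rfl, rfl⟩ := h
    split_ifs <;> simp
  · rw [Matrix.single_apply_of_ne _ _ _ _ _ h]
    split_ifs <;> simp [Matrix.single_apply_of_ne _ _ _ _ _ h]

theorem upp_single {n : ℕ} (k l : Fin n) :
    uppL n (Matrix.single k l 1) = if l < k then 0 else Matrix.single k l 1 := by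
  have := low_add_upp (Matrix.single k l (1 : ℂ))
  rw [low_single] at this
  split_ifs at * with h
  · simpa using this
  · simpa using this

theorem det_Phi {n : ℕ} {T : Matrix (Fin n) (Fin n) ℂ} (hT : T.IsUpperTriangular) :
    LinearMap.det (PhiL T) = ∏ i, ∏ j, if j < i then T j j - T i i else 1 := by
  apply lin_det _ (fun p => (p.1 : ℤ) - p.2)
  · intro i j k l hne hw
    simp only [PhiL, LinearMap.add_apply, LinearMap.comp_apply, low_single, upp_single,
      LinearMap.sub_apply, LinearMap.mulRight_apply, LinearMap.mulLeft_apply]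
    have hne' : ¬ (k = i ∧ l = j) := by rintro ⟨rfl, rfl⟩; exact hne rfl
    by_cases h : l < k
    · simp only [h, if_true, Matrix.add_apply, Matrix.sub_apply, Matrix.zero_apply]
      have h1 : (Matrix.single k l (1:ℂ) * T) i j = 0 := by
        by_cases hik : i = k
        · subst hik
          rw [Matrix.single_mul_apply_same, one_mul]
          refine hT (show j < l from ?_)
          have : j ≠ l := by rintro rfl; exact hne' ⟨rfl, rfl⟩
          simp only at hw
          omega
        · rw [Matrix.single_mul_apply_of_ne _ _ _ _ _ hik]
      have h2 : (T * Matrix.single k l (1:ℂ)) i j = 0 := by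
        by_cases hjl : j = l
        · subst hjl
          rw [Matrix.mul_single_apply_same, mul_one]
          refine hT (show k < i from ?_)
          have : i ≠ k := by rintro rfl; exact hne' ⟨rfl, rfl⟩
          simp only at hw
          omega
        · rw [Matrix.mul_single_apply_of_ne _ _ _ _ _ hjl]
      rw [h1, h2]; simp
    · simp [h, Matrix.single_apply_of_ne _ _ _ _ _ hne']
  · intro i j
    simp only [PhiL, LinearMap.add_apply, LinearMap.comp_apply, low_single, upp_single,
      LinearMap.sub_apply, LinearMap.mulRight_apply, LinearMap.mulLeft_apply]
    by_cases h : j < i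
    · simp [h]
    · simp [h]

theorem det_Psi {n : ℕ} {K : Matrix (Fin n) (Fin n) ℂ} (hK : UL K) :
    LinearMap.det (PsiL K) = 1 := by
  rw [lin_det _ (fun p => (p.2 : ℤ) - p.1) (fun _ _ => 1)]
  · simp
  · intro i j k l hne hw
    simp only [PsiL, LinearMap.add_apply, LinearMap.comp_apply, low_single, upp_single,
      LinearMap.mulLeft_apply]
    have hne' : ¬ (k = i ∧ l = j) := by rintro ⟨rfl, rfl⟩; exact hne rfl
    by_cases h : l < k
    · simp only [h, if_true, Matrix.add_apply, Matrix.zero_apply, zero_add]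
      by_cases hjl : j = l
      · subst hjl
        rw [Matrix.mul_single_apply_same, mul_one]
        refine hK.2 _ _ ?_
        have : i ≠ k := by rintro rfl; exact hne' ⟨rfl, rfl⟩
        simp only at hw
        omega
      · rw [Matrix.mul_single_apply_of_ne _ _ _ _ _ hjl]
    · simp [h, Matrix.single_apply_of_ne _ _ _ _ _ hne']
  · intro i j
    simp only [PsiL, LinearMap.add_apply, LinearMap.comp_apply, low_single, upp_single,
      LinearMap.mulLeft_apply]
    by_cases h : j < i
    · simp [h, hK.1]
    · simp [h]

/-- transport to real linear maps on `EE n` -/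
noncomputable def toE {n : ℕ} (φ : Matrix (Fin n) (Fin n) ℂ →ₗ[ℂ] Matrix (Fin n) (Fin n) ℂ) :
    EE n →ₗ[ℝ] EE n :=
  ((Matrix.ofLinearEquiv ℂ).symm.toLinearMap ∘ₗ φ ∘ₗ
      ((Matrix.ofLinearEquiv ℂ).symm.symm : _ ≃ₗ[ℂ] Matrix (Fin n) (Fin n) ℂ).toLinearMap).restrictScalars ℝ

theorem toE_apply {n : ℕ} (φ : Matrix (Fin n) (Fin n) ℂ →ₗ[ℂ] Matrix (Fin n) (Fin n) ℂ) (X : EE n) :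
    toE φ X = Matrix.of.symm (φ (Matrix.of X)) := rfl

theorem det_toE {n : ℕ} (φ : Matrix (Fin n) (Fin n) ℂ →ₗ[ℂ] Matrix (Fin n) (Fin n) ℂ) :
    LinearMap.det (toE φ) = Complex.normSq (LinearMap.det φ) := by
  rw [toE, LinearMap.det_restrictScalars, LinearMap.det_conj, Algebra.norm_complex_apply]

/-- the chart -/
noncomputable def chart (n : ℕ) (X : EE n) : EE n :=
  Matrix.of.symm ((1 + lowL n (Matrix.of X)) * uppL n (Matrix.of X) * (1 + lowL n (Matrix.of X))⁻¹)

noncomputable def mulB (n : ℕ) : EE n →L[ℝ] EE n →L[ℝ] EE n :=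
  (LinearMap.mk₂ ℝ (fun A B : EE n => (Matrix.of.symm (Matrix.of A * Matrix.of B) : EE n))
    (by intro a b c; exact add_mul (Matrix.of a) (Matrix.of b) (Matrix.of c))
    (by intro r a b; exact smul_mul_assoc r (Matrix.of a) (Matrix.of b))
    (by intro a b c; exact mul_add (Matrix.of a) (Matrix.of b) (Matrix.of c))
    (by intro r a b; exact mul_smul_comm r (Matrix.of a) (Matrix.of b))).toContinuousBilinearMap

theorem mulB_apply {n : ℕ} (A B : EE n) : mulB n A B = Matrix.of.symm (Matrix.of A * Matrix.of B) := rfl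

theorem diff_det {n : ℕ} (A : EE n → Matrix (Fin n) (Fin n) ℂ)
    (hA : ∀ i j, Differentiable ℝ fun X => A X i j) : Differentiable ℝ fun X => (A X).det := by
  simp_rw [Matrix.det_apply]
  refine Differentiable.fun_sum fun σ _ => ?_
  refine Differentiable.fun_const_smul ?_ _
  have : ∀ s : Finset (Fin n), Differentiable ℝ fun X => ∏ i ∈ s, A X (σ i) i := by
    intro s
    induction s using Finset.induction_on with
    | empty => simp
    | insert a s ha ih =>
      simp_rw [Finset.prod_insert ha]
      exact (hA _ _).fun_mul ih
  exact this _

theorem diff_chart (n : ℕ) : Differentiable ℝ (chart n) := by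
  have h0 : ∀ i j, Differentiable ℝ fun X : EE n => (1 + lowL n (Matrix.of X)) i j := by
    intro i j
    simp only [Matrix.add_apply, lowL_apply]
    split_ifs
    · simp only [Matrix.of_apply]; fun_prop
    · simp
  have h1 : ∀ i j, Differentiable ℝ fun X : EE n => (1 + lowL n (Matrix.of X))⁻¹ i j := by
    intro i j
    have : ∀ X : EE n, (1 + lowL n (Matrix.of X))⁻¹ = (1 + lowL n (Matrix.of X)).adjugate := by
      intro X
      rw [Matrix.inv_def, UL_det (UL_low _)]; simp
    simp_rw [this, Matrix.adjugate_apply]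
    apply diff_det
    intro k l
    by_cases hk : k = j
    · subst hk; simp
    · simp only [Matrix.updateRow_ne hk]; exact h0 _ _
  have h2 : ∀ i j, Differentiable ℝ fun X : EE n => (uppL n (Matrix.of X)) i j := by
    intro i j
    simp only [uppL_apply]
    split_ifs
    · simp only [Matrix.of_apply]; fun_prop
    · simp
  rw [differentiable_pi]; intro i
  rw [differentiable_pi]; intro j
  simp only [chart, Matrix.of_symm_apply, Matrix.mul_apply]
  refine Differentiable.fun_sum fun k _ => Differentiable.fun_mul ?_ (h1 _ _)
  exact Differentiable.fun_sum fun k _ => Differentiable.fun_mul (h0 _ _) (h2 _ _)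

noncomputable def chartD {n : ℕ} (X : EE n) : EE n →L[ℝ] EE n :=
  LinearMap.toContinuousLinearMap (toE
    (conjL (1 + lowL n (Matrix.of X)) (1 + lowL n (Matrix.of X))⁻¹ ∘ₗ
      PhiL (uppL n (Matrix.of X)) ∘ₗ PsiL (1 + lowL n (Matrix.of X))⁻¹))

theorem low_Psi {n : ℕ} {K : Matrix (Fin n) (Fin n) ℂ} (hK : UL K) (H : Matrix (Fin n) (Fin n) ℂ) :
    lowL n (PsiL K H) = K * lowL n H ∧ uppL n (PsiL K H) = uppL n H := by
  have h1 : ∀ i j, i ≤ j → (K * lowL n H) i j = 0 := by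
    intro i j hij
    rw [Matrix.mul_apply]
    refine Finset.sum_eq_zero fun k _ => ?_
    rcases lt_or_ge i k with h | h
    · rw [hK.2 _ _ h, zero_mul]
    · rw [lowL_apply, if_neg (not_lt.2 (h.trans hij)), mul_zero]
  constructor
  · ext i j
    rw [lowL_apply]
    simp only [PsiL, LinearMap.add_apply, LinearMap.comp_apply, LinearMap.mulLeft_apply, Matrix.add_apply]
    split_ifs with h
    · rw [uppL_apply, if_neg (not_le.2 h), zero_add]
    · rw [h1 i j (not_lt.1 h)]
  · ext i j
    rw [uppL_apply]
    simp only [PsiL, LinearMap.add_apply, LinearMap.comp_apply, LinearMap.mulLeft_apply, Matrix.add_apply]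
    split_ifs with h
    · rw [h1 i j h, add_zero]
    · rw [uppL_apply, if_neg h]

theorem hasFDerivAt_chart {n : ℕ} (X : EE n) : HasFDerivAt (chart n) (chartD X) X := by
  have hd := (diff_chart n X).hasFDerivAt
  have hG : HasFDerivAt (fun X : EE n => (Matrix.of.symm (1 + lowL n (Matrix.of X)) : EE n))
      (LinearMap.toContinuousLinearMap (toE (lowL n))) X := by
    have := (LinearMap.toContinuousLinearMap (toE (lowL n))).hasFDerivAt (x := X)
    exact this.const_add (Matrix.of.symm (1 : Matrix (Fin n) (Fin n) ℂ))
  have hT : HasFDerivAt (fun X : EE n => (Matrix.of.symm (uppL n (Matrix.of X)) : EE n))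
      (LinearMap.toContinuousLinearMap (toE (uppL n))) X :=
    (LinearMap.toContinuousLinearMap (toE (uppL n))).hasFDerivAt (x := X)
  have h1 := (mulB n).hasFDerivAt_of_bilinear hd hG
  have h2 := (mulB n).hasFDerivAt_of_bilinear hG hT
  have hunit : ∀ X : EE n, IsUnit (1 + lowL n (Matrix.of X)).det := fun X => by
    rw [UL_det (UL_low _)]; exact isUnit_one
  have heq : (fun X => mulB n (chart n X) (Matrix.of.symm (1 + lowL n (Matrix.of X)) : EE n)) =
      fun X => mulB n (Matrix.of.symm (1 + lowL n (Matrix.of X)) : EE n)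
        (Matrix.of.symm (uppL n (Matrix.of X)) : EE n) := by
    funext Y
    simp only [mulB_apply, chart, Equiv.apply_symm_apply]
    rw [nonsing_inv_mul_cancel_right _ _ (hunit Y)]
  rw [heq] at h1
  have h3 := h1.unique h2
  convert hd using 1
  ext1 H
  have h4 := congrArg (Matrix.of (α := ℂ)) (DFunLike.congr_fun h3 H)
  simp only [_root_.add_apply, ContinuousLinearMap.precompR_apply, ContinuousLinearMap.precompL_apply,
    mulB_apply, LinearMap.coe_toContinuousLinearMap', toE_apply, Equiv.apply_symm_apply] at h4
  apply (Matrix.of (α := ℂ)).injective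
  set g := 1 + lowL n (Matrix.of X) with hg
  set D := Matrix.of (fderiv ℝ (chart n) X H) with hD
  have h5 : D * g = g * uppL n (of H) + lowL n (of H) * uppL n (of X) - of (chart n X) * lowL n (of H) := by
    rw [eq_sub_iff_add_eq, add_comm]; exact h4
  have h6 : D = (g * uppL n (of H) + lowL n (of H) * uppL n (of X) - of (chart n X) * lowL n (of H)) * g⁻¹ := by
    rw [← h5, mul_nonsing_inv_cancel_right _ _ (hunit X)]
  rw [h6]
  obtain ⟨hp1, hp2⟩ := low_Psi (UL_inv (UL_low (of X))) (of H)
  simp only [chartD, LinearMap.coe_toContinuousLinearMap', toE_apply, Equiv.apply_symm_apply, chart,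
    LinearMap.comp_apply, conjL, PhiL, LinearMap.add_apply, LinearMap.sub_apply, LinearMap.mulLeft_apply,
    LinearMap.mulRight_apply]
  rw [hp1, hp2, ← hg, ← mul_assoc]
  congr 1
  have hgg : g * g⁻¹ = 1 := mul_nonsing_inv _ (hunit X)
  rw [mul_add, mul_sub]
  simp only [← mul_assoc, hgg, one_mul]
  abel

theorem det_chartD {n : ℕ} (X : EE n) :
    |(chartD X).det| = ∏ i, ∏ j, if i < j then ‖X i i - X j j‖ ^ 2 else 1 := by
  have : (chartD X).det = Complex.normSq (∏ i, ∏ j, if j < i then X j j - X i i else 1) := by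
    rw [chartD, LinearMap.det_toContinuousLinearMap, det_toE, LinearMap.det_comp, LinearMap.det_comp, det_conjL _ _
      (mul_nonsing_inv _ (by rw [UL_det (UL_low _)]; exact isUnit_one)), det_Phi (upp_tri _),
      det_Psi (UL_inv (UL_low _))]
    simp [upp_diag]
  rw [this, abs_of_nonneg (Complex.normSq_nonneg _), Finset.prod_comm]
  simp only [map_prod]
  refine Finset.prod_congr rfl fun i _ => Finset.prod_congr rfl fun j _ => ?_
  split_ifs
  · rw [Complex.normSq_eq_norm_sq]
  · simp

instance borelE1 (n : ℕ) : BorelSpace (Fin n → ℂ) := inferInstance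
instance borelEE (n : ℕ) : BorelSpace (EE n) := inferInstance
instance sctE1 (n : ℕ) : SecondCountableTopology (Fin n → ℂ) := inferInstance
instance sctEE (n : ℕ) : SecondCountableTopology (EE n) := inferInstance
instance haarE1 (n : ℕ) : (volume : Measure (Fin n → ℂ)).IsAddHaarMeasure := inferInstance
instance haarEE (n : ℕ) : (volume : Measure (EE n)).IsAddHaarMeasure := Measure.pi.isAddHaarMeasure _
instance openEE (n : ℕ) : OpensMeasurableSpace (EE n) := inferInstance
instance sfinEE (n : ℕ) : SigmaFinite (volume : Measure (EE n)) := inferInstance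

def SS {n : ℕ} (σ : Equiv.Perm (Fin n)) : Set (EE n) :=
  {X | StrictMono fun k => (X (σ k) (σ k)).re}

theorem meas_SS {n : ℕ} (σ : Equiv.Perm (Fin n)) : MeasurableSet (SS σ) := by
  have : SS σ = ⋂ (a : Fin n) (b : Fin n) (_ : a < b),
      {X : EE n | (X (σ a) (σ a)).re < (X (σ b) (σ b)).re} := by
    ext X; simp [SS, StrictMono]
  rw [this]
  refine MeasurableSet.iInter fun a => MeasurableSet.iInter fun b => MeasurableSet.iInter fun _ => ?_
  refine measurableSet_lt ?_ ?_ <;> fun_prop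

theorem eig_transfer {n : ℕ} {P T T' : Matrix (Fin n) (Fin n) ℂ} (hP : P.det ≠ 0)
    (hT : T.IsUpperTriangular) (hT' : T'.IsUpperTriangular) (h : P * T = T' * P) (i : Fin n) :
    ∃ j, T' j j = T i i := by
  have hu : ∀ {A : Matrix (Fin n) (Fin n) ℂ}, A.IsUpperTriangular →
      (A - T i i • (1 : Matrix (Fin n) (Fin n) ℂ)).IsUpperTriangular := by
    intro A hA
    refine hA.sub ?_
    intro a b hab
    have : b < a := hab
    simp [Matrix.one_apply_ne this.ne']
  have h1 : P * (T - T i i • (1 : Matrix (Fin n) (Fin n) ℂ)) =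
      (T' - T i i • (1 : Matrix (Fin n) (Fin n) ℂ)) * P := by
    rw [mul_sub, sub_mul, h]; simp
  have h2 := congrArg Matrix.det h1
  rw [det_mul, det_mul, det_of_isUpperTriangular (hu hT), det_of_isUpperTriangular (hu hT'),
    Finset.prod_eq_zero (Finset.mem_univ i) (by simp), mul_zero] at h2
  have h3 := (mul_eq_zero.1 h2.symm).resolve_right hP
  obtain ⟨j, -, hj⟩ := Finset.prod_eq_zero_iff.1 h3
  refine ⟨j, ?_⟩
  simpa [sub_eq_zero] using hj

theorem inj_chart {n : ℕ} (σ : Equiv.Perm (Fin n)) : Set.InjOn (chart n) (SS σ) := by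
  intro X hX Y hY hXY
  have hXY' : (1 + lowL n (Matrix.of X)) * uppL n (Matrix.of X) * (1 + lowL n (Matrix.of X))⁻¹ =
    (1 + lowL n (Matrix.of Y)) * uppL n (Matrix.of Y) * (1 + lowL n (Matrix.of Y))⁻¹ := hXY
  set g := 1 + lowL n (Matrix.of X) with hg
  set g' := 1 + lowL n (Matrix.of Y) with hg'
  have hgu : IsUnit g.det := by rw [UL_det (UL_low _)]; exact isUnit_one
  have hgu' : IsUnit g'.det := by rw [UL_det (UL_low _)]; exact isUnit_one
  have hP : UL (g'⁻¹ * g) := UL_mul (UL_inv (UL_low _)) (UL_low _)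
  have hPT : (g'⁻¹ * g) * uppL n (Matrix.of X) = uppL n (Matrix.of Y) * (g'⁻¹ * g) := by
    have h1 := congrArg (fun Z => g'⁻¹ * (Z * g)) hXY'
    beta_reduce at h1
    rw [nonsing_inv_mul_cancel_right _ _ hgu] at h1
    rw [mul_assoc, h1]
    simp only [mul_assoc]
    rw [nonsing_inv_mul_cancel_left _ _ hgu']
  have hPd : (g'⁻¹ * g).det ≠ 0 := by rw [UL_det hP]; exact one_ne_zero
  have e1 : ∀ i, ∃ j, Y j j = X i i := by
    intro i
    obtain ⟨j, hj⟩ := eig_transfer hPd (upp_tri _) (upp_tri _) hPT i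
    rw [upp_diag, upp_diag] at hj
    exact ⟨j, hj⟩
  have hQ : UL (g⁻¹ * g') := UL_mul (UL_inv (UL_low _)) (UL_low _)
  have hQT : (g⁻¹ * g') * uppL n (Matrix.of Y) = uppL n (Matrix.of X) * (g⁻¹ * g') := by
    have h1 := congrArg (fun Z => g⁻¹ * (Z * g')) hXY'.symm
    beta_reduce at h1
    rw [nonsing_inv_mul_cancel_right _ _ hgu'] at h1
    rw [mul_assoc, h1]
    simp only [mul_assoc]
    rw [nonsing_inv_mul_cancel_left _ _ hgu]
  have e2 : ∀ i, ∃ j, X j j = Y i i := by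
    intro i
    obtain ⟨j, hj⟩ := eig_transfer (by rw [UL_det hQ]; exact one_ne_zero) (upp_tri _) (upp_tri _) hQT i
    rw [upp_diag, upp_diag] at hj
    exact ⟨j, hj⟩
  have hre : (fun k => (X (σ k) (σ k)).re) = fun k => (Y (σ k) (σ k)).re := by
    refine (StrictMono.range_inj hX hY).1 ?_
    ext r
    constructor
    · rintro ⟨k, rfl⟩
      obtain ⟨j, hj⟩ := e1 (σ k)
      exact ⟨σ.symm j, by simp [hj]⟩
    · rintro ⟨k, rfl⟩
      obtain ⟨j, hj⟩ := e2 (σ k)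
      exact ⟨σ.symm j, by simp [hj]⟩
  have hre' : ∀ i, (X i i).re = (Y i i).re := by
    intro i
    have := congrFun hre (σ.symm i)
    simpa using this
  have hXinj : ∀ i j, (X i i).re = (X j j).re → i = j := by
    intro i j hij
    have := (StrictMono.injective hX) (a₁ := σ.symm i) (a₂ := σ.symm j) (by simpa using hij)
    exact σ.symm.injective this
  have hdd : ∀ i, X i i = Y i i := by
    intro i
    obtain ⟨j, hj⟩ := e1 i
    have : i = j := hXinj _ _ (by rw [hre' j, hj])
    rw [← hj, this]
  have hP1 := inj_core hP (upp_tri _) (upp_tri _) (fun i => by rw [upp_diag, upp_diag]; exact hdd i)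
    (fun i j h => by
      rw [upp_diag, upp_diag] at h
      exact hXinj i j (congrArg Complex.re h)) hPT
  have hgg : g = g' := by
    have := congrArg (fun Z => g' * Z) hP1
    simpa [mul_nonsing_inv_cancel_left _ _ hgu'] using this
  rw [hP1, one_mul, mul_one] at hPT
  have hlow : lowL n (Matrix.of X) = lowL n (Matrix.of Y) := by
    rw [hg, hg'] at hgg; exact add_left_cancel hgg
  apply (Matrix.of (α := ℂ)).injective
  rw [← low_add_upp (Matrix.of X), ← low_add_upp (Matrix.of Y), hlow, hPT]

theorem mp_toE {n : ℕ} (φ : Matrix (Fin n) (Fin n) ℂ →ₗ[ℂ] Matrix (Fin n) (Fin n) ℂ)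
    (h : LinearMap.det φ = 1) : MeasurePreserving (toE φ) volume volume := by
  refine ⟨(LinearMap.continuous_of_finiteDimensional _).measurable, ?_⟩
  have hd : LinearMap.det (toE φ) = 1 := by rw [det_toE, h]; simp
  rw [Measure.map_linearMap_addHaar_eq_smul_addHaar _ (by rw [hd]; exact one_ne_zero), hd]
  simp

theorem ae_toE {n : ℕ} (φ : Matrix (Fin n) (Fin n) ℂ →ₗ[ℂ] Matrix (Fin n) (Fin n) ℂ)
    (h : LinearMap.det φ ≠ 0) {p : EE n → Prop} (hp : ∀ᵐ X, p X) : ∀ᵐ X, p (toE φ X) := by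
  have hd : LinearMap.det (toE φ) ≠ 0 := by rw [det_toE]; simpa using h
  have hm : Measurable (toE φ) := (LinearMap.continuous_of_finiteDimensional _).measurable
  have h1 := Measure.map_linearMap_addHaar_eq_smul_addHaar (volume : Measure (EE n)) hd
  refine ae_of_ae_map (f := toE φ) hm.aemeasurable ?_
  rw [h1]
  exact Measure.ae_smul_measure hp _

theorem ae_minor {n : ℕ} (p : Fin n → Prop) [DecidablePred p] :
    ∀ᵐ A : EE n, ((Matrix.of A).submatrix (Subtype.val : {k // p k} → Fin n)
      (Subtype.val : {k // p k} → Fin n)).det ≠ 0 := by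
  let D : EE n → ℂ := fun A => ((Matrix.of A).submatrix (Subtype.val : {k // p k} → Fin n)
      (Subtype.val : {k // p k} → Fin n)).det
  have hDc : Continuous D := by
    refine Continuous.matrix_det ?_
    refine Continuous.matrix_submatrix ?_ _ _
    exact continuous_id
  let sc : ℂ → EE n := fun t => Matrix.of.symm (t • (1 : Matrix (Fin n) (Fin n) ℂ))
  have hsc : Continuous sc := by
    refine continuous_pi fun i => continuous_pi fun j => ?_
    simp only [sc, Matrix.of_symm_apply, Matrix.smul_apply]
    fun_prop
  have h1 : ∀ A : EE n, ∀ᵐ t : ℂ, D (A + sc t) ≠ 0 := by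
    intro A
    set B := (Matrix.of A).submatrix (Subtype.val : {k // p k} → Fin n)
      (Subtype.val : {k // p k} → Fin n) with hB
    have h2 : ∀ t, D (A + sc t) = (-B).charpoly.eval t := by
      intro t
      rw [Matrix.eval_charpoly]
      show Matrix.det _ = Matrix.det _
      congr 1
      ext i j
      simp [sc, hB, Matrix.scalar_apply, Matrix.one_apply, Matrix.diagonal_apply, Subtype.ext_iff, add_comm]
    have h3 : {t : ℂ | ¬ D (A + sc t) ≠ 0}.Finite := by
      refine ((-B).charpoly.roots.toFinset.finite_toSet).subset ?_
      intro t ht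
      simp only [not_not, Set.mem_ofPred_eq] at ht
      rw [h2] at ht
      simp [Polynomial.mem_roots (Matrix.charpoly_monic (-B)).ne_zero, Polynomial.IsRoot, ht]
    rw [ae_iff]
    exact h3.measure_zero _
  have h2 : ∀ᵐ t : ℂ, ∀ᵐ A : EE n, D (A + sc t) ≠ 0 := by
    rw [Measure.ae_ae_comm]
    · exact Filter.Eventually.of_forall h1
    · refine (IsOpen.measurableSet ?_)
      refine isOpen_ne_fun ?_ continuous_const
      exact hDc.comp (continuous_snd.add (hsc.comp continuous_fst))
  obtain ⟨t, ht⟩ := h2.exists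
  have h3 := measurePreserving_add_right (volume : Measure (EE n)) (sc t)
  rw [← h3.map_eq, ae_map_iff h3.measurable.aemeasurable]
  · exact ht
  · exact (isOpen_ne_fun hDc continuous_const).measurableSet

theorem meas_inv {n : ℕ} : Measurable fun G : EE n => (Matrix.of.symm (Matrix.of G)⁻¹ : EE n) := by
  refine measurable_pi_lambda _ fun i => measurable_pi_lambda _ fun j => ?_
  simp only [Matrix.of_symm_apply, Matrix.inv_def, Matrix.smul_apply, Ring.inverse_eq_inv', smul_eq_mul]
  refine Measurable.mul (Measurable.inv ?_) ?_
  · have : Continuous fun G : EE n => (Matrix.of G).det := Continuous.matrix_det continuous_id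
    exact this.measurable
  · have : Continuous fun G : EE n => (Matrix.of G).adjugate := Continuous.matrix_adjugate continuous_id
    exact (this.matrix_elem i j).measurable

theorem meas_mul {n : ℕ} {α : Type*} [MeasurableSpace α] {A B : α → EE n} (hA : Measurable A)
    (hB : Measurable B) : Measurable fun x => (Matrix.of.symm (Matrix.of (A x) * Matrix.of (B x)) : EE n) := by
  refine measurable_pi_lambda _ fun i => measurable_pi_lambda _ fun j => ?_
  simp only [Matrix.of_symm_apply, Matrix.mul_apply, Matrix.of_apply]
  fun_prop

def NN (n : ℕ) : Set (EE n) := {X | ∃ i j, i ≠ j ∧ (X i i).re = (X j j).re}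

theorem null_NN (n : ℕ) : volume (NN n) = 0 := by
  have : NN n = ⋃ (i : Fin n) (j : Fin n) (_ : i ≠ j), {X : EE n | (X i i).re = (X j j).re} := by
    ext X; simp [NN]
  rw [this]
  refine measure_iUnion_null fun i => measure_iUnion_null fun j => measure_iUnion_null fun hij => ?_
  let φ : EE n →ₗ[ℝ] ℝ :=
    { toFun := fun X => (X i i).re - (X j j).re
      map_add' := by intro X Y; simp; ring
      map_smul' := by intro r X; simp; ring }
  have h1 : {X : EE n | (X i i).re = (X j j).re} = (LinearMap.ker φ : Set (EE n)) := by
    ext X; simp [φ, sub_eq_zero]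
  rw [h1]
  refine Measure.addHaar_submodule _ _ ?_
  intro htop
  have : (Pi.single i (Pi.single i 1) : EE n) ∈ LinearMap.ker φ := by rw [htop]; trivial
  simp [φ, hij.symm] at this

theorem exists_form {n : ℕ} (σ : Equiv.Perm (Fin n)) (M : Matrix (Fin n) (Fin n) ℂ) :
    ∃ g T : Matrix (Fin n) (Fin n) ℂ, IsUnit g.det ∧ T.IsUpperTriangular ∧ M * g = g * T ∧
      ((StrictMono fun k => (T (σ k) (σ k)).re) ∨ ∃ i j, i ≠ j ∧ (T i i).re = (T j j).re) := by
  obtain ⟨g, T, hg, hT, hM⟩ := exists_tri M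
  by_cases hd : ∃ i j, i ≠ j ∧ (T i i).re = (T j j).re
  · exact ⟨g, T, hg, hT, hM, Or.inr hd⟩
  · have hinj : ∀ i j, (T i i).re = (T j j).re → i = j := by
      intro i j h; by_contra hne; exact hd ⟨i, j, hne, h⟩
    set s := Tuple.sort (fun i => (T i i).re) with hs
    obtain ⟨g', hg', hM'⟩ := exists_diag hg hT hM (fun i j h => hinj i j (congrArg Complex.re h))
      (σ.symm.trans s)
    refine ⟨g', _, hg', Matrix.blockTriangular_diagonal _, hM', Or.inl ?_⟩
    have h1 : Monotone ((fun i => (T i i).re) ∘ s) := Tuple.monotone_sort _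
    have h2 : StrictMono ((fun i => (T i i).re) ∘ s) :=
      h1.strictMono_of_injective (fun a b h => s.injective (hinj _ _ h))
    intro a b hab
    simpa using h2 hab

theorem conull_chart {n : ℕ} (σ : Equiv.Perm (Fin n)) : ∀ᵐ M : EE n, M ∈ chart n '' SS σ := by
  have hN : volume (chart n '' NN n) = 0 :=
    addHaar_image_eq_zero_of_differentiableOn_of_addHaar_eq_zero volume
      (diff_chart n).differentiableOn (null_NN n)
  have hSm : MeasurableSet (chart n '' SS σ) :=
    measurable_image_of_fderivWithin (meas_SS σ)
      (fun X _ => (hasFDerivAt_chart X).hasFDerivWithinAt) (inj_chart σ)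
  set W := chart n '' SS σ ∪ toMeasurable volume (chart n '' NN n) with hW
  have hWm : MeasurableSet W := hSm.union (measurableSet_toMeasurable _ _)
  have hdet : ∀ᵐ G : EE n, (Matrix.of G).det ≠ 0 := by
    filter_upwards [ae_minor (n := n) (fun _ => True)] with G hG
    have := Matrix.det_submatrix_equiv_self (Equiv.subtypeUnivEquiv (p := fun _ : Fin n => True) (fun _ => trivial)) (Matrix.of G)
    rw [← this]; exact hG
  have hmin : ∀ᵐ A : EE n, ∀ i : Fin n, ((Matrix.of A).submatrix (Subtype.val : {k // k < i} → Fin n)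
      (Subtype.val : {k // k < i} → Fin n)).det ≠ 0 := by
    rw [ae_all_iff]; intro i; exact ae_minor _
  have key : ∀ M : EE n, ∀ᵐ G : EE n, (Matrix.of.symm (Matrix.of G * Matrix.of M * (Matrix.of G)⁻¹) : EE n) ∈ W := by
    intro M
    obtain ⟨g, T, hg, hT, hM, hor⟩ := exists_form σ (Matrix.of M)
    have hmin' := ae_toE (LinearMap.mulRight ℂ g) (by rw [det_mulR]; exact pow_ne_zero _ hg.ne_zero) hmin
    filter_upwards [hmin', hdet] with G hG hGd
    have hGu : IsUnit (Matrix.of G).det := isUnit_iff_ne_zero.2 hGd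
    obtain ⟨l, b, hl, hb, hlb⟩ := exists_LU _ hG
    have hlb' : Matrix.of G * g = l * b := hlb
    have hlu : IsUnit l.det := by rw [UL_det hl]; exact isUnit_one
    have hbu : IsUnit b.det := by
      have h1 := congrArg Matrix.det hlb'
      rw [det_mul, det_mul, UL_det hl, one_mul] at h1
      rw [← h1]; exact hGu.mul hg
    have hT' : (b * T * b⁻¹).IsUpperTriangular := (hb.mul hT).mul (upper_inv hb hbu)
    have hTd : ∀ i, (b * T * b⁻¹) i i = T i i := by
      intro i
      rw [upper_mul_diag (hb.mul hT) (upper_inv hb hbu), upper_mul_diag hb hT]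
      have := upper_mul_diag hb (upper_inv hb hbu) i
      rw [mul_nonsing_inv _ hbu, Matrix.one_apply_eq] at this
      linear_combination (- T i i) * this
    set X : EE n := Matrix.of.symm (l - 1 + b * T * b⁻¹) with hX
    have hlow1 : lowL n (l - 1) = l - 1 := by
      ext i j
      rw [lowL_apply]
      split_ifs with h
      · rfl
      · rcases (not_lt.1 h).lt_or_eq with h' | h'
        · simp [hl.2 _ _ h', Matrix.one_apply_ne h'.ne]
        · subst h'; simp [hl.1]
    have hupp1 : uppL n (l - 1) = 0 := by
      have := low_add_upp (l - 1)
      rw [hlow1] at this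
      exact add_eq_left.1 this
    have hXl : 1 + lowL n (Matrix.of X) = l := by
      rw [hX, Equiv.apply_symm_apply, map_add, hlow1, low_of_tri hT']; simp
    have hXu : uppL n (Matrix.of X) = b * T * b⁻¹ := by
      rw [hX, Equiv.apply_symm_apply, map_add, hupp1, upp_of_tri hT']; simp
    have hch : chart n X = Matrix.of.symm (Matrix.of G * Matrix.of M * (Matrix.of G)⁻¹) := by
      rw [chart, hXl, hXu]
      congr 1
      have hM' : Matrix.of M = g * T * g⁻¹ := by rw [← hM, mul_nonsing_inv_cancel_right _ _ hg]
      have hinv : l⁻¹ = b * (Matrix.of G * g)⁻¹ := by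
        rw [hlb', Matrix.mul_inv_rev, mul_nonsing_inv_cancel_left _ _ hbu]
      rw [hinv, Matrix.mul_inv_rev, hM']
      have h1 : l * (b * T * b⁻¹) * (b * (g⁻¹ * (Matrix.of G)⁻¹)) = (l * b) * T * (b⁻¹ * b) * (g⁻¹ * (Matrix.of G)⁻¹) := by
        simp only [mul_assoc]
      rw [h1, nonsing_inv_mul _ hbu, ← hlb']
      simp only [mul_assoc, one_mul]
    have hXd : ∀ i, X i i = T i i := by
      intro i
      have : X i i = (l - 1 + b * T * b⁻¹) i i := rfl
      rw [this, Matrix.add_apply, hTd]; simp [hl.1]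
    rw [← hch]
    rcases hor with h | h
    · left
      refine ⟨X, ?_, rfl⟩
      simpa [SS, hXd] using h
    · right
      refine subset_toMeasurable _ _ ⟨X, ?_, rfl⟩
      simpa [NN, hXd] using h
  have key2 : ∀ᵐ G : EE n, ∀ᵐ M : EE n, (Matrix.of.symm (Matrix.of G * Matrix.of M * (Matrix.of G)⁻¹) : EE n) ∈ W := by
    rw [Measure.ae_ae_comm]
    · exact Filter.Eventually.of_forall key
    · have hm : Measurable fun p : EE n × EE n => (Matrix.of.symm (Matrix.of p.1 * Matrix.of p.2 * (Matrix.of p.1)⁻¹) : EE n) :=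
        meas_mul (meas_mul measurable_fst measurable_snd) (meas_inv.comp measurable_fst)
      exact hm hWm
  obtain ⟨G, hG, hGd⟩ := (key2.and hdet).exists
  have hmp := mp_toE _ (det_conjL (Matrix.of G) (Matrix.of G)⁻¹ (mul_nonsing_inv _ (isUnit_iff_ne_zero.2 hGd)))
  have hWae : ∀ᵐ M : EE n, M ∈ W := by
    rw [← hmp.map_eq]
    refine (ae_map_iff hmp.measurable.aemeasurable hWm).2 ?_
    filter_upwards [hG] with M hM
    have : toE (conjL (Matrix.of G) (Matrix.of G)⁻¹) M = Matrix.of.symm (Matrix.of G * Matrix.of M * (Matrix.of G)⁻¹) := by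
      rw [toE_apply]
      simp [conjL, mul_assoc]
    rw [this]; exact hM
  have hn : ∀ᵐ M : EE n, M ∉ toMeasurable volume (chart n '' NN n) := by
    rw [ae_iff]
    simp only [not_not, Set.ofPred_mem_eq]
    rw [measure_toMeasurable, hN]
  filter_upwards [hWae, hn] with M h1 h2
  exact h1.resolve_right h2

noncomputable def vand {n : ℕ} (d : Fin n → ℂ) : ℝ :=
  ∏ i : Fin n, ∏ j : Fin n, if i < j then ‖d i - d j‖ ^ 2 else 1

theorem main_cov {n : ℕ} (σ : Equiv.Perm (Fin n)) (F : EE n → ℝ≥0∞) :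
    ∫⁻ M, F M = ∫⁻ X in SS σ, ENNReal.ofReal (vand fun i => X i i) * F (chart n X) := by
  have h := lintegral_image_eq_lintegral_abs_det_fderiv_mul volume (meas_SS σ)
      (fun X _ => (hasFDerivAt_chart X).hasFDerivWithinAt) (inj_chart σ) F
  simp_rw [det_chartD] at h
  rw [Measure.restrict_eq_self_of_ae_mem (conull_chart σ)] at h
  exact h

theorem lint_pi {n : ℕ} {α : Type} [MeasurableSpace α] (μ : Fin n → Measure α)
    [∀ i, SigmaFinite (μ i)] (f : Fin n → α → ℝ≥0∞) (hf : ∀ i, Measurable (f i)) :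
    ∫⁻ x, ∏ i, f i (x i) ∂(Measure.pi μ) = ∏ i, ∫⁻ x, f i x ∂(μ i) := by
  induction n with
  | zero => simp
  | succ n ih =>
    have h1 := (measurePreserving_piFinSuccAbove μ 0)
    have h2 : ∫⁻ x, ∏ i, f i (x i) ∂(Measure.pi μ) =
        ∫⁻ p, f 0 p.1 * ∏ i : Fin n, f i.succ (p.2 i)
          ∂((μ 0).prod (Measure.pi fun j => μ ((0 : Fin (n+1)).succAbove j))) := by
      rw [← h1.lintegral_comp_emb (MeasurableEquiv.measurableEmbedding _)]
      refine lintegral_congr fun x => ?_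
      rw [Fin.prod_univ_succ]
      rfl
    have hg : Measurable fun x : Fin n → α => ∏ i : Fin n, f i.succ (x i) := by
      refine Finset.measurable_prod _ fun i _ => ?_
      exact (hf _).comp (measurable_pi_apply i)
    rw [h2, Fin.prod_univ_succ]
    refine (lintegral_prod_mul (hf 0).aemeasurable hg.aemeasurable).trans ?_
    congr 1
    exact ih (fun j => μ ((0 : Fin (n+1)).succAbove j)) (fun i => f i.succ) (fun i => hf _)

theorem pi_wd {n : ℕ} {α : Type} [MeasurableSpace α] (μ : Fin n → Measure α)
    [∀ i, SigmaFinite (μ i)] (f : Fin n → α → ℝ≥0∞) (hf : ∀ i, Measurable (f i))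
    [∀ i, SigmaFinite ((μ i).withDensity (f i))] :
    Measure.pi (fun i => (μ i).withDensity (f i)) =
      (Measure.pi μ).withDensity (fun x => ∏ i, f i (x i)) := by
  refine Measure.pi_eq fun s hs => ?_
  rw [withDensity_apply _ (MeasurableSet.univ_pi hs), Measure.restrict_pi_pi, lint_pi _ _ hf]
  refine Finset.prod_congr rfl fun i _ => ?_
  rw [withDensity_apply _ (hs i)]

theorem pi_add {n : ℕ} {α : Type} [MeasurableSpace α] [Add α] [MeasurableAdd₂ α]
    (a b : Fin n → Measure α) [∀ i, SigmaFinite (a i)] [∀ i, SigmaFinite (b i)]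
    [∀ i, SigmaFinite (((a i).prod (b i)).map fun p => p.1 + p.2)] :
    Measure.pi (fun i => ((a i).prod (b i)).map fun p => p.1 + p.2) =
      ((Measure.pi a).prod (Measure.pi b)).map fun p => p.1 + p.2 := by
  have hm : Measurable fun p : α × α => p.1 + p.2 := measurable_fst.add measurable_snd
  rw [← Measure.pi_map_pi (fun i => hm.aemeasurable),
    ← (measurePreserving_arrowProdEquivProdArrow α α (Fin n) a b).map_eq, Measure.map_map]
  · rfl
  · exact measurable_fst.add measurable_snd
  · exact MeasurableEquiv.measurable _

noncomputable def mu1 (p : Prop) [Decidable p] : Measure ℂ := if p then volume else Measure.dirac 0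

instance (p : Prop) [Decidable p] : SigmaFinite (mu1 p) := by
  unfold mu1; split_ifs <;> infer_instance

theorem mu1_add (p q : Prop) [Decidable p] [Decidable q] (h : ¬ (p ∧ q)) :
    ((mu1 p).prod (mu1 q)).map (fun x => x.1 + x.2) = mu1 (p ∨ q) := by
  have hm : Measurable fun p : ℂ × ℂ => p.1 + p.2 := measurable_fst.add measurable_snd
  by_cases hp : p
  · have hq : ¬ q := fun hq => h ⟨hp, hq⟩
    simp only [mu1, hp, hq, if_true, if_false, true_or]
    rw [Measure.prod_dirac, Measure.map_map hm (by fun_prop)]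
    simp [Function.comp_def]
  · by_cases hq : q
    · simp only [mu1, hp, hq, if_true, if_false, or_true]
      rw [Measure.dirac_prod, Measure.map_map hm (by fun_prop)]
      simp [Function.comp_def]
    · simp only [mu1, hp, hq, if_false, or_false]
      rw [Measure.dirac_prod, Measure.map_map hm (by fun_prop)]
      simp [Function.comp_def]

noncomputable def muP {n : ℕ} (P : Fin n → Fin n → Prop) [∀ i j, Decidable (P i j)] :
    Measure (EE n) := Measure.pi fun i => Measure.pi fun j => mu1 (P i j)

instance {n : ℕ} (P : Fin n → Fin n → Prop) [∀ i j, Decidable (P i j)] : SigmaFinite (muP P) := by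
  unfold muP; infer_instance

theorem muP_add {n : ℕ} (P Q : Fin n → Fin n → Prop) [∀ i j, Decidable (P i j)]
    [∀ i j, Decidable (Q i j)] (h : ∀ i j, ¬ (P i j ∧ Q i j)) :
    ((muP P).prod (muP Q)).map (fun x => x.1 + x.2) = muP fun i j => P i j ∨ Q i j := by
  have e1 : ∀ i, ((Measure.pi fun j => mu1 (P i j)).prod (Measure.pi fun j => mu1 (Q i j))).map
      (fun x => x.1 + x.2) = Measure.pi fun j => mu1 (P i j ∨ Q i j) := by
    intro i
    have : ∀ j, SigmaFinite (((mu1 (P i j)).prod (mu1 (Q i j))).map (fun x => x.1 + x.2)) := by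
      intro j; rw [mu1_add _ _ (h i j)]; infer_instance
    rw [← pi_add]
    congr 1
    funext j
    exact mu1_add _ _ (h i j)
  have : ∀ i, SigmaFinite (((Measure.pi fun j => mu1 (P i j)).prod
      (Measure.pi fun j => mu1 (Q i j))).map (fun x => x.1 + x.2)) := by
    intro i; rw [e1]; infer_instance
  unfold muP
  rw [← pi_add]
  congr 1
  funext i
  exact e1 i

theorem muP_congr {n : ℕ} {P Q : Fin n → Fin n → Prop} [∀ i j, Decidable (P i j)]
    [∀ i j, Decidable (Q i j)] (h : ∀ i j, P i j ↔ Q i j) : muP P = muP Q := by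
  unfold muP mu1
  simp only [h]

theorem muP_all {n : ℕ} {P : Fin n → Fin n → Prop} [∀ i j, Decidable (P i j)]
    (h : ∀ i j, P i j) : muP P = volume := by
  unfold muP mu1
  simp only [h, if_true]
  rfl

theorem muP_ae {n : ℕ} (P : Fin n → Fin n → Prop) [∀ i j, Decidable (P i j)] :
    ∀ᵐ X ∂(muP P), ∀ i j, ¬ P i j → X i j = 0 := by
  rw [ae_all_iff]; intro i
  rw [ae_all_iff]; intro j
  by_cases h : P i j
  · exact Filter.Eventually.of_forall fun X hX => absurd h hX
  have h1 : ∀ᵐ z ∂(mu1 (P i j)), z = 0 := by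
    simp [mu1, h]
  have h2 := (Measure.quasiMeasurePreserving_eval (fun j => mu1 (P i j)) j).ae h1
  have h3 := (Measure.quasiMeasurePreserving_eval (fun i => Measure.pi fun j => mu1 (P i j)) i).ae h2
  filter_upwards [h3] with X hX _
  exact hX

theorem muP_single {n : ℕ} (i : Fin n) :
    (Measure.pi fun j => mu1 (i = j)) = (volume : Measure ℂ).map (fun z => (Pi.single i z : Fin n → ℂ)) := by
  have hm : Measurable (fun z : ℂ => (Pi.single i z : Fin n → ℂ)) := by
    refine measurable_pi_lambda _ fun j => ?_
    by_cases h : j = i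
    · subst h; simp; fun_prop
    · simp [h]
  refine Measure.pi_eq fun s hs => ?_
  rw [Measure.map_apply hm (MeasurableSet.univ_pi hs), ← Finset.mul_prod_erase _ _ (Finset.mem_univ i)]
  have hii : mu1 (i = i) = volume := by simp [mu1]
  rw [hii]
  by_cases h0 : ∀ j, j ≠ i → (0 : ℂ) ∈ s j
  · have e1 : (fun z : ℂ => (Pi.single i z : Fin n → ℂ)) ⁻¹' (Set.univ.pi s) = s i := by
      ext z
      simp only [Set.mem_preimage, Set.mem_pi, Set.mem_univ, true_imp_iff]
      constructor
      · intro h; simpa using h i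
      · intro h j
        by_cases hj : j = i
        · subst hj; simpa using h
        · simpa [hj] using h0 j hj
    rw [e1, Finset.prod_eq_one, mul_one]
    intro j hj
    have hj' : j ≠ i := Finset.ne_of_mem_erase hj
    simp [mu1, hj'.symm, h0 j hj', hs j]
  · push Not at h0
    obtain ⟨j, hj, hj0⟩ := h0
    have e1 : (fun z : ℂ => (Pi.single i z : Fin n → ℂ)) ⁻¹' (Set.univ.pi s) = ∅ := by
      ext z
      simp only [Set.mem_preimage, Set.mem_pi, Set.mem_univ, true_imp_iff, Set.mem_empty_iff_false, iff_false]
      intro h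
      have := h j
      simp [hj] at this
      exact hj0 this
    rw [e1, Finset.prod_eq_zero (Finset.mem_erase.2 ⟨hj, Finset.mem_univ j⟩), mul_zero, measure_empty]
    simp [mu1, hj.symm, hj0, hs j]

theorem muP_diag {n : ℕ} : (muP fun i j : Fin n => i = j) =
    (volume : Measure (Fin n → ℂ)).map (fun d => (Matrix.of.symm (Matrix.diagonal d) : EE n)) := by
  unfold muP
  have hm : ∀ i, Measurable (fun z : ℂ => (Pi.single i z : Fin n → ℂ)) := by
    intro i
    refine measurable_pi_lambda _ fun j => ?_
    by_cases h : j = i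
    · subst h; simp; fun_prop
    · simp [h]
  have : ∀ i, SigmaFinite ((volume : Measure ℂ).map (fun z => (Pi.single i z : Fin n → ℂ))) := by
    intro i; rw [← muP_single]; infer_instance
  simp_rw [muP_single]
  rw [← Measure.pi_map_pi (fun i => (hm i).aemeasurable)]
  congr 1
  funext d
  ext i j
  by_cases h : i = j
  · subst h; simp
  · simp [h, Ne.symm h]

noncomputable def muLow (n : ℕ) : Measure (EE n) := muP fun i j => j < i
noncomputable def muUp (n : ℕ) : Measure (EE n) := muP fun i j => i ≤ j
noncomputable def muSU (n : ℕ) : Measure (EE n) := muP fun i j => i < j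
instance (n : ℕ) : SigmaFinite (muLow n) := by unfold muLow; infer_instance
instance (n : ℕ) : SigmaFinite (muUp n) := by unfold muUp; infer_instance
instance (n : ℕ) : SigmaFinite (muSU n) := by unfold muSU; infer_instance

theorem meas_toE {n : ℕ} (φ : Matrix (Fin n) (Fin n) ℂ →ₗ[ℂ] Matrix (Fin n) (Fin n) ℂ) :
    Measurable (toE φ) := (LinearMap.continuous_of_finiteDimensional _).measurable

theorem split_LU {n : ℕ} {G : EE n → ℝ≥0∞} (hG : Measurable G) :
    ∫⁻ X, G X = ∫⁻ L, ∫⁻ T, G (L + T) ∂(muUp n) ∂(muLow n) := by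
  have h1 : ((muLow n).prod (muUp n)).map (fun x => x.1 + x.2) = (volume : Measure (EE n)) := by
    unfold muLow muUp
    rw [muP_add _ _ (fun i j => by simp)]
    exact muP_all (fun i j => lt_or_ge _ _)
  have hm : Measurable fun x : EE n × EE n => x.1 + x.2 := measurable_fst.add measurable_snd
  have hGm : Measurable fun x : EE n × EE n => G (x.1 + x.2) := hG.comp hm
  rw [← h1, lintegral_map hG hm, lintegral_prod _ hGm.aemeasurable]

theorem split_DU {n : ℕ} {G : EE n → ℝ≥0∞} (hG : Measurable G) :
    ∫⁻ T, G T ∂(muUp n) = ∫⁻ d : Fin n → ℂ, ∫⁻ S, G (Matrix.of.symm (Matrix.diagonal d) + S) ∂(muSU n) := by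
  have h1 : ((muP fun i j : Fin n => i = j).prod (muSU n)).map (fun x => x.1 + x.2) = muUp n := by
    unfold muSU muUp
    rw [muP_add _ _ (fun i j => by rintro ⟨rfl, h⟩; exact lt_irrefl _ h)]
    exact muP_congr (fun i j => by rw [le_iff_eq_or_lt])
  have hm : Measurable fun x : EE n × EE n => x.1 + x.2 := measurable_fst.add measurable_snd
  have hd : Measurable (fun d : Fin n → ℂ => (Matrix.of.symm (Matrix.diagonal d) : EE n)) := by
    refine measurable_pi_lambda _ fun i => measurable_pi_lambda _ fun j => ?_
    by_cases h : i = j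
    · subst h; simp; fun_prop
    · simp [h]
  have hGm : Measurable fun x : EE n × EE n => G (x.1 + x.2) := hG.comp hm
  rw [← h1, lintegral_map hG hm, lintegral_prod _ hGm.aemeasurable, muP_diag,
    lintegral_map _ hd]
  exact hGm.lintegral_prod_right'

theorem ae_low {n : ℕ} : ∀ᵐ L ∂(muLow n), toE (lowL n) L = L ∧ toE (uppL n) L = 0 := by
  filter_upwards [muP_ae fun i j : Fin n => j < i] with L hL
  constructor
  · ext i j
    show lowL n (Matrix.of L) i j = _
    rw [lowL_apply]
    split_ifs with h
    · rfl
    · exact (hL _ _ h).symm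
  · ext i j
    show uppL n (Matrix.of L) i j = _
    rw [uppL_apply]
    split_ifs with h
    · exact (hL _ _ h.not_gt)
    · rfl

theorem ae_up {n : ℕ} : ∀ᵐ T ∂(muUp n), toE (lowL n) T = 0 ∧ toE (uppL n) T = T := by
  filter_upwards [muP_ae fun i j : Fin n => i ≤ j] with L hL
  constructor
  · ext i j
    show lowL n (Matrix.of L) i j = _
    rw [lowL_apply]
    split_ifs with h
    · exact (hL _ _ h.not_ge)
    · rfl
  · ext i j
    show uppL n (Matrix.of L) i j = _
    rw [uppL_apply]
    split_ifs with h
    · rfl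
    · exact (hL _ _ h).symm

theorem split_mul {n : ℕ} {χ H : EE n → ℝ≥0∞} (hχ : Measurable χ) (hH : Measurable H) :
    ∫⁻ X, χ (toE (lowL n) X) * H (toE (uppL n) X) = (∫⁻ L, χ L ∂(muLow n)) * ∫⁻ T, H T ∂(muUp n) := by
  have hm : Measurable fun X => χ (toE (lowL n) X) * H (toE (uppL n) X) :=
    (hχ.comp (meas_toE _)).mul (hH.comp (meas_toE _))
  rw [split_LU hm]
  rw [← lintegral_mul_const _ hχ]
  refine lintegral_congr_ae ?_
  filter_upwards [ae_low] with L hL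
  rw [← lintegral_const_mul _ hH]
  refine lintegral_congr_ae ?_
  filter_upwards [ae_up] with T hT
  rw [map_add, map_add, hL.1, hL.2, hT.1, hT.2, add_zero, zero_add]

def box (n : ℕ) : Set (EE n) := Set.univ.pi fun _ => Set.univ.pi fun _ => Metric.ball (0 : ℂ) 1

theorem meas_box (n : ℕ) : MeasurableSet (box n) :=
  MeasurableSet.univ_pi fun _ => MeasurableSet.univ_pi fun _ => measurableSet_ball

theorem low_box (n : ℕ) : muLow n (box n) ≠ 0 ∧ muLow n (box n) ≠ ∞ := by
  have h1 : muLow n (box n) = ∏ i : Fin n, ∏ j : Fin n, mu1 (j < i) (Metric.ball (0 : ℂ) 1) := by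
    unfold muLow muP box
    rw [Measure.pi_pi]
    refine Finset.prod_congr rfl fun i _ => ?_
    rw [Measure.pi_pi]
  rw [h1]
  constructor
  · refine Finset.prod_ne_zero_iff.2 fun i _ => Finset.prod_ne_zero_iff.2 fun j _ => ?_
    unfold mu1
    split_ifs
    · exact (Metric.measure_ball_pos _ _ one_pos).ne'
    · simp
  · refine ENNReal.prod_ne_top fun i _ => ENNReal.prod_ne_top fun j _ => ?_
    unfold mu1
    split_ifs
    · exact measure_ball_lt_top.ne
    · simp

def KInv {n : ℕ} (F : EE n → ℝ≥0∞) : Prop :=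
  ∀ U : Matrix (Fin n) (Fin n) ℂ, U ∈ Matrix.unitaryGroup (Fin n) ℂ → ∀ M : Matrix (Fin n) (Fin n) ℂ,
    F (Matrix.of.symm (U * M * Uᴴ)) = F (Matrix.of.symm M)

noncomputable def Th {n : ℕ} (b c : Matrix (Fin n) (Fin n) ℂ) :
    Matrix (Fin n) (Fin n) ℂ →ₗ[ℂ] Matrix (Fin n) (Fin n) ℂ :=
  lowL n + (conjL b c) ∘ₗ uppL n

theorem Th_apply {n : ℕ} (b c X : Matrix (Fin n) (Fin n) ℂ) :
    Th b c X = lowL n X + b * (uppL n X * c) := by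
  simp [Th, conjL]

theorem low_low {n : ℕ} (X : Matrix (Fin n) (Fin n) ℂ) : lowL n (lowL n X) = lowL n X := by
  ext i j; simp only [lowL_apply]; split_ifs <;> rfl
theorem upp_low {n : ℕ} (X : Matrix (Fin n) (Fin n) ℂ) : uppL n (lowL n X) = 0 := by
  ext i j; simp only [lowL_apply, uppL_apply, Matrix.zero_apply]
  split_ifs with h1 h2
  · exact absurd h1 h2.not_ge
  · rfl
  · rfl

theorem low_Th {n : ℕ} {b c : Matrix (Fin n) (Fin n) ℂ} (hb : b.IsUpperTriangular)
    (hc : c.IsUpperTriangular) (X : Matrix (Fin n) (Fin n) ℂ) : lowL n (Th b c X) = lowL n X := by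
  rw [Th_apply, map_add, low_low, low_of_tri (hb.mul ((upp_tri X).mul hc)), add_zero]

theorem upp_Th {n : ℕ} {b c : Matrix (Fin n) (Fin n) ℂ} (hb : b.IsUpperTriangular)
    (hc : c.IsUpperTriangular) (X : Matrix (Fin n) (Fin n) ℂ) :
    uppL n (Th b c X) = b * (uppL n X * c) := by
  rw [Th_apply, map_add, upp_low, upp_of_tri (hb.mul ((upp_tri X).mul hc)), zero_add]

theorem det_Th {n : ℕ} {b c : Matrix (Fin n) (Fin n) ℂ} (hb : b.IsUpperTriangular)
    (hc : c.IsUpperTriangular) (hcb : c * b = 1) : LinearMap.det (Th b c) ≠ 0 := by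
  have : Th c b ∘ₗ Th b c = LinearMap.id := by
    refine LinearMap.ext fun X => ?_
    rw [LinearMap.comp_apply, Th_apply, low_Th hb hc, upp_Th hb hc]
    have : c * (b * (uppL n X * c) * b) = (c * b) * uppL n X * (c * b) := by simp only [mul_assoc]
    rw [this, hcb, one_mul, mul_one, low_add_upp]; rfl
  have h2 := congrArg LinearMap.det this
  rw [LinearMap.det_comp, LinearMap.det_id] at h2
  intro h0; rw [h0, mul_zero] at h2; exact zero_ne_one h2

theorem conj_diag {n : ℕ} {b T : Matrix (Fin n) (Fin n) ℂ} (hb : b.IsUpperTriangular)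
    (hbu : IsUnit b.det) (hT : T.IsUpperTriangular) (i : Fin n) : (b * (T * b⁻¹)) i i = T i i := by
  rw [← mul_assoc, upper_mul_diag (hb.mul hT) (upper_inv hb hbu), upper_mul_diag hb hT]
  have := upper_mul_diag hb (upper_inv hb hbu) i
  rw [mul_nonsing_inv _ hbu, Matrix.one_apply_eq] at this
  linear_combination (- T i i) * this

theorem LM2 {n : ℕ} (g : Matrix (Fin n) (Fin n) ℂ) (hg : IsUnit g.det) : ∃ c : ℝ≥0∞, c ≠ 0 ∧
    ∀ (F : EE n → ℝ≥0∞) (w : (Fin n → ℂ) → ℝ≥0∞), Measurable F → Measurable w → KInv F →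
      ∫⁻ T, w (fun i => T i i) * F (Matrix.of.symm (g * Matrix.of T * g⁻¹)) ∂(muUp n) =
        c * ∫⁻ T, w (fun i => T i i) * F T ∂(muUp n) := by
  obtain ⟨U, b, hU, hb, hgU⟩ := exists_QR g
  have hbu : IsUnit b.det := by
    rw [hgU, det_mul] at hg
    exact isUnit_of_mul_isUnit_right hg
  have hbi := upper_inv hb hbu
  have hUu : Uᴴ * U = 1 := Matrix.mem_unitaryGroup_iff'.1 hU
  have hinv : g⁻¹ = b⁻¹ * Uᴴ := by
    rw [hgU, Matrix.mul_inv_rev, Matrix.inv_eq_left_inv hUu]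
  have hd := det_Th hb hbi (nonsing_inv_mul _ hbu)
  have hd' : LinearMap.det (toE (Th b b⁻¹)) ≠ 0 := by rw [det_toE]; simpa using hd
  have hmap := Measure.map_linearMap_addHaar_eq_smul_addHaar (volume : Measure (EE n)) hd'
  set c := ENNReal.ofReal |(LinearMap.det (toE (Th b b⁻¹)))⁻¹| with hc
  refine ⟨c, ?_, ?_⟩
  · rw [hc]; simpa using hd'
  intro F w hF hw hK
  have hwd : Measurable fun T : EE n => w fun i => T i i := hw.comp (by fun_prop)
  have hH : Measurable fun T : EE n => w (fun i => T i i) * F T := hwd.mul hF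
  have hcm : Measurable fun T : EE n => (Matrix.of.symm (b * (Matrix.of T * b⁻¹)) : EE n) :=
    meas_mul measurable_const (meas_mul measurable_id measurable_const)
  set χ : EE n → ℝ≥0∞ := (box n).indicator 1 with hχ
  have hχm : Measurable χ := measurable_one.indicator (meas_box n)
  have hχi : ∫⁻ L, χ L ∂(muLow n) = muLow n (box n) := by
    rw [hχ, lintegral_indicator_one (meas_box n)]
  have e1 := split_mul hχm hH
  have e2 := split_mul hχm (hH.comp hcm)
  have e3 : ∫⁻ X, χ (toE (lowL n) X) * (w (fun i => toE (uppL n) X i i) * F (toE (uppL n) X))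
      ∂(Measure.map (toE (Th b b⁻¹)) volume) =
      c * ∫⁻ X, χ (toE (lowL n) X) * (w (fun i => toE (uppL n) X i i) * F (toE (uppL n) X)) := by
    rw [hmap, lintegral_smul_measure, smul_eq_mul]
  have hmm : Measurable fun X => χ (toE (lowL n) X) *
      (w (fun i => toE (uppL n) X i i) * F (toE (uppL n) X)) :=
    (hχm.comp (meas_toE _)).mul (hH.comp (meas_toE _))
  rw [lintegral_map hmm (meas_toE _)] at e3
  have e4 : ∀ X, toE (lowL n) (toE (Th b b⁻¹) X) = toE (lowL n) X := fun X => low_Th hb hbi _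
  have e5 : ∀ X, toE (uppL n) (toE (Th b b⁻¹) X) =
     (Matrix.of.symm (b * (Matrix.of (toE (uppL n) X) * b⁻¹)) : EE n) := fun X => upp_Th hb hbi _
  simp only [e4, e5] at e3
  simp only [Function.comp_def] at e2
  rw [e1, e2, hχi, mul_left_comm] at e3
  have e6 := (ENNReal.mul_right_inj (low_box n).1 (low_box n).2).1 e3
  rw [← e6]
  refine lintegral_congr_ae ?_
  filter_upwards [ae_up] with T hT
  have hTt : (Matrix.of T).IsUpperTriangular := by
    have := upp_tri (Matrix.of T)
    have h2 : uppL n (Matrix.of T) = Matrix.of T := hT.2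
    rwa [h2] at this
  congr 1
  · congr 1
    funext i
    exact (conj_diag hb hbu hTt i).symm
  · rw [hinv, hgU, ← hK U hU (b * (Matrix.of T * b⁻¹))]
    congr 2
    simp only [mul_assoc]

def SD {n : ℕ} (σ : Equiv.Perm (Fin n)) : Set (Fin n → ℂ) := {d | StrictMono fun k => (d (σ k)).re}

theorem meas_SD {n : ℕ} (σ : Equiv.Perm (Fin n)) : MeasurableSet (SD σ) := by
  have : SD σ = ⋂ (a : Fin n) (b : Fin n) (_ : a < b),
      {X : Fin n → ℂ | (X (σ a)).re < (X (σ b)).re} := by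
    ext X; simp [SD, StrictMono]
  rw [this]
  refine MeasurableSet.iInter fun a => MeasurableSet.iInter fun b => MeasurableSet.iInter fun _ => ?_
  refine measurableSet_lt ?_ ?_ <;> fun_prop

theorem meas_vand {n : ℕ} : Measurable (fun d : Fin n → ℂ => ENNReal.ofReal (vand d)) := by
  refine ENNReal.measurable_ofReal.comp ?_
  unfold vand
  refine Finset.measurable_prod _ fun i _ => Finset.measurable_prod _ fun j _ => ?_
  split_ifs <;> fun_prop

noncomputable def ws {n : ℕ} (σ : Equiv.Perm (Fin n)) (d : Fin n → ℂ) : ℝ≥0∞ :=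
  (SD σ).indicator (fun d => ENNReal.ofReal (vand d)) d

theorem meas_ws {n : ℕ} (σ : Equiv.Perm (Fin n)) : Measurable (ws σ) :=
  meas_vand.indicator (meas_SD σ)

theorem meas_chart (n : ℕ) : Measurable (chart n) := (diff_chart n).continuous.measurable

theorem meas_dg {n : ℕ} : Measurable (fun T : EE n => fun i => T i i) := by fun_prop

theorem LM3a {n : ℕ} (σ : Equiv.Perm (Fin n)) : ∃ c : EE n → ℝ≥0∞, (∀ L, c L ≠ 0) ∧
    ∀ F : EE n → ℝ≥0∞, Measurable F → KInv F →
      ∫⁻ M, F M = ∫⁻ L, c L * (∫⁻ T, ws σ (fun i => T i i) * F T ∂(muUp n)) ∂(muLow n) := by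
  have hgu : ∀ L : EE n, IsUnit (1 + lowL n (Matrix.of L)).det := fun L => by
    rw [UL_det (UL_low _)]; exact isUnit_one
  choose c hc0 hc using fun L : EE n => LM2 (1 + lowL n (Matrix.of L)) (hgu L)
  refine ⟨c, hc0, fun F hF hK => ?_⟩
  have h1 : ∫⁻ M, F M = ∫⁻ X : EE n, ws σ (fun i => X i i) * F (chart n X) := by
    rw [main_cov σ, ← lintegral_indicator (meas_SS σ)]
    refine lintegral_congr fun X => ?_
    by_cases hX : X ∈ SS σ
    · have hX' : (fun i => X i i) ∈ SD σ := hX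
      rw [Set.indicator_of_mem hX, ws, Set.indicator_of_mem hX']
    · have hX' : (fun i => X i i) ∉ SD σ := hX
      rw [Set.indicator_of_notMem hX, ws, Set.indicator_of_notMem hX', zero_mul]
  have hm : Measurable fun X : EE n => ws σ (fun i => X i i) * F (chart n X) :=
    ((meas_ws σ).comp meas_dg).mul (hF.comp (meas_chart n))
  rw [h1, split_LU hm]
  refine lintegral_congr_ae ?_
  filter_upwards [ae_low] with L hL
  rw [← hc L F (ws σ) hF (meas_ws σ) hK]
  refine lintegral_congr_ae ?_
  filter_upwards [ae_up] with T hT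
  have hl1 : lowL n (Matrix.of L) = Matrix.of L := hL.1
  have hl2 : uppL n (Matrix.of L) = 0 := hL.2
  have ht1 : lowL n (Matrix.of T) = 0 := hT.1
  have ht2 : uppL n (Matrix.of T) = Matrix.of T := hT.2
  have hLd : ∀ i, L i i = 0 := by
    intro i
    have := upp_diag (Matrix.of L) i
    rw [hl2] at this
    exact this.symm
  have hadd : Matrix.of (L + T) = Matrix.of L + Matrix.of T := rfl
  congr 1
  · congr 1
    funext i
    simp [hLd]
  · rw [chart, hadd, map_add, map_add, hl2, ht1, ht2, add_zero, zero_add]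

theorem low_univ (n : ℕ) : muLow n Set.univ ≠ 0 := fun h =>
  (low_box n).1 (measure_mono_null (Set.subset_univ _) h)

theorem LM3 {n : ℕ} (σ : Equiv.Perm (Fin n)) {ψ : EE n → ℝ≥0∞} (hψ : Measurable ψ) (hψK : KInv ψ)
    (h0 : ∫⁻ M, ψ M ≠ 0) (h1 : ∫⁻ M, ψ M ≠ ∞) : ∃ D : ℝ≥0∞, D ≠ 0 ∧ D ≠ ∞ ∧
    ∀ F : EE n → ℝ≥0∞, Measurable F → KInv F → ∫⁻ M, F M ≠ ∞ →
      ∫⁻ T, ws σ (fun i => T i i) * F T ∂(muUp n) = D * ∫⁻ M, F M := by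
  obtain ⟨c, hc0, hc⟩ := LM3a σ
  have key : ∀ F : EE n → ℝ≥0∞, Measurable F → KInv F → ∫⁻ M, F M ≠ ∞ →
      ∫⁻ M, F M = (∫⁻ L, c L ∂(muLow n)) * ∫⁻ T, ws σ (fun i => T i i) * F T ∂(muUp n) := by
    intro F hF hK hfin
    have hI : ∫⁻ T, ws σ (fun i => T i i) * F T ∂(muUp n) ≠ ∞ := by
      intro hI
      rw [hc F hF hK, hI] at hfin
      apply hfin
      have : ∀ L, c L * ∞ = ∞ := fun L => ENNReal.mul_top (hc0 L)
      simp_rw [this]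
      rw [lintegral_const, ENNReal.top_mul (low_univ n)]
    rw [hc F hF hK, lintegral_mul_const' _ _ hI]
  set C := ∫⁻ L, c L ∂(muLow n)
  have kψ := key ψ hψ hψK h1
  have hC0 : C ≠ 0 := by
    intro h; rw [h, zero_mul] at kψ; exact h0 kψ
  have hCt : C ≠ ∞ := by
    intro h
    rw [h] at kψ
    by_cases hz : ∫⁻ T, ws σ (fun i => T i i) * ψ T ∂(muUp n) = 0
    · rw [hz, mul_zero] at kψ; exact h0 kψ
    · rw [ENNReal.top_mul hz] at kψ; exact h1 kψ
  refine ⟨C⁻¹, ENNReal.inv_ne_zero.2 hCt, ENNReal.inv_ne_top.2 hC0, fun F hF hK hfin => ?_⟩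
  rw [key F hF hK hfin, ← mul_assoc, ENNReal.inv_mul_cancel hC0 hCt, one_mul]

theorem up_NN {n : ℕ} : ∀ᵐ T ∂(muUp n), T ∉ NN n := by
  have hNm : MeasurableSet (NN n) := by
    have : NN n = ⋃ (i : Fin n) (j : Fin n) (_ : i ≠ j), {X : EE n | (X i i).re = (X j j).re} := by
      ext X; simp [NN]
    rw [this]
    refine MeasurableSet.iUnion fun i => MeasurableSet.iUnion fun j => MeasurableSet.iUnion fun _ => ?_
    refine measurableSet_eq_fun ?_ ?_ <;> fun_prop
  have h1 := split_mul (n := n) (χ := fun _ => 1) (H := (NN n).indicator 1) measurable_const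
    (measurable_one.indicator hNm)
  have h2 : ∫⁻ X : EE n, 1 * (NN n).indicator (1 : EE n → ℝ≥0∞) (toE (uppL n) X) = 0 := by
    have : ∀ X : EE n, 1 * (NN n).indicator (1 : EE n → ℝ≥0∞) (toE (uppL n) X) = (NN n).indicator 1 X := by
      intro X
      rw [one_mul]
      have : toE (uppL n) X ∈ NN n ↔ X ∈ NN n := by
        have : ∀ i, toE (uppL n) X i i = X i i := fun i => upp_diag _ i
        simp [NN, this]
      by_cases hx : X ∈ NN n
      · rw [Set.indicator_of_mem (this.2 hx), Set.indicator_of_mem hx]; rfl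
      · rw [Set.indicator_of_notMem (fun h => hx (this.1 h)), Set.indicator_of_notMem hx]
    simp_rw [this]
    rw [lintegral_indicator_one hNm, null_NN]
  rw [h2, lintegral_indicator_one hNm, lintegral_one] at h1
  have := (mul_eq_zero.1 h1.symm).resolve_left (low_univ n)
  rw [ae_iff]
  simpa using this

theorem sum_ws {n : ℕ} {T : EE n} (hT : T ∉ NN n) :
    ∑ σ : Equiv.Perm (Fin n), ws σ (fun i => T i i) = ENNReal.ofReal (vand fun i => T i i) := by
  have hinj : ∀ i j, (T i i).re = (T j j).re → i = j := by
    intro i j h; by_contra hne; exact hT ⟨i, j, hne, h⟩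
  set s := Tuple.sort (fun i => (T i i).re) with hs
  have h1 : Monotone ((fun i => (T i i).re) ∘ s) := Tuple.monotone_sort _
  have h2 : StrictMono ((fun i => (T i i).re) ∘ s) :=
    h1.strictMono_of_injective (fun a b h => s.injective (hinj _ _ h))
  rw [Finset.sum_eq_single s]
  · have : (fun i => T i i) ∈ SD s := h2
    rw [ws, Set.indicator_of_mem this]
  · intro σ _ hσ
    rw [ws, Set.indicator_of_notMem]
    intro h3
    apply hσ
    have h4 : (fun k => (T (σ k) (σ k)).re) = ((fun i => (T i i).re) ∘ s) := by
      refine (StrictMono.range_inj h3 h2).1 ?_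
      rw [EquivLike.range_comp (fun i => (T i i).re) s]
      exact EquivLike.range_comp (fun i => (T i i).re) σ
    ext k
    exact congrArg Fin.val (hinj _ _ (congrFun h4 k))
  · intro h; exact absurd (Finset.mem_univ _) h

theorem LM4 {n : ℕ} {ψ : EE n → ℝ≥0∞} (hψ : Measurable ψ) (hψK : KInv ψ)
    (h0 : ∫⁻ M, ψ M ≠ 0) (h1 : ∫⁻ M, ψ M ≠ ∞) : ∃ D : ℝ≥0∞, D ≠ 0 ∧ D ≠ ∞ ∧
    ∀ F : EE n → ℝ≥0∞, Measurable F → KInv F → ∫⁻ M, F M ≠ ∞ →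
      ∫⁻ T, ENNReal.ofReal (vand fun i => T i i) * F T ∂(muUp n) = D * ∫⁻ M, F M := by
  choose D hD0 hDt hD using fun σ : Equiv.Perm (Fin n) => LM3 σ hψ hψK h0 h1
  refine ⟨∑ σ, D σ, ?_, ?_, ?_⟩
  · intro h
    have := (Finset.sum_eq_zero_iff.1 h) 1 (Finset.mem_univ _)
    exact hD0 1 this
  · exact ENNReal.sum_ne_top.2 fun σ _ => hDt σ
  · intro F hF hK hfin
    rw [Finset.sum_mul]
    simp_rw [← hD _ F hF hK hfin]
    have hm : ∀ σ : Equiv.Perm (Fin n), Measurable fun T : EE n => ws σ (fun i => T i i) * F T :=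
      fun σ => ((meas_ws σ).comp meas_dg).mul hF
    rw [← lintegral_finsetSum _ (fun σ _ => hm σ)]
    refine lintegral_congr_ae ?_
    filter_upwards [up_NN] with T hT
    rw [← sum_ws hT, Finset.sum_mul]

theorem map_wd {α β : Type} [MeasurableSpace α] [MeasurableSpace β] {μ : Measure α} {ν : Measure β}
    (e : α ≃ᵐ β) (he : MeasurePreserving e μ ν) (f : α → ℝ≥0∞) :
    (μ.withDensity f).map e = ν.withDensity (fun y => f (e.symm y)) := by
  ext s hs
  rw [Measure.map_apply e.measurable hs, withDensity_apply _ (e.measurable hs), withDensity_apply _ hs,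
    ← he.setLIntegral_comp_preimage_emb e.measurableEmbedding]
  simp

theorem cg_meas : Measurable (fun p : ℝ × ℝ => (p.1 : ℂ) + (p.2 : ℂ) * Complex.I) := by fun_prop

instance cg_prob (v : ℝ≥0) : IsProbabilityMeasure (complexGaussian v) :=
  Measure.isProbabilityMeasure_map cg_meas.aemeasurable

theorem cg_density {v : ℝ≥0} (hv : v ≠ 0) : complexGaussian v =
    volume.withDensity fun z => ENNReal.ofReal ((π * v)⁻¹) * ENNReal.ofReal (Real.exp (-‖z‖ ^ 2 / v)) := by
  have hv2 : v / 2 ≠ 0 := by simp [hv]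
  have hvp : (0 : ℝ) < v := by positivity
  have h1 : (fun p : ℝ × ℝ => (p.1 : ℂ) + (p.2 : ℂ) * Complex.I) = Complex.measurableEquivRealProd.symm := by
    funext p
    apply Complex.ext <;> simp [Complex.measurableEquivRealProd]
  unfold complexGaussian
  rw [gaussianReal_of_var_ne_zero _ hv2, prod_withDensity (measurable_gaussianPDF _ _) (measurable_gaussianPDF _ _),
    h1, ← Measure.volume_eq_prod, map_wd _ (Complex.volume_preserving_equiv_real_prod.symm)]
  congr 1
  funext z
  simp only [MeasurableEquiv.symm_symm, gaussianPDF, gaussianPDFReal]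
  rw [← ENNReal.ofReal_mul (by positivity), ← ENNReal.ofReal_mul (by positivity)]
  congr 1
  have h2 : (Complex.measurableEquivRealProd z).1 = z.re := rfl
  have h3 : (Complex.measurableEquivRealProd z).2 = z.im := rfl
  rw [h2, h3]
  have h4 : 2 * π * ((v / 2 : ℝ≥0) : ℝ) = π * v := by push_cast; ring
  have h5 : 2 * ((v / 2 : ℝ≥0) : ℝ) = v := by push_cast; ring
  rw [h4, h5, mul_mul_mul_comm, ← Real.exp_add, ← mul_inv, Real.mul_self_sqrt (by positivity)]
  congr 2
  rw [← Complex.normSq_eq_norm_sq, Complex.normSq_apply]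
  field_simp
  ring

theorem cg_map {v : ℝ≥0} (s : ℝ) : (complexGaussian v).map (fun z => (s : ℂ) * z) =
    complexGaussian (NNReal.mk (s ^ 2) (sq_nonneg s) * v) := by
  unfold complexGaussian
  have h1 := gaussianReal_map_const_mul (μ := 0) (v := v / 2) s
  rw [mul_zero] at h1
  rw [mul_div_assoc, ← h1, Measure.map_map (by fun_prop) cg_meas, Measure.map_prod_map _ _ (by fun_prop) (by fun_prop),
    Measure.map_map cg_meas (by fun_prop)]
  congr 1
  funext p
  simp
  ring

theorem gt1 (p : Prop) [Decidable p] {v : ℝ≥0} (hv : v ≠ 0) {s : ℝ} (hs : s ≠ 0) :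
    ((if p then complexGaussian v else Measure.dirac 0).map (fun z => (s : ℂ) * z)) =
    (mu1 p).withDensity fun z => (if p then ENNReal.ofReal ((π * (s ^ 2 * v))⁻¹) else 1) *
      ENNReal.ofReal (Real.exp (-‖z‖ ^ 2 / (s ^ 2 * v))) := by
  by_cases hp : p
  · simp only [hp, if_true, mu1]
    rw [cg_map, cg_density]
    · rfl
    · refine mul_ne_zero ?_ hv
      intro h
      have := congrArg NNReal.toReal h
      rw [NNReal.coe_mk] at this
      exact hs (pow_eq_zero_iff (two_ne_zero) |>.1 this)
  · simp only [hp, if_false, mu1]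
    rw [Measure.map_dirac' (by fun_prop), mul_zero]
    symm
    have : (fun z : ℂ => 1 * ENNReal.ofReal (Real.exp (-‖z‖ ^ 2 / (s ^ 2 * v)))) =ᵐ[Measure.dirac (0 : ℂ)] 1 := by
      rw [Filter.EventuallyEq, ae_dirac_eq]
      simp
    rw [withDensity_congr_ae this, withDensity_one]

instance (n : ℕ) : IsProbabilityMeasure (GTlaw n) := by
  unfold GTlaw
  have : ∀ i j : Fin n, IsProbabilityMeasure (if (i : ℕ) < (j : ℕ) then complexGaussian ((n : ℝ≥0))⁻¹ else Measure.dirac (0 : ℂ)) := by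
    intro i j; split_ifs <;> infer_instance
  infer_instance

theorem gt_density {n : ℕ} (hn : n ≠ 0) {s : ℝ} (hs : s ≠ 0) : ∃ c : ℝ≥0∞, c ≠ 0 ∧ c ≠ ∞ ∧
    (GTlaw n).map (fun S => (fun i j => (s : ℂ) * S i j : EE n)) =
      (muSU n).withDensity fun S => c * ENNReal.ofReal (Real.exp (-(∑ i, ∑ j, ‖S i j‖ ^ 2) * n / s ^ 2)) := by
  set v : ℝ≥0 := ((n : ℝ≥0))⁻¹ with hv
  have hv0 : v ≠ 0 := by simp [hv, hn]
  set K : Fin n → Fin n → ℝ≥0∞ := fun i j => if (i : ℕ) < (j : ℕ) then ENNReal.ofReal ((π * (s ^ 2 * v))⁻¹) else 1 with hK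
  have hpos : 0 < (π * (s ^ 2 * (v : ℝ)))⁻¹ := by positivity
  set g : ℂ → ℝ≥0∞ := fun z => ENNReal.ofReal (Real.exp (-‖z‖ ^ 2 / (s ^ 2 * v))) with hg
  have hgm : Measurable g := by rw [hg]; fun_prop
  let Q : Fin n → Fin n → Measure ℂ := fun i j => if (i : ℕ) < (j : ℕ) then complexGaussian v else Measure.dirac 0
  have hQ : ∀ i j, IsProbabilityMeasure (Q i j) := by
    intro i j; simp only [Q]; split_ifs <;> infer_instance
  have e1 : ∀ i j : Fin n, (Q i j).map (fun z => (s : ℂ) * z) = (mu1 (i < j)).withDensity fun z => K i j * g z := by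
    intro i j
    exact gt1 _ hv0 hs
  have p1 : ∀ i j : Fin n, IsProbabilityMeasure ((Q i j).map (fun z => (s : ℂ) * z)) := fun i j =>
    Measure.isProbabilityMeasure_map (by fun_prop)
  have p2 : ∀ i j : Fin n, IsProbabilityMeasure ((mu1 (i < j)).withDensity fun z => K i j * g z) := fun i j => by
    rw [← e1]; infer_instance
  have hfm : ∀ i j, Measurable fun z => K i j * g z := fun i j => hgm.const_mul _
  have e2 : ∀ i : Fin n, (Measure.pi (Q i)).map (fun x j => (s : ℂ) * x j) =
      (Measure.pi fun j => mu1 (i < j)).withDensity fun x => ∏ j, (K i j * g (x j)) := by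
    intro i
    rw [← pi_wd _ (fun j z => K i j * g z) (hfm i)]
    rw [Measure.pi_map_pi (μ := Q i) (f := fun j z => (s : ℂ) * z) (fun j => by fun_prop)]
    congr 1
    funext j
    exact e1 i j
  have p3 : ∀ i : Fin n, IsProbabilityMeasure ((Measure.pi (Q i)).map (fun x j => (s : ℂ) * x j)) := fun i =>
    Measure.isProbabilityMeasure_map (measurable_pi_lambda _ fun j => by fun_prop).aemeasurable
  have p4 : ∀ i : Fin n, IsProbabilityMeasure ((Measure.pi fun j => mu1 (i < j)).withDensity fun x => ∏ j, (K i j * g (x j))) := fun i => by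
    rw [← e2]; infer_instance
  have e3 : (GTlaw n).map (fun S => (fun i j => (s : ℂ) * S i j : EE n)) =
      (muSU n).withDensity fun S => ∏ i, ∏ j, (K i j * g (S i j)) := by
    have hmu : muSU n = Measure.pi fun i => Measure.pi fun j => mu1 (i < j) := rfl
    rw [hmu, ← pi_wd (fun i : Fin n => Measure.pi fun j => mu1 (i < j)) (fun i (x : Fin n → ℂ) => ∏ j, (K i j * g (x j)))
      (fun i => Finset.measurable_prod _ fun j _ => (hfm i j).comp (measurable_pi_apply j))]
    have : GTlaw n = Measure.pi fun i => Measure.pi (Q i) := rfl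
    rw [this, Measure.pi_map_pi (μ := fun i => Measure.pi (Q i)) (f := fun i (x : Fin n → ℂ) j => (s : ℂ) * x j) (fun i => (measurable_pi_lambda _ fun j => by fun_prop).aemeasurable)]
    congr 1
    funext i
    exact e2 i
  refine ⟨∏ i, ∏ j, K i j, ?_, ?_, ?_⟩
  · refine Finset.prod_ne_zero_iff.2 fun i _ => Finset.prod_ne_zero_iff.2 fun j _ => ?_
    simp only [hK]
    split_ifs
    · simpa using hpos
    · exact one_ne_zero
  · refine ENNReal.prod_ne_top fun i _ => ENNReal.prod_ne_top fun j _ => ?_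
    simp only [hK]
    split_ifs <;> simp
  · rw [e3]
    congr 1
    funext S
    simp_rw [Finset.prod_mul_distrib]
    congr 1
    simp only [hg]
    simp_rw [← ENNReal.ofReal_prod_of_nonneg (fun i _ => (Real.exp_pos _).le), ← Real.exp_sum]
    rw [← ENNReal.ofReal_prod_of_nonneg (fun i _ => (Real.exp_pos _).le), ← Real.exp_sum]
    congr 2
    rw [neg_mul, Finset.sum_mul, neg_div, Finset.sum_div, ← Finset.sum_neg_distrib]
    refine Finset.sum_congr rfl fun i _ => ?_
    rw [Finset.sum_mul, Finset.sum_div, ← Finset.sum_neg_distrib]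
    refine Finset.sum_congr rfl fun j _ => ?_
    simp only [hv]
    push_cast
    have : (n : ℝ) ≠ 0 := by exact_mod_cast hn
    field_simp

noncomputable def qf (θ : ℝ) (a b : ℂ) : ℝ :=
  ‖(a + star b) / 2‖ ^ 2 / Real.cos θ ^ 2 + ‖(a - star b) / 2‖ ^ 2 / Real.sin θ ^ 2

theorem psi_formula (θ : ℝ) (n : ℕ) (M : Matrix (Fin n) (Fin n) ℂ) :
    psiTheta θ n M = Real.exp (-((n : ℝ) / 2) * ∑ i, ∑ j, qf θ (M i j) (M j i)) := by
  have hA : (((2 : ℂ)⁻¹ • (M + Mᴴ)) ^ 2).trace = ((∑ i, ∑ j, ‖(M i j + star (M j i)) / 2‖ ^ 2 : ℝ) : ℂ) := by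
    rw [sq, Matrix.trace]
    push_cast
    refine Finset.sum_congr rfl fun i _ => ?_
    rw [Matrix.diag_apply, Matrix.mul_apply]
    refine Finset.sum_congr rfl fun j _ => ?_
    rw [← Complex.conj_mul']
    have c2 : (starRingEnd ℂ) 2 = 2 := Complex.conj_ofNat 2
    simp [c2]
    ring
  have hB : (((2 * Complex.I : ℂ)⁻¹ • (M - Mᴴ)) ^ 2).trace = ((∑ i, ∑ j, ‖(M i j - star (M j i)) / 2‖ ^ 2 : ℝ) : ℂ) := by
    rw [sq, Matrix.trace]
    push_cast
    refine Finset.sum_congr rfl fun i _ => ?_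
    rw [Matrix.diag_apply, Matrix.mul_apply]
    refine Finset.sum_congr rfl fun j _ => ?_
    rw [← Complex.conj_mul']
    have c2 : (starRingEnd ℂ) 2 = 2 := Complex.conj_ofNat 2
    simp [c2]
    ring_nf
    simp
    ring
  unfold psiTheta
  rw [hA, hB]
  have : (-(n : ℂ) / 2 *
    ((((∑ i, ∑ j, ‖(M i j + star (M j i)) / 2‖ ^ 2 : ℝ) : ℂ) / (Real.cos θ : ℂ) ^ 2) +
      (((∑ i, ∑ j, ‖(M i j - star (M j i)) / 2‖ ^ 2 : ℝ) : ℂ) / (Real.sin θ : ℂ) ^ 2))) =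
      ((-((n : ℝ) / 2) * ∑ i, ∑ j, qf θ (M i j) (M j i) : ℝ) : ℂ) := by
    unfold qf
    simp_rw [Finset.sum_add_distrib, ← Finset.sum_div]
    push_cast
    ring
  rw [this, Complex.ofReal_re]

noncomputable def PS (θ : ℝ) (n : ℕ) : EE n → ℝ≥0∞ := fun t => ENNReal.ofReal (psiTheta θ n (Matrix.of t))

theorem meas_psi (θ : ℝ) (n : ℕ) : Continuous fun t : EE n => psiTheta θ n (Matrix.of t) := by
  simp_rw [psi_formula, qf, Matrix.of_apply]
  fun_prop

theorem meas_PS (θ : ℝ) (n : ℕ) : Measurable (PS θ n) := (meas_psi θ n).measurable.ennreal_ofReal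

theorem psi_tr {n : ℕ} {U : Matrix (Fin n) (Fin n) ℂ} (hU1 : Uᴴ * U = 1) (c : ℂ) (X : Matrix (Fin n) (Fin n) ℂ) :
    ((c • (U * X * Uᴴ)) ^ 2).trace = ((c • X) ^ 2).trace := by
  have h1 : U * X * Uᴴ * (U * X * Uᴴ) = U * (X * X) * Uᴴ := by
    calc _ = U * X * (Uᴴ * U) * X * Uᴴ := by simp only [Matrix.mul_assoc]
      _ = _ := by rw [hU1]; simp only [Matrix.mul_assoc, Matrix.one_mul]
  rw [sq, sq, Matrix.smul_mul, Matrix.mul_smul, Matrix.smul_mul, Matrix.mul_smul, h1]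
  rw [Matrix.trace_smul, Matrix.trace_smul, Matrix.trace_smul, Matrix.trace_smul, Matrix.trace_mul_cycle, hU1, Matrix.one_mul]

theorem psi_inv (θ : ℝ) (n : ℕ) {U : Matrix (Fin n) (Fin n) ℂ} (hU1 : Uᴴ * U = 1) (M : Matrix (Fin n) (Fin n) ℂ) :
    psiTheta θ n (U * M * Uᴴ) = psiTheta θ n M := by
  have h0 : (U * M * Uᴴ)ᴴ = U * Mᴴ * Uᴴ := by
    rw [conjTranspose_mul, conjTranspose_mul, conjTranspose_conjTranspose, Matrix.mul_assoc]
  have h1 : U * M * Uᴴ + (U * M * Uᴴ)ᴴ = U * (M + Mᴴ) * Uᴴ := by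
    rw [h0, Matrix.mul_add, Matrix.add_mul]
  have h2 : U * M * Uᴴ - (U * M * Uᴴ)ᴴ = U * (M - Mᴴ) * Uᴴ := by
    rw [h0, Matrix.mul_sub, Matrix.sub_mul]
  unfold psiTheta
  rw [h1, h2, psi_tr hU1, psi_tr hU1]

theorem KInv_PS (θ : ℝ) (n : ℕ) : KInv (PS θ n) := by
  intro U hU M
  have hU1 : Uᴴ * U = 1 := (Matrix.mem_unitaryGroup_iff').1 hU
  show ENNReal.ofReal (psiTheta θ n (U * M * Uᴴ)) = ENNReal.ofReal (psiTheta θ n M)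
  rw [psi_inv θ n hU1]

theorem qf_ge {θ : ℝ} (hc : Real.cos θ ≠ 0) (hs : Real.sin θ ≠ 0) (a b : ℂ) : (‖a‖ ^ 2 + ‖b‖ ^ 2) / 2 ≤ qf θ a b := by
  have h1 : ‖(a + star b) / 2‖ ^ 2 + ‖(a - star b) / 2‖ ^ 2 = (‖a‖ ^ 2 + ‖b‖ ^ 2) / 2 := by
    simp only [← Complex.normSq_eq_norm_sq, Complex.normSq_apply]
    simp
    ring
  rw [← h1]
  unfold qf
  refine add_le_add ?_ ?_
  · rw [le_div_iff₀ (by positivity)]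
    exact mul_le_of_le_one_right (by positivity) (Real.cos_sq_le_one θ)
  · rw [le_div_iff₀ (by positivity)]
    exact mul_le_of_le_one_right (by positivity) (Real.sin_sq_le_one θ)

theorem lint_gauss {n : ℕ} (hn : n ≠ 0) : ∫⁻ z : ℂ, ENNReal.ofReal (Real.exp (-((n : ℝ) / 2) * ‖z‖ ^ 2)) ≠ ∞ := by
  have hv : (2 / n : ℝ≥0) ≠ 0 := by simp [hn]
  have h1 : complexGaussian (2 / n) Set.univ = 1 := measure_univ
  rw [cg_density hv, withDensity_apply _ MeasurableSet.univ, Measure.restrict_univ,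
    lintegral_const_mul _ (by fun_prop)] at h1
  have h2 : ∀ z : ℂ, -((n : ℝ) / 2) * ‖z‖ ^ 2 = -‖z‖ ^ 2 / ((2 / n : ℝ≥0) : ℝ) := by
    intro z
    push_cast
    have : (n : ℝ) ≠ 0 := by exact_mod_cast hn
    field_simp
  simp_rw [h2]
  intro h
  rw [h, ENNReal.mul_top] at h1
  · simp at h1
  · have : (0 : ℝ) < ((2 / n : ℝ≥0) : ℝ) := by positivity
    have : 0 < (π * ((2 / n : ℝ≥0) : ℝ))⁻¹ := by positivity
    exact (ENNReal.ofReal_pos.2 this).ne'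

theorem PS_fin {θ : ℝ} (hc : Real.cos θ ≠ 0) (hs : Real.sin θ ≠ 0) {n : ℕ} (hn : n ≠ 0) :
    ∫⁻ t, PS θ n t ≠ ∞ := by
  set g : ℂ → ℝ≥0∞ := fun z => ENNReal.ofReal (Real.exp (-((n : ℝ) / 2) * ‖z‖ ^ 2)) with hg
  have hgm : Measurable g := by rw [hg]; fun_prop
  have hb : ∀ t : EE n, PS θ n t ≤ ∏ i, ∏ j, g (t i j) := by
    intro t
    unfold PS
    simp only [hg]
    simp_rw [← ENNReal.ofReal_prod_of_nonneg (fun i _ => (Real.exp_pos _).le), ← Real.exp_sum]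
    rw [← ENNReal.ofReal_prod_of_nonneg (fun i _ => (Real.exp_pos _).le), ← Real.exp_sum]
    refine ENNReal.ofReal_le_ofReal ?_
    rw [psi_formula, Real.exp_le_exp]
    simp_rw [← Finset.mul_sum]
    refine mul_le_mul_of_nonpos_left ?_ (by simp; positivity)
    have h1 : ∑ i, ∑ j, ‖t i j‖ ^ 2 = ∑ i, ∑ j, (‖t i j‖ ^ 2 + ‖t j i‖ ^ 2) / 2 := by
      have h2 : ∑ i, ∑ j, ‖t i j‖ ^ 2 = ∑ i, ∑ j, ‖t j i‖ ^ 2 := Finset.sum_comm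
      simp_rw [← Finset.sum_div, Finset.sum_add_distrib]
      rw [← h2]; ring
    rw [h1]
    exact Finset.sum_le_sum fun i _ => Finset.sum_le_sum fun j _ => qf_ge hc hs _ _
  refine ne_top_of_le_ne_top ?_ (lintegral_mono hb)
  have h3 : ∫⁻ t : EE n, ∏ i, ∏ j, g (t i j) = ∏ i : Fin n, ∫⁻ x : Fin n → ℂ, ∏ j, g (x j) :=
    lint_pi (fun _ => volume) (fun _ (x : Fin n → ℂ) => ∏ j, g (x j))
      (fun i => Finset.measurable_prod _ fun j _ => hgm.comp (measurable_pi_apply j))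
  rw [h3]
  refine ENNReal.prod_ne_top fun i _ => ?_
  have h4 : ∫⁻ x : Fin n → ℂ, ∏ j, g (x j) = ∏ j : Fin n, ∫⁻ z : ℂ, g z :=
    lint_pi (fun _ => volume) (fun _ z => g z) (fun _ => hgm)
  rw [h4]
  exact ENNReal.prod_ne_top fun j _ => lint_gauss hn

theorem PS_pos (θ : ℝ) (n : ℕ) (t : EE n) : PS θ n t ≠ 0 := by
  unfold PS
  rw [psi_formula]
  exact (ENNReal.ofReal_pos.2 (Real.exp_pos _)).ne'

theorem PS_ne_zero (θ : ℝ) (n : ℕ) : ∫⁻ t, PS θ n t ≠ 0 := by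
  rw [← pos_iff_ne_zero, lintegral_pos_iff_support (meas_PS θ n)]
  have : Function.support (PS θ n) = Set.univ := by
    ext t; simp [PS_pos]
  rw [this]
  exact isOpen_univ.measure_pos volume Set.univ_nonempty

theorem psi_DS {θ : ℝ} (hc : Real.cos θ ≠ 0) (hs : Real.sin θ ≠ 0) (n : ℕ) (d : Fin n → ℂ) (S : EE n)
    (hS : ∀ i j, ¬ i < j → S i j = 0) :
    psiTheta θ n (Matrix.of (Matrix.of.symm (Matrix.diagonal d) + S)) =
      Real.exp (-((n : ℝ) / 2) * ∑ i : Fin n, ((d i).re ^ 2 / Real.cos θ ^ 2 + (d i).im ^ 2 / Real.sin θ ^ 2)) *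
      Real.exp (-(∑ i, ∑ j, ‖S i j‖ ^ 2) * n / Real.sin (2 * θ) ^ 2) := by
  rw [psi_formula, ← Real.exp_add]
  congr 1
  have key : ∀ i j : Fin n, qf θ ((Matrix.of.symm (Matrix.diagonal d) + S) i j) ((Matrix.of.symm (Matrix.diagonal d) + S) j i) =
      (if i = j then ((d i).re ^ 2 / Real.cos θ ^ 2 + (d i).im ^ 2 / Real.sin θ ^ 2) else 0) +
      (‖S i j‖ ^ 2 + ‖S j i‖ ^ 2) / Real.sin (2 * θ) ^ 2 := by
    intro i j
    have hDS : ∀ i j, (Matrix.of.symm (Matrix.diagonal d) + S) i j = Matrix.diagonal d i j + S i j := fun _ _ => rfl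
    rw [hDS, hDS]
    have hcs := Real.sin_sq_add_cos_sq θ
    have hq : ∀ a : ℂ, ‖a / 2‖ ^ 2 / Real.cos θ ^ 2 + ‖a / 2‖ ^ 2 / Real.sin θ ^ 2 = ‖a‖ ^ 2 / Real.sin (2 * θ) ^ 2 := by
      intro a
      rw [Real.sin_two_mul, norm_div]
      simp
      field_simp
      rw [hcs]
      ring
    by_cases hij : i = j
    · subst hij
      have h0 : S i i = 0 := hS i i (lt_irrefl _)
      simp only [Matrix.diagonal_apply_eq, h0, add_zero, if_true, norm_zero]
      unfold qf
      simp only [← Complex.normSq_eq_norm_sq, Complex.normSq_apply]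
      simp
      ring
    · rw [Matrix.diagonal_apply_ne _ hij, Matrix.diagonal_apply_ne _ (Ne.symm hij), if_neg hij, zero_add, zero_add, zero_add]
      rcases lt_or_gt_of_ne hij with hl | hl
      · have h0 : S j i = 0 := hS j i (not_lt.2 hl.le)
        rw [h0]
        unfold qf
        simp only [star_zero, add_zero, sub_zero, norm_zero]
        rw [hq]; simp
      · have h0 : S i j = 0 := hS i j (not_lt.2 hl.le)
        rw [h0]
        unfold qf
        simp only [zero_add, zero_sub, norm_zero, neg_div, norm_neg]
        rw [hq, norm_star]; simp
  simp_rw [Matrix.of_apply, key, Finset.sum_add_distrib, ← Finset.sum_div, Finset.sum_add_distrib]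
  rw [show ∑ i, ∑ j, ‖S j i‖ ^ 2 = ∑ i, ∑ j, ‖S i j‖ ^ 2 from Finset.sum_comm]
  simp [Finset.sum_add_distrib, ← Finset.sum_div]
  ring

theorem vand_nonneg {n : ℕ} (d : Fin n → ℂ) : 0 ≤ vand d := by
  unfold vand
  refine Finset.prod_nonneg fun i _ => Finset.prod_nonneg fun j _ => ?_
  split_ifs <;> positivity

theorem J_eq {θ : ℝ} (hc : Real.cos θ ≠ 0) (hs : Real.sin θ ≠ 0) {n : ℕ} (hn : n ≠ 0) :
    ∃ C : ℝ≥0∞, C ≠ 0 ∧ C ≠ ∞ ∧ ∀ f : EE n → ℝ≥0∞, Measurable f → KInv f → ∫⁻ M, PS θ n M * f M ≠ ∞ →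
      ∫⁻ d, ENNReal.ofReal (thetaDensity θ n d) *
        ∫⁻ S, f (Matrix.of.symm (Matrix.diagonal d) + fun i j => (Real.sin (2 * θ) : ℂ) * S i j) ∂(GTlaw n) =
      C * ∫⁻ M, PS θ n M * f M := by
  have hs2 : Real.sin (2 * θ) ≠ 0 := by
    rw [Real.sin_two_mul]; exact mul_ne_zero (mul_ne_zero two_ne_zero hs) hc
  obtain ⟨c, hc0, hct, hgt⟩ := gt_density hn hs2
  obtain ⟨D, hD0, hDt, hD⟩ := LM4 (meas_PS θ n) (KInv_PS θ n) (PS_ne_zero θ n) (PS_fin hc hs hn)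
  refine ⟨c * D, mul_ne_zero hc0 hD0, ENNReal.mul_ne_top hct hDt, ?_⟩
  intro f hf hfK hfin
  have hsc : Measurable (fun S : EE n => (fun i j => (Real.sin (2 * θ) : ℂ) * S i j : EE n)) :=
    measurable_pi_lambda _ fun i => measurable_pi_lambda _ fun j => by fun_prop
  have hadd : ∀ A : EE n, Measurable fun S : EE n => A + S := fun A =>
    measurable_pi_lambda _ fun i => measurable_pi_lambda _ fun j => by
      simp only [Pi.add_apply]; fun_prop
  have hem : Measurable fun S : EE n => ENNReal.ofReal (Real.exp (-(∑ i, ∑ j, ‖S i j‖ ^ 2) * n / Real.sin (2 * θ) ^ 2)) := by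
    fun_prop
  have hG : Measurable fun T : EE n => ENNReal.ofReal (vand fun i => T i i) * (PS θ n T * f T) := by
    refine Measurable.mul ?_ ((meas_PS θ n).mul hf)
    have hdg : Measurable fun (T : EE n) (i : Fin n) => T i i := measurable_pi_lambda _ fun i => by fun_prop
    exact meas_vand.comp hdg
  have h1 := hD (fun M => PS θ n M * f M) ((meas_PS θ n).mul hf)
    (fun U hU M => by show PS θ n _ * f _ = _; rw [KInv_PS θ n U hU M, hfK U hU M]) hfin
  rw [split_DU hG] at h1
  rw [mul_assoc, ← h1, ← lintegral_const_mul' _ _ hct]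
  refine lintegral_congr fun d => ?_
  have h2 : ∫⁻ S, f (Matrix.of.symm (Matrix.diagonal d) + fun i j => (Real.sin (2 * θ) : ℂ) * S i j) ∂(GTlaw n)
      = ∫⁻ S, f (Matrix.of.symm (Matrix.diagonal d) + S) ∂((GTlaw n).map (fun S => (fun i j => (Real.sin (2 * θ) : ℂ) * S i j : EE n))) :=
    (lintegral_map (hf.comp (hadd _)) hsc).symm
  have h2' := lintegral_withDensity_eq_lintegral_mul (muSU n) (hem.const_mul c) (hf.comp (hadd (Matrix.of.symm (Matrix.diagonal d))))
  simp only [Function.comp_def] at h2'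
  rw [h2, hgt, h2', ← lintegral_const_mul' _ _ ENNReal.ofReal_ne_top, ← lintegral_const_mul' _ _ hct]
  refine lintegral_congr_ae ?_
  have hae : ∀ᵐ S ∂(muSU n), ∀ i j : Fin n, ¬ i < j → S i j = 0 := muP_ae _
  filter_upwards [hae] with S hS
  have h3 : (fun i => (Matrix.of.symm (Matrix.diagonal d) + S) i i) = d := by
    funext i
    show Matrix.diagonal d i i + S i i = d i
    rw [hS i i (lt_irrefl _), Matrix.diagonal_apply_eq, add_zero]
  have h4 : thetaDensity θ n d = vand d * Real.exp (-((n : ℝ) / 2) * ∑ i : Fin n, ((d i).re ^ 2 / Real.cos θ ^ 2 + (d i).im ^ 2 / Real.sin θ ^ 2)) := rfl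
  rw [h3, h4, PS, psi_DS hc hs n d S hS, ENNReal.ofReal_mul (vand_nonneg _), ENNReal.ofReal_mul (Real.exp_pos _).le]
  simp only [Pi.mul_apply, Function.comp_apply]
  ring

noncomputable def Ph {n : ℕ} (x : EE n × EE n) : EE n :=
  Matrix.of.symm ((Matrix.of x.1)ᴴ * Matrix.of x.2 * Matrix.of x.1)

theorem meas_Ph {n : ℕ} : Measurable (Ph (n := n)) := by
  refine meas_mul (A := fun x : EE n × EE n => (Matrix.of.symm ((Matrix.of x.1)ᴴ * Matrix.of x.2) : EE n))
    (B := fun x : EE n × EE n => x.1) ?_ measurable_fst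
  refine meas_mul (A := fun x : EE n × EE n => (Matrix.of.symm ((Matrix.of x.1)ᴴ) : EE n)) ?_ measurable_snd
  refine measurable_pi_lambda _ fun i => measurable_pi_lambda _ fun j => ?_
  show Measurable fun x : EE n × EE n => star (x.1 j i)
  have : Measurable fun x : EE n × EE n => x.1 j i := by fun_prop
  exact continuous_star.measurable.comp this

noncomputable def Fb {n : ℕ} (h : Measure (EE n)) (f : EE n → ℝ≥0∞) (M : EE n) : ℝ≥0∞ :=
  ∫⁻ V, f (Ph (V, M)) ∂h

theorem meas_Fb {n : ℕ} (h : Measure (EE n)) [IsProbabilityMeasure h] {f : EE n → ℝ≥0∞} (hf : Measurable f) :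
    Measurable (Fb h f) :=
  (hf.comp meas_Ph).lintegral_prod_left'

theorem KInv_Fb {n : ℕ} (h : Measure (EE n)) 
    (hinv : ∀ U : Matrix (Fin n) (Fin n) ℂ, U ∈ Matrix.unitaryGroup (Fin n) ℂ →
      h.map (fun V => (Matrix.of.symm (U * Matrix.of V) : EE n)) = h)
    {f : EE n → ℝ≥0∞} (hf : Measurable f) : KInv (Fb h f) := by
  intro U hU M
  have hU' : Uᴴ ∈ Matrix.unitaryGroup (Fin n) ℂ := Unitary.star_mem hU
  have hm : Measurable fun V : EE n => (Matrix.of.symm (Uᴴ * Matrix.of V) : EE n) :=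
    meas_mul (A := fun _ => (Matrix.of.symm Uᴴ : EE n)) measurable_const measurable_id
  have hg : Measurable fun V : EE n => f (Ph (V, (Matrix.of.symm M : EE n))) :=
    (hf.comp meas_Ph).comp (measurable_id.prodMk measurable_const)
  unfold Fb
  conv_rhs => rw [← hinv _ hU', lintegral_map hg hm]
  refine lintegral_congr fun V => ?_
  congr 1
  show Matrix.of.symm ((Matrix.of V)ᴴ * (U * M * Uᴴ) * Matrix.of V) =
    Matrix.of.symm ((Uᴴ * Matrix.of V)ᴴ * M * (Uᴴ * Matrix.of V))
  rw [conjTranspose_mul, conjTranspose_conjTranspose]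
  simp only [Matrix.mul_assoc]

theorem Fb_int {n : ℕ} (h : Measure (EE n)) [IsProbabilityMeasure h]
    (hsupp : ∀ᵐ U ∂h, Matrix.of U ∈ Matrix.unitaryGroup (Fin n) ℂ)
    {f ψ : EE n → ℝ≥0∞} (hf : Measurable f) (hψ : Measurable ψ) (hψK : KInv ψ) :
    ∫⁻ M, ψ M * Fb h f M = ∫⁻ M, ψ M * f M := by
  have hm : Measurable fun x : EE n × EE n => ψ x.1 * f (Ph (x.2, x.1)) :=
    (hψ.comp measurable_fst).mul ((hf.comp meas_Ph).comp measurable_swap)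
  have h1 : ∀ M, ψ M * Fb h f M = ∫⁻ V, ψ M * f (Ph (V, M)) ∂h := fun M => by
    unfold Fb
    rw [lintegral_const_mul]
    exact (hf.comp meas_Ph).comp (measurable_id.prodMk measurable_const)
  simp_rw [h1]
  rw [lintegral_lintegral_swap hm.aemeasurable]
  have h2 : ∀ᵐ V ∂h, ∫⁻ M, ψ M * f (Ph (V, M)) = ∫⁻ M, ψ M * f M := by
    filter_upwards [hsupp] with V hV
    have hV1 : (Matrix.of V)ᴴ * Matrix.of V = 1 := (Matrix.mem_unitaryGroup_iff').1 hV
    have hV' : (Matrix.of V)ᴴ ∈ Matrix.unitaryGroup (Fin n) ℂ := Unitary.star_mem hV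
    have mp := mp_toE _ (det_conjL _ _ hV1)
    have h3 : ∀ M : EE n, toE (conjL (Matrix.of V)ᴴ (Matrix.of V)) M = Ph (V, M) := by
      intro M
      show Matrix.of.symm ((Matrix.of V)ᴴ * (Matrix.of M * Matrix.of V)) = Matrix.of.symm ((Matrix.of V)ᴴ * Matrix.of M * Matrix.of V)
      rw [Matrix.mul_assoc]
    have h4 : ∀ M, ψ (Ph (V, M)) = ψ M := by
      intro M
      have := hψK _ hV' (Matrix.of M)
      rw [conjTranspose_conjTranspose] at this
      exact this
    rw [← mp.lintegral_comp (f := fun M => ψ M * f M) (hψ.mul hf)]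
    refine lintegral_congr fun M => ?_
    rw [h3, h4]
  rw [lintegral_congr_ae h2]
  simp

theorem stmt5' (θ : ℝ) (hθ : θ ∈ Set.Ioo 0 (π / 2)) (n : ℕ) (hn : 1 ≤ n)
    (h : Measure (Fin n → Fin n → ℂ)) [IsProbabilityMeasure h]
    (hsupp : h {U | Matrix.of U ∈ Matrix.unitaryGroup (Fin n) ℂ} = 1)
    (hinv : ∀ U : Matrix (Fin n) (Fin n) ℂ, U ∈ Matrix.unitaryGroup (Fin n) ℂ →
      h.map (fun V => Matrix.of.symm (U * Matrix.of V)) = h) :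
    ((h.prod ((nuTheta θ n).prod (GTlaw n))).map fun x =>
        Matrix.of.symm ((Matrix.of x.1)ᴴ *
          (Matrix.diagonal x.2.1 + (Real.sin (2 * θ) : ℂ) • Matrix.of x.2.2) *
            Matrix.of x.1))
      = kappaY θ n := by
  have hc : Real.cos θ ≠ 0 := (Real.cos_pos_of_mem_Ioo ⟨by linarith [hθ.1, Real.pi_pos], hθ.2⟩).ne'
  have hs : Real.sin θ ≠ 0 := (Real.sin_pos_of_pos_of_lt_pi hθ.1 (by linarith [hθ.2, Real.pi_pos])).ne'
  have hn0 : n ≠ 0 := by omega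
  obtain ⟨C, hC0, hCt, hC⟩ := J_eq hc hs hn0
  set L : ℝ≥0∞ := ∫⁻ M, PS θ n M with hL
  have hL0 : L ≠ 0 := PS_ne_zero θ n
  have hLt : L ≠ ∞ := PS_fin hc hs hn0
  have hsupp' : ∀ᵐ U ∂h, Matrix.of U ∈ Matrix.unitaryGroup (Fin n) ℂ := by
    have hms : MeasurableSet {U : EE n | Matrix.of U ∈ Matrix.unitaryGroup (Fin n) ℂ} := by
      have : {U : EE n | Matrix.of U ∈ Matrix.unitaryGroup (Fin n) ℂ} =
          (fun U : EE n => Ph (U, (Matrix.of.symm 1 : EE n))) ⁻¹' {Matrix.of.symm 1} := by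
        ext U
        simp only [Set.mem_ofPred_eq, Set.mem_preimage, Set.mem_singleton_iff, Matrix.mem_unitaryGroup_iff']
        show _ ↔ Matrix.of.symm ((Matrix.of U)ᴴ * 1 * Matrix.of U) = _
        rw [Matrix.mul_one, Equiv.apply_eq_iff_eq]
        rfl
      rw [this]
      exact (meas_Ph.comp (measurable_id.prodMk measurable_const)) (measurableSet_singleton _)
    exact (prob_compl_eq_zero_iff hms).2 hsupp
  -- thetaDensity
  have htm : Measurable fun d : Fin n → ℂ => thetaDensity θ n d := by
    unfold thetaDensity
    refine Measurable.mul ?_ (by fun_prop)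
    refine Finset.measurable_prod _ fun i _ => Finset.measurable_prod _ fun j _ => ?_
    split_ifs <;> fun_prop
  have ht0 : ∀ d, 0 ≤ thetaDensity θ n d := fun d => mul_nonneg (vand_nonneg d) (Real.exp_pos _).le
  have hp0 : ∀ M, 0 ≤ psiTheta θ n M := fun M => (Real.exp_pos _).le
  have hT : ∫⁻ d, ENNReal.ofReal (thetaDensity θ n d) = C * L := by
    have := hC (fun _ => 1) measurable_const (fun _ _ _ => rfl) (by simpa using hLt)
    simpa using this
  have hTi : ENNReal.ofReal (∫ d, thetaDensity θ n d) = C * L := by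
    rw [integral_eq_lintegral_of_nonneg_ae (Filter.Eventually.of_forall ht0) htm.aestronglyMeasurable, hT,
      ENNReal.ofReal_toReal (ENNReal.mul_ne_top hCt hLt)]
  have hPi : ENNReal.ofReal (∫ t : EE n, psiTheta θ n (Matrix.of t)) = L := by
    rw [integral_eq_lintegral_of_nonneg_ae (Filter.Eventually.of_forall fun t => hp0 _)
      (meas_psi θ n).measurable.aestronglyMeasurable]
    exact ENNReal.ofReal_toReal hLt
  have hCL0 : C * L ≠ 0 := mul_ne_zero hC0 hL0
  have hCLt : C * L ≠ ∞ := ENNReal.mul_ne_top hCt hLt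
  have hnu : nuTheta θ n = (C * L)⁻¹ • volume.withDensity fun d => ENNReal.ofReal (thetaDensity θ n d) := by
    unfold nuTheta; rw [hTi]
  have hka : kappaY θ n = L⁻¹ • volume.withDensity (PS θ n) := by
    unfold kappaY; rw [hPi]; rfl
  have hnp : IsProbabilityMeasure (nuTheta θ n) := by
    constructor
    rw [hnu, Measure.smul_apply, withDensity_apply _ MeasurableSet.univ, Measure.restrict_univ, hT, smul_eq_mul,
      ENNReal.inv_mul_cancel hCL0 hCLt]
  have hDS : Measurable fun y : (Fin n → ℂ) × EE n => (Matrix.of.symm (Matrix.diagonal y.1) + fun i j => (Real.sin (2 * θ) : ℂ) * y.2 i j : EE n) := by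
    refine measurable_pi_lambda _ fun i => measurable_pi_lambda _ fun j => ?_
    show Measurable fun y : (Fin n → ℂ) × EE n => Matrix.diagonal y.1 i j + (Real.sin (2 * θ) : ℂ) * y.2 i j
    refine Measurable.add ?_ (by fun_prop)
    by_cases hij : i = j
    · subst hij
      simp only [Matrix.diagonal_apply_eq]; fun_prop
    · simp only [Matrix.diagonal_apply_ne _ hij]; fun_prop
  have hmap : (fun x : EE n × (Fin n → ℂ) × EE n => (Matrix.of.symm ((Matrix.of x.1)ᴴ *
          (Matrix.diagonal x.2.1 + (Real.sin (2 * θ) : ℂ) • Matrix.of x.2.2) *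
            Matrix.of x.1) : EE n)) = fun x => Ph (x.1, (Matrix.of.symm (Matrix.diagonal x.2.1) + fun i j => (Real.sin (2 * θ) : ℂ) * x.2.2 i j : EE n)) := by
    funext x
    rfl
  have hmm : Measurable fun x : EE n × (Fin n → ℂ) × EE n => Ph (x.1, (Matrix.of.symm (Matrix.diagonal x.2.1) + fun i j => (Real.sin (2 * θ) : ℂ) * x.2.2 i j : EE n)) :=
    meas_Ph.comp (measurable_fst.prodMk (hDS.comp measurable_snd))
  refine Measure.ext fun A hA => ?_
  have hka2 : kappaY θ n A = L⁻¹ * ∫⁻ M, PS θ n M * A.indicator 1 M := by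
    rw [hka, Measure.smul_apply, withDensity_apply _ hA, smul_eq_mul, ← lintegral_indicator hA]
    congr 1
    refine lintegral_congr fun M => ?_
    by_cases hM : M ∈ A <;> simp [hM]
  have hf : Measurable (A.indicator (1 : EE n → ℝ≥0∞)) := measurable_one.indicator hA
  have hFint := Fb_int h hsupp' hf (meas_PS θ n) (KInv_PS θ n)
  have hfin : ∫⁻ M, PS θ n M * Fb h (A.indicator 1) M ≠ ∞ := by
    rw [hFint]
    refine ne_top_of_le_ne_top hLt (lintegral_mono fun M => ?_)
    by_cases hM : M ∈ A <;> simp [hM]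
  have hJ := hC (Fb h (A.indicator 1)) (meas_Fb h hf) (KInv_Fb h hinv hf) hfin
  rw [hFint] at hJ
  have hFDS := (meas_Fb h hf).comp hDS
  have hl : (h.prod ((nuTheta θ n).prod (GTlaw n))).map (fun x : EE n × (Fin n → ℂ) × EE n => Ph (x.1, (Matrix.of.symm (Matrix.diagonal x.2.1) + fun i j => (Real.sin (2 * θ) : ℂ) * x.2.2 i j : EE n))) A
      = ∫⁻ d, ∫⁻ S, Fb h (A.indicator 1) (Matrix.of.symm (Matrix.diagonal d) + fun i j => (Real.sin (2 * θ) : ℂ) * S i j) ∂(GTlaw n) ∂(nuTheta θ n) := by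
    rw [← lintegral_indicator_one hA, lintegral_map hf hmm]
    refine (lintegral_prod_symm' _ (hf.comp hmm)).trans ?_
    exact lintegral_prod _ hFDS.aemeasurable
  have hin : Measurable fun d => ∫⁻ S, Fb h (A.indicator 1) (Matrix.of.symm (Matrix.diagonal d) + fun i j => (Real.sin (2 * θ) : ℂ) * S i j) ∂(GTlaw n) :=
    hFDS.lintegral_prod_right'
  have hw := lintegral_withDensity_eq_lintegral_mul volume htm.ennreal_ofReal hin
  simp only [Pi.mul_apply] at hw
  rw [hmap, hl, hka2, hnu, lintegral_smul_measure, hw, hJ, smul_eq_mul, ← mul_assoc,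
    ENNReal.mul_inv (Or.inl hC0) (Or.inl hCt), mul_comm C⁻¹, mul_assoc L⁻¹, ENNReal.inv_mul_cancel hC0 hCt, mul_one]

/-- Dyson's theorem for elliptic Gaussian random matrices: if `h` is the Haar probability
measure on the unitary group `U(n)`, `ν_n` the eigenvalue distribution above, and `GT(n)` the
strictly upper triangular Gaussian law, then the pushforward of `h ⊗ ν_n ⊗ GT(n)` under
`(U,d,S) ↦ U*(diag(d) + sin(2θ)·S)U` equals `κ_Y`, the law of
`(cos θ)H₁ + i(sin θ)H₂` for independent GUE matrices `H₁, H₂`. -/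
theorem stmt5 (θ : ℝ) (hθ : θ ∈ Set.Ioo 0 (π / 2)) (n : ℕ) (hn : 1 ≤ n)
    (h : Measure (Fin n → Fin n → ℂ)) [IsProbabilityMeasure h]
    (hsupp : h {U | Matrix.of U ∈ Matrix.unitaryGroup (Fin n) ℂ} = 1)
    (hinv : ∀ U : Matrix (Fin n) (Fin n) ℂ, U ∈ Matrix.unitaryGroup (Fin n) ℂ →
      h.map (fun V => Matrix.of.symm (U * Matrix.of V)) = h) :
    ((h.prod ((nuTheta θ n).prod (GTlaw n))).map fun x =>
        Matrix.of.symm ((Matrix.of x.1)ᴴ *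
          (Matrix.diagonal x.2.1 + (Real.sin (2 * θ) : ℂ) • Matrix.of x.2.2) *
            Matrix.of x.1))
      = kappaY θ n := by
  exact stmt5' θ hθ n hn h hsupp hinv
end

section
/- Let N be a positive natural number. Define α_N(0) = 1 and, for p ≥ 1, α_N(p) = (p − 1/N)(p − 2/N)⋯(p − p/N)/(p+1)!. Then there exists r > 0 such that for every w ∈ ℂ with |w| < r, the series Σ_{p=0}^∞ α_N(p)·(w·(1 + w/N)^{−N})^{p+1} converges and equals 1 − (1 + w/N)^{−N}. (Equivalently: the function K_N(t) = t/(1 − Σ_{p=0}^∞ α_N(p)·t^{p+1}) is defined, analytic and invertible with respect to composition in a neighborhood of 0, with inverse K_N^{⟨−1⟩}(z) = z·(1 + z/N)^{−N}.) -/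
/-- `α_N(p) = (p − 1/N)(p − 2/N)⋯(p − p/N)/(p+1)!`, with `α_N(0) = 1`. -/
noncomputable def alphaN (N p : ℕ) : ℝ :=
  (∏ m ∈ Finset.Icc 1 p, ((p : ℝ) - (m : ℝ) / (N : ℝ))) / ((p + 1).factorial : ℝ)

lemma aux_row {𝕜 : Type*} [RCLike 𝕜] (M : ℕ) (y : 𝕜) (hy : ‖y‖ < 1) :
    HasSum (fun k : ℕ => ((M + k - 1).choose k : 𝕜) * y ^ k) (((1 - y)⁻¹) ^ M) := by
  cases M with
  | zero =>
    have := hasSum_single (f := fun k : ℕ => ((0 + k - 1).choose k : 𝕜) * y ^ k) 0 (by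
      intro k hk
      have : (0 + k - 1).choose k = 0 := Nat.choose_eq_zero_of_lt (by omega)
      simp only [this]; simp)
    simpa using this
  | succ m =>
    have := hasSum_choose_mul_geometric_of_norm_lt_one m hy
    rw [inv_pow, ← one_div]
    refine this.congr_fun ?_ |> id
    intro k
    have h : m + 1 + k - 1 = k + m := by omega
    rw [h, Nat.choose_symm_add]

open Polynomial in
lemma aux_diff (n m : ℕ) :
    ∑ q ∈ Finset.range (m + 2), ((-1 : ℂ) ^ (m + 1 - q) * ((m + 1).choose q : ℂ)) *
      ∏ i ∈ Finset.range m, ((n : ℂ) * ((q : ℂ) - 1) + i) = 0 := by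
  let P : ℂ[X] := ∏ i ∈ Finset.range m, (C (n : ℂ) * (X - C 1) + C (i : ℂ))
  have hd : P.natDegree < m + 1 := by
    have : P.natDegree ≤ ∑ i ∈ Finset.range m, 1 := by
      refine (natDegree_prod_le _ _).trans (Finset.sum_le_sum fun i _ => ?_)
      compute_degree
    simp at this; omega
  have h := congrFun (Polynomial.fwdDiff_iter_eq_zero_of_degree_lt hd) 0
  rw [fwdDiff_iter_eq_sum_shift] at h
  simp only [Pi.zero_apply, zero_add, nsmul_eq_mul, mul_one, zsmul_eq_mul] at h
  rw [← h]
  refine Finset.sum_congr rfl fun q _ => ?_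
  simp [P, eval_prod]

lemma aux_prod (N p k : ℕ) :
    (∏ j ∈ Finset.Icc 1 p, ((N : ℂ) * p - j)) * ∏ i ∈ Finset.range k, ((N : ℂ) * p + i)
      = ∏ i ∈ Finset.range (p + k), ((N : ℂ) * p - p + i) := by
  rw [Finset.prod_range_add]
  congr 1
  · rw [← Finset.prod_range_reflect, Finset.range_eq_Ico]
    have h := Finset.prod_Ico_add' (fun j : ℕ => ((N : ℂ) * p - j)) 0 p 1
    have h' : Finset.Icc 1 p = Finset.Ico (0 + 1) (p + 1) := by ext; simp; try omega
    rw [h', ← h]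
    refine Finset.prod_congr rfl fun i hi => ?_
    have hi' : i < p := (Finset.mem_Ico.1 hi).2
    rw [show p - 1 - i = p - (i + 1) by omega, Nat.cast_sub hi']
    ring
  · refine Finset.prod_congr rfl fun i _ => ?_
    push_cast; ring

lemma aux_T (n p k : ℕ) :
    (alphaN (n + 1) p : ℂ) * ((n + 1 : ℕ) : ℂ) ^ (p + 1) * (-1) ^ k *
      ((((n + 1) * p + k - 1).choose k : ℕ) : ℂ) =
    ((n + 1 : ℕ) : ℂ) / ((p + k + 1).factorial : ℂ) * ((-1 : ℂ) ^ k * ((p + k + 1).choose (p + 1) : ℂ) *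
      ∏ i ∈ Finset.range (p + k), ((n : ℂ) * (((p + 1 : ℕ) : ℂ) - 1) + i)) := by
  have hN : ((n + 1 : ℕ) : ℂ) ≠ 0 := by exact_mod_cast Nat.succ_ne_zero n
  have h1 : (k.factorial : ℂ) * ((((n + 1) * p + k - 1).choose k : ℕ) : ℂ)
      = ∏ i ∈ Finset.range k, (((n + 1 : ℕ) : ℂ) * p + i) := by
    have := Nat.ascFactorial_eq_factorial_mul_choose' ((n + 1) * p) k
    rw [Nat.ascFactorial_eq_prod_range] at this
    have h := congrArg (Nat.cast (R := ℂ)) this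
    push_cast at h ⊢
    exact h.symm
  have h2 : (alphaN (n + 1) p : ℂ) * ((n + 1 : ℕ) : ℂ) ^ p * ((p + 1).factorial : ℂ)
      = ∏ j ∈ Finset.Icc 1 p, (((n + 1 : ℕ) : ℂ) * p - j) := by
    have hf : ((p + 1).factorial : ℂ) ≠ 0 := by exact_mod_cast (Nat.factorial_ne_zero _)
    have hc : ((n + 1 : ℕ) : ℂ) ^ p = ∏ j ∈ Finset.Icc 1 p, ((n + 1 : ℕ) : ℂ) := by simp
    unfold alphaN
    rw [hc]
    push_cast [-Nat.cast_add, -Nat.cast_succ]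
    rw [div_mul_eq_mul_div, div_mul_cancel₀ _ hf, ← Finset.prod_mul_distrib]
    refine Finset.prod_congr rfl fun j _ => ?_
    field_simp
  have h3 : ((p + k + 1).choose (p + 1) : ℂ) * ((p + 1).factorial : ℂ) * (k.factorial : ℂ)
      = ((p + k + 1).factorial : ℂ) := by
    have := Nat.add_choose_mul_factorial_mul_factorial (p + 1) k
    rw [show p + 1 + k = p + k + 1 by ring] at this
    rw [← Nat.choose_symm_of_eq_add (show p + k + 1 = (p + 1) + k by ring)] at this
    exact_mod_cast this
  have h4 := aux_prod (n + 1) p k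
  rw [← h1, ← h2] at h4
  have h5 : ∏ i ∈ Finset.range (p + k), ((n : ℂ) * (((p + 1 : ℕ) : ℂ) - 1) + i)
     = ∏ i ∈ Finset.range (p + k), (((n + 1 : ℕ) : ℂ) * p - p + i) := by
    refine Finset.prod_congr rfl fun i _ => ?_
    push_cast; ring
  rw [h5, ← h4]
  have hf : ((p + k + 1).factorial : ℂ) ≠ 0 := by exact_mod_cast (Nat.factorial_ne_zero _)
  rw [div_mul_eq_mul_div, eq_div_iff hf, ← h3]
  ring

lemma aux_coeff (n m : ℕ) :
    ∑ x ∈ Finset.HasAntidiagonal.antidiagonal m,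
      (alphaN (n + 1) x.1 : ℂ) * ((n + 1 : ℕ) : ℂ) ^ (x.1 + 1) * (-1) ^ x.2 *
      ((((n + 1) * x.1 + x.2 - 1).choose x.2 : ℕ) : ℂ) = ((n + 1).choose (m + 1) : ℂ) := by
  have hf : ((m + 1).factorial : ℂ) ≠ 0 := by exact_mod_cast (Nat.factorial_ne_zero _)
  have h0 : ∑ x ∈ Finset.HasAntidiagonal.antidiagonal m,
      (alphaN (n + 1) x.1 : ℂ) * ((n + 1 : ℕ) : ℂ) ^ (x.1 + 1) * (-1) ^ x.2 *
      ((((n + 1) * x.1 + x.2 - 1).choose x.2 : ℕ) : ℂ)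
      = ∑ x ∈ Finset.HasAntidiagonal.antidiagonal m, ((n + 1 : ℕ) : ℂ) / ((m + 1).factorial : ℂ) *
        ((-1 : ℂ) ^ x.2 * ((m + 1).choose (x.1 + 1) : ℂ) *
      ∏ i ∈ Finset.range m, ((n : ℂ) * (((x.1 + 1 : ℕ) : ℂ) - 1) + i)) := by
    refine Finset.sum_congr rfl fun x hx => ?_
    rw [aux_T, Finset.HasAntidiagonal.mem_antidiagonal.1 hx]
  rw [h0, ← Finset.mul_sum, Finset.Nat.sum_antidiagonal_eq_sum_range_succ_mk]
  have h := aux_diff n m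
  rw [Finset.sum_range_succ'] at h
  simp only [Nat.add_sub_add_right] at h
  have h6 : (-1 : ℂ) ^ m * ∏ i ∈ Finset.range m, (-(n : ℂ) + i) = (n.descFactorial m : ℂ) := by
    clear h h0 hf
    induction m with
    | zero => simp
    | succ m ih =>
      rw [Finset.prod_range_succ, pow_succ, Nat.descFactorial_succ, Nat.cast_mul, ← ih]
      rcases le_or_gt m n with hmn | hmn
      · rw [Nat.cast_sub hmn]; ring
      · rw [Nat.sub_eq_zero_of_le hmn.le]
        have : ∏ i ∈ Finset.range m, (-(n : ℂ) + i) = 0 :=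
          Finset.prod_eq_zero (Finset.mem_range.2 hmn) (by ring)
        rw [this]; simp
  have h7 : ((n + 1 : ℕ) : ℂ) * (n.descFactorial m : ℂ)
      = ((m + 1).factorial : ℂ) * ((n + 1).choose (m + 1) : ℂ) := by
    rw [← Nat.cast_mul, ← Nat.cast_mul, ← Nat.descFactorial_eq_factorial_mul_choose,
      Nat.succ_descFactorial_succ]
  have h8 := eq_neg_of_add_eq_zero_left h
  rw [div_mul_eq_mul_div, div_eq_iff hf, mul_comm ((n + 1).choose (m + 1) : ℂ), ← h7, ← h6]
  congr 1
  refine h8.trans ?_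
  simp
  ring

lemma aux_bound (N p : ℕ) (hN : 0 < N) : |alphaN N p| ≤ 3 ^ p := by
  have hN' : (1 : ℝ) ≤ N := by exact_mod_cast hN
  unfold alphaN
  rw [abs_div, Finset.abs_prod, Nat.abs_cast]
  have h1 : ∏ m ∈ Finset.Icc 1 p, |(p : ℝ) - (m : ℝ) / (N : ℝ)| ≤ (p : ℝ) ^ p := by
    calc _ ≤ ∏ m ∈ Finset.Icc 1 p, (p : ℝ) := by
          refine Finset.prod_le_prod (fun _ _ => abs_nonneg _) fun m hm => ?_
          have hm' : (m : ℝ) ≤ p := by exact_mod_cast (Finset.mem_Icc.1 hm).2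
          have h1 : (m : ℝ) / N ≤ m := div_le_self (by positivity) hN'
          have h2 : 0 ≤ (m : ℝ) / N := by positivity
          rw [abs_le]; constructor <;> linarith
      _ = _ := by simp
  have h2 : (p : ℝ) ^ p / (p.factorial : ℝ) ≤ Real.exp p :=
    Real.pow_div_factorial_le_exp _ (by positivity) _
  have h3 : Real.exp p ≤ 3 ^ p := by
    rw [← Real.exp_one_pow]
    gcongr
    exact Real.exp_one_lt_three.le
  refine le_trans ?_ (h2.trans h3)
  have : (p.factorial : ℝ) ≤ ((p + 1).factorial : ℝ) := by
    exact_mod_cast Nat.factorial_le (Nat.le_succ p)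
  gcongr

theorem stmt9 (N : ℕ) (hN : 0 < N) :
    ∃ r : ℝ, 0 < r ∧ ∀ w : ℂ, ‖w‖ < r →
      HasSum (fun p : ℕ => (alphaN N p : ℂ) * (w * ((1 + w / (N : ℂ))⁻¹) ^ N) ^ (p + 1))
        (1 - ((1 + w / (N : ℂ))⁻¹) ^ N) := by
  refine ⟨(3 * 2 ^ N)⁻¹, by positivity, fun w hw => ?_⟩
  have hNR : (1 : ℝ) ≤ N := by exact_mod_cast hN
  have hNC : (N : ℂ) ≠ 0 := by exact_mod_cast hN.ne'
  have hw3 : ‖w‖ * (3 * 2 ^ N) < 1 := by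
    rwa [← one_div, lt_div_iff₀ (by positivity)] at hw
  have hwhalf : ‖w‖ ≤ 1 / 2 := by
    have : (1 : ℝ) ≤ 2 ^ N := one_le_pow₀ (by norm_num)
    nlinarith [norm_nonneg w]
  set x : ℂ := w / N with hx
  have hxw : ‖x‖ ≤ 1 / 2 := by
    rw [hx, norm_div, Complex.norm_natCast]
    exact (div_le_self (norm_nonneg _) hNR).trans hwhalf
  have hwx : w = N * x := by rw [hx]; field_simp
  have hx1 : 1 + x ≠ 0 := by
    intro h
    have : x = -1 := by linear_combination h
    rw [this] at hxw; norm_num at hxw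
  let f : ℕ × ℕ → ℂ := fun q => (alphaN N q.1 : ℂ) * w ^ (q.1 + 1) *
    (((N * q.1 + q.2 - 1).choose q.2 : ℂ) * (-x) ^ q.2)
  have hrow : ∀ p, HasSum (fun k => f (p, k))
      ((alphaN N p : ℂ) * w ^ (p + 1) * ((1 + x)⁻¹) ^ (N * p)) := by
    intro p
    have := (aux_row (N * p) (-x) (by rw [norm_neg]; linarith)).mul_left
      ((alphaN N p : ℂ) * w ^ (p + 1))
    rw [sub_neg_eq_add] at this
    exact this
  have hrown : ∀ p, HasSum (fun k => ‖f (p, k)‖)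
      (|alphaN N p| * ‖w‖ ^ (p + 1) * ((1 - ‖x‖)⁻¹) ^ (N * p)) := by
    intro p
    have := (aux_row (𝕜 := ℝ) (N * p) ‖x‖ (by rw [norm_norm]; linarith)).mul_left
      (|alphaN N p| * ‖w‖ ^ (p + 1))
    refine this.congr_fun ?_ |> id
    intro k
    simp [f]
  have hsum : Summable f := by
    apply Summable.of_norm
    rw [summable_prod_of_nonneg (fun _ => norm_nonneg _)]
    refine ⟨fun p => (hrown p).summable, ?_⟩
    simp only [fun p => (hrown p).tsum_eq]
    refine Summable.of_nonneg_of_le (f := fun p => ‖w‖ * (‖w‖ * (3 * 2 ^ N)) ^ p)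
      (fun p => ?_) (fun p => ?_)
      ((summable_geometric_of_lt_one (by positivity) hw3).mul_left _)
    · have : 0 ≤ (1 - ‖x‖)⁻¹ := inv_nonneg.2 (by linarith)
      positivity
    · have h1 : 0 ≤ (1 - ‖x‖)⁻¹ := inv_nonneg.2 (by linarith)
      have h2 : (1 - ‖x‖)⁻¹ ≤ 2 := by
        rw [inv_le_comm₀ (by linarith) (by norm_num)]; linarith
      calc |alphaN N p| * ‖w‖ ^ (p + 1) * ((1 - ‖x‖)⁻¹) ^ (N * p)
          ≤ 3 ^ p * ‖w‖ ^ (p + 1) * 2 ^ (N * p) := by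
            gcongr
            exact aux_bound N p hN
        _ = _ := by rw [mul_pow, mul_pow, pow_mul]; ring
  have hA := hsum.hasSum.prod_fiberwise hrow
  have hB : HasSum (fun m : ℕ => ((N.choose (m + 1) : ℕ) : ℂ) * x ^ (m + 1)) (∑' q, f q) := by
    refine ((Finset.HasAntidiagonal.sigmaAntidiagonalEquivProd (A := ℕ)).hasSum_iff.2
      hsum.hasSum).sigma fun m => ?_
    have h := hasSum_fintype (fun c : Finset.HasAntidiagonal.antidiagonal m => f c.1)
    have h2 : ∑ c : Finset.HasAntidiagonal.antidiagonal m, f c.1 = ((N.choose (m + 1) : ℕ) : ℂ) * x ^ (m + 1) := by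
      rw [Finset.sum_coe_sort (Finset.HasAntidiagonal.antidiagonal m) f]
      obtain ⟨n, rfl⟩ : ∃ n, N = n + 1 := ⟨N - 1, by omega⟩
      rw [← aux_coeff n m, Finset.sum_mul]
      refine Finset.sum_congr rfl fun q hq => ?_
      rw [← Finset.HasAntidiagonal.mem_antidiagonal.1 hq]
      simp only [f]
      rw [hwx, neg_pow x]
      ring
    rw [h2] at h
    exact h
  have hC : HasSum (fun m : ℕ => ((N.choose (m + 1) : ℕ) : ℂ) * x ^ (m + 1)) ((1 + x) ^ N - 1) := by
    have h := hasSum_sum_of_ne_finset_zero (L := SummationFilter.unconditional ℕ)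
      (f := fun m : ℕ => ((N.choose (m + 1) : ℕ) : ℂ) * x ^ (m + 1)) (s := Finset.range N) (by
        intro m hm
        rw [Nat.choose_eq_zero_of_lt (by simp at hm; omega)]; simp)
    convert h using 1
    rw [add_comm 1 x, add_pow, Finset.sum_range_succ']
    simp [mul_comm]
  rw [hB.unique hC] at hA
  have hD := hA.mul_left (((1 + x)⁻¹) ^ N)
  have e : ((1 + x)⁻¹) ^ N * ((1 + x) ^ N - 1) = 1 - ((1 + x)⁻¹) ^ N := by
    rw [mul_sub, ← mul_pow, inv_mul_cancel₀ hx1]; simp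
  rw [e] at hD
  refine hD.congr_fun ?_ |> id
  intro p
  rw [mul_pow, ← pow_mul]
  ring
end

section
/- Let N be a positive natural number. Define β_N(0) = 1 and, for p ≥ 1, β_N(p) = (p + 1/N)(p + 2/N)⋯(p + p/N)/(p+1)!. Then there exists r > 0 such that for every w ∈ ℂ with |w| < r, the series Σ_{p=0}^∞ β_N(p)·(w·(1 − w/N)^{N})^{p+1} converges and equals 1 − (1 − w/N)^{N}. (Equivalently: the function L_N(t) = t/(1 − Σ_{p=0}^∞ β_N(p)·t^{p+1}) is defined, analytic and invertible with respect to composition in a neighborhood of 0, with inverse L_N^{⟨−1⟩}(z) = z·(1 − z/N)^{N}.) -/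
/-- `β_N(p) = (p + 1/N)(p + 2/N)⋯(p + p/N)/(p+1)!`, with `β_N(0) = 1`. -/
noncomputable def betaN (N p : ℕ) : ℝ :=
  (∏ m ∈ Finset.Icc 1 p, ((p : ℝ) + (m : ℝ) / (N : ℝ))) / ((p + 1).factorial : ℝ)

open Finset in
lemma aux_comb (N k : ℕ) :
    ∑ q ∈ antidiagonal k, (((N+1)*q.1).choose q.1 : ℤ) * ((-1)^q.2 * ((N*q.1).choose q.2 : ℤ))
      = ((N:ℤ)+1)^k := by
  have h1 : (((1 + Polynomial.X : Polynomial ℤ)^(N+1) + (-1))^k).coeff k = ((N:ℤ)+1)^k := by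
    have h := mul_geom_sum (1 + Polynomial.X : Polynomial ℤ) (N+1)
    rw [← sub_eq_add_neg, ← h, mul_pow, add_sub_cancel_left, Polynomial.coeff_X_pow_mul',
      if_pos le_rfl, Nat.sub_self, Polynomial.coeff_zero_eq_eval_zero, Polynomial.eval_pow,
      Polynomial.eval_finsetSum]
    simp
  rw [← h1, (Commute.all _ _).add_pow', Polynomial.finsetSum_coeff]
  refine Finset.sum_congr rfl fun q hq => ?_
  rw [HasAntidiagonal.mem_antidiagonal] at hq
  have h2 := Nat.choose_mul (n := (N+1)*q.1) (k := k) (s := q.1) (by omega)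
  have e1 : (N+1)*q.1 - q.1 = N*q.1 := by rw [add_mul, one_mul, Nat.add_sub_cancel]
  have e2 : k - q.1 = q.2 := by omega
  rw [e1, e2] at h2
  have h3 : ((-1 : Polynomial ℤ)^q.2) = Polynomial.C ((-1)^q.2) := by simp
  rw [Polynomial.coeff_smul, ← pow_mul, h3, Polynomial.coeff_mul_C,
    Polynomial.coeff_one_add_X_pow, nsmul_eq_mul]
  have h4 : (((N+1)*q.1).choose k : ℤ) * (k.choose q.1 : ℤ)
      = ((N+1)*q.1).choose q.1 * (N*q.1).choose q.2 := by exact_mod_cast h2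
  linear_combination (-(-1)^q.2) * h4

lemma aux_bound_s10 (N : ℕ) (x : ℝ) (hx0 : 0 ≤ x) (hx : x < 1/4^(N+1)) :
    2^(N+1) * (x * (1+x)^N) ≤ 1/2 := by
  have h4 : (1:ℝ)/4^(N+1) ≤ 1 := by
    rw [div_le_one (by positivity)]; exact one_le_pow₀ (by norm_num)
  have h2 : (1+x)^N ≤ 2^N := pow_le_pow_left₀ (by linarith) (by linarith) _
  calc 2^(N+1) * (x * (1+x)^N) ≤ 2^(N+1) * (1/4^(N+1) * 2^N) := by gcongr
    _ = 1/2 := by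
      have : (4:ℝ)^(N+1) = 2^(N+1) * (2^N * 2) := by
        rw [← pow_succ, ← mul_pow]; norm_num
      rw [this]; field_simp

lemma aux_bound2 (N p : ℕ) (x : ℝ) (hx0 : 0 ≤ x) (hx : x < 1/4^(N+1)) :
    (((N+1)*p).choose p : ℝ) * (x * (1+x)^N)^p ≤ (1/2)^p := by
  have h1 : (((N+1)*p).choose p : ℝ) ≤ 2^((N+1)*p) := by
    exact_mod_cast Nat.choose_le_two_pow _ _
  calc _ ≤ 2^((N+1)*p) * (x * (1+x)^N)^p := by gcongr
    _ = (2^(N+1) * (x * (1+x)^N))^p := by rw [pow_mul, ← mul_pow]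
    _ ≤ (1/2)^p := pow_le_pow_left₀ (by positivity) (aux_bound_s10 N x hx0 hx) _

lemma aux_inner {K : Type*} [NormedField K] (N p : ℕ) (u s a : K) :
    HasSum (fun j : ℕ => a * (s^j * ((N*p).choose j : K)) * u^(p+j))
      (a * (u * (1 + s*u)^N)^p) := by
  have h : a * (u * (1 + s*u)^N)^p = ∑ j ∈ Finset.range (N*p+1),
      a * (s^j * ((N*p).choose j : K)) * u^(p+j) := by
    rw [mul_pow, ← pow_mul, add_comm 1, add_pow, Finset.mul_sum, Finset.mul_sum]
    refine Finset.sum_congr rfl fun j _ => ?_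
    rw [mul_pow, pow_add]; ring
  rw [h]
  apply hasSum_sum_of_ne_finset_zero
  intro j hj
  rw [Finset.mem_range, not_lt] at hj
  rw [Nat.choose_eq_zero_of_lt (by omega)]; simp

lemma aux_deriv_sum (N : ℕ) (u : ℂ) (hu : ‖u‖ < 1/4^(N+1)) :
    HasSum (fun p : ℕ => (((N+1)*p).choose p : ℂ) * (u * (1-u)^N)^p) (1 - (N+1)*u)⁻¹ := by
  let f : ℕ × ℕ → ℂ := fun q =>
    (((N+1)*q.1).choose q.1 : ℂ) * ((-1)^q.2 * ((N*q.1).choose q.2 : ℂ)) * u^(q.1+q.2)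
  have hin : ∀ p, HasSum (fun j => f (p, j)) ((((N+1)*p).choose p : ℂ) * (u * (1-u)^N)^p) := by
    intro p
    have := aux_inner N p u (-1) (((N+1)*p).choose p : ℂ)
    rw [neg_one_mul, ← sub_eq_add_neg] at this
    exact this
  have hf : Summable f := by
    apply Summable.of_norm
    have hn : ∀ p, HasSum (fun j => ‖f (p, j)‖)
        ((((N+1)*p).choose p : ℝ) * (‖u‖ * (1+‖u‖)^N)^p) := by
      intro p
      have := aux_inner N p ‖u‖ 1 (((N+1)*p).choose p : ℝ)
      rw [one_mul] at this
      have hfe : (fun j => ‖f (p, j)‖) = fun j => (((N+1)*p).choose p : ℝ) *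
          (1^j * ((N*p).choose j : ℝ)) * ‖u‖^(p+j) := by
        funext j
        simp [f]
      rw [hfe]
      exact this
    rw [summable_prod_of_nonneg (fun _ => norm_nonneg _)]
    refine ⟨fun p => (hn p).summable, ?_⟩
    simp_rw [(hn _).tsum_eq]
    exact Summable.of_nonneg_of_le (fun p => by positivity)
      (fun p => aux_bound2 N p _ (norm_nonneg _) hu)
      (summable_geometric_of_lt_one (by norm_num) (by norm_num))
  have h1 := hf.hasSum.prod_fiberwise hin
  have h2 : HasSum (fun k : ℕ => (((N:ℂ)+1)*u)^k) (∑' q, f q) := by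
    have h3 := (Finset.HasAntidiagonal.sigmaAntidiagonalEquivProd (A := ℕ)).hasSum_iff.mpr hf.hasSum
    refine h3.sigma fun k => ?_
    have h4 : (((N:ℂ)+1)*u)^k = ∑ q ∈ Finset.HasAntidiagonal.antidiagonal k, f q := by
      have h5 := congrArg (Int.cast : ℤ → ℂ) (aux_comb N k)
      push_cast at h5
      rw [mul_pow, ← h5, Finset.sum_mul]
      refine Finset.sum_congr rfl fun q hq => ?_
      rw [Finset.HasAntidiagonal.mem_antidiagonal] at hq
      simp only [f, hq]
    rw [h4, ← Finset.sum_coe_sort]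
    exact hasSum_fintype _
  have h6 : ‖((N:ℂ)+1)*u‖ < 1 := by
    have : ‖((N:ℂ)+1)‖ = (N:ℝ)+1 := by
      rw [← Nat.cast_succ, Complex.norm_natCast]; push_cast; ring
    rw [norm_mul, this]
    have h7 : ((N:ℝ)+1) < 4^(N+1) := by
      exact_mod_cast Nat.lt_pow_self (n := N+1) (a := 4) (by norm_num)
    rw [lt_div_iff₀ (by positivity)] at hu
    nlinarith [norm_nonneg u]
  rw [← h2.unique (hasSum_geometric_of_norm_lt_one h6)]
  exact h1

lemma aux_main (N : ℕ) (u : ℂ) (hu : ‖u‖ < 1/4^(N+1)) :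
    HasSum (fun p : ℕ => (N:ℂ) * (((N+1)*p).choose p : ℂ) / ((p:ℂ)+1) * (u * (1-u)^N)^(p+1))
      (1 - (1-u)^N) := by
  let T : ℂ → ℂ := fun z => z * (1-z)^N
  let T' : ℂ → ℂ := fun z => (1-z)^N - z * (N * (1-z)^(N-1))
  have hT : ∀ z, HasDerivAt T (T' z) z := by
    intro z
    have h1 : HasDerivAt (fun z : ℂ => 1 - z) (-1) z := by
      simpa using (hasDerivAt_id z).const_sub 1
    have := (hasDerivAt_id z).mul (h1.pow N)
    refine this.congr_deriv ?_
    simp [T']; ring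
  let g : ℕ → ℂ → ℂ := fun p z => (N:ℂ) * (((N+1)*p).choose p : ℂ) / ((p:ℂ)+1) * (T z)^(p+1)
  let g' : ℕ → ℂ → ℂ := fun p z => (N:ℂ) * T' z * ((((N+1)*p).choose p : ℂ) * (T z)^p)
  have hg : ∀ p z, HasDerivAt (g p) (g' p z) z := by
    intro p z
    have := ((hT z).pow (p+1)).const_mul ((N:ℂ) * (((N+1)*p).choose p : ℂ) / ((p:ℂ)+1))
    refine this.congr_deriv ?_
    have : (p:ℂ)+1 ≠ 0 := by exact_mod_cast Nat.succ_ne_zero p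
    simp only [g', Nat.add_sub_cancel]; push_cast; field_simp
  let S : Set ℂ := Metric.ball 0 (1/4^(N+1))
  have hS : ∀ z ∈ S, ‖z‖ < 1/4^(N+1) := fun z hz => by simpa [S] using hz
  have h4 : (1:ℝ)/4^(N+1) ≤ 1 := by
    rw [div_le_one (by positivity)]; exact one_le_pow₀ (by norm_num)
  have hz1 : ∀ z : ℂ, ‖1 - z‖ ≤ 1 + ‖z‖ := fun z => by simpa using norm_sub_le 1 z
  have hT'b : ∀ z ∈ S, ‖T' z‖ ≤ 2^N + N * 2^(N-1) := by
    intro z hz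
    have hz' := hS z hz
    have h2 : ‖1 - z‖ ≤ 2 := (hz1 z).trans (by linarith)
    refine (norm_sub_le _ _).trans ?_
    rw [norm_mul, norm_mul, norm_pow, norm_pow, Complex.norm_natCast]
    have : ‖z‖ * (N * ‖1-z‖^(N-1)) ≤ 1 * (N * 2^(N-1)) := by
      gcongr; linarith
    have h3 : ‖1-z‖^N ≤ 2^N := by gcongr
    linarith
  let B : ℕ → ℝ := fun p => N * (2^N + N * 2^(N-1)) * (1/2)^p
  have hB : Summable B :=
    (summable_geometric_of_lt_one (by norm_num) (by norm_num)).mul_left _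
  have hgB : ∀ p, ∀ z ∈ S, ‖g' p z‖ ≤ B p := by
    intro p z hz
    have hb : ‖(((N+1)*p).choose p : ℂ) * (T z)^p‖ ≤ (1/2)^p := by
      refine le_trans ?_ (aux_bound2 N p ‖z‖ (norm_nonneg _) (hS z hz))
      simp only [T]
      rw [norm_mul, norm_pow, norm_mul, norm_pow, Complex.norm_natCast]
      have := hz1 z
      gcongr
    simp only [g', B]
    rw [norm_mul, norm_mul, Complex.norm_natCast]
    have := hT'b z hz
    gcongr
  have hSo : IsOpen S := Metric.isOpen_ball
  have hSp : IsPreconnected S := (convex_ball _ _).isPreconnected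
  have h0 : (0:ℂ) ∈ S := Metric.mem_ball_self (by positivity)
  have huS : u ∈ S := by simpa [S] using hu
  have hg0 : ∀ p, g p 0 = 0 := by intro p; simp [g, T]
  have hs0 : Summable fun p => g p 0 := by simp [hg0, summable_zero]
  have hsum : Summable fun p => g p u :=
    summable_of_summable_hasDerivAt_of_isPreconnected hB hSo hSp (fun p z _ => hg p z) hgB h0 hs0 huS
  have hD : ∀ z ∈ S, HasDerivAt (fun z => (∑' p, g p z) - (1 - (1-z)^N)) 0 z := by
    intro z hz
    have hd := hasDerivAt_tsum_of_isPreconnected hB hSo hSp (fun p z _ => hg p z) hgB h0 hs0 hz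
    have hv : ∑' p, g' p z = N * T' z * (1 - (N+1)*z)⁻¹ :=
      ((aux_deriv_sum N z (hS z hz)).mul_left _).tsum_eq
    have h1 : HasDerivAt (fun z : ℂ => 1 - z) (-1) z := by
      simpa using (hasDerivAt_id z).const_sub 1
    have h2 := hd.sub ((h1.pow N).const_sub 1)
    refine h2.congr_deriv ?_
    have hne : (1 - ((N:ℂ)+1)*z) ≠ 0 := by
      intro h0
      have h6 : ((N:ℂ)+1)*z = 1 := by linear_combination -h0
      have h8 := congrArg norm h6
      have : ‖((N:ℂ)+1)‖ = (N:ℝ)+1 := by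
        rw [← Nat.cast_succ, Complex.norm_natCast]; push_cast; ring
      rw [norm_mul, this, norm_one] at h8
      have h7 : ((N:ℝ)+1) < 4^(N+1) := by
        exact_mod_cast Nat.lt_pow_self (n := N+1) (a := 4) (by norm_num)
      have hu := hS z hz
      rw [lt_div_iff₀ (by positivity)] at hu
      nlinarith [norm_nonneg z]
    rw [hv]
    rcases N with _ | n
    · simp
    · have hT2 : T' z = (1-z)^n * (1 - (((n+1 : ℕ):ℂ)+1)*z) := by
        simp only [T', Nat.add_sub_cancel]; ring
      rw [hT2, mul_assoc, mul_assoc, mul_inv_cancel₀ hne, Nat.add_sub_cancel]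
      ring
  have hc := hSo.is_const_of_deriv_eq_zero hSp
    (fun z hz => (hD z hz).differentiableAt.differentiableWithinAt)
    (fun z hz => (hD z hz).deriv) huS h0
  have hval : ∑' p, g p u = 1 - (1-u)^N := by
    simp only [hg0, tsum_zero, sub_zero, one_pow, sub_self] at hc
    exact sub_eq_zero.mp hc
  rw [← hval]
  exact hsum.hasSum

lemma aux_beta (N p : ℕ) (hN : 0 < N) :
    betaN N p = (((N+1)*p).choose p : ℝ) / ((p:ℝ)+1) / (N:ℝ)^p := by
  have hN' : (N:ℝ) ≠ 0 := by positivity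
  have h1 : ∏ m ∈ Finset.Icc 1 p, ((p : ℝ) + (m : ℝ) / (N : ℝ))
      = (p.factorial : ℝ) * ((N+1)*p).choose p / (N:ℝ)^p := by
    have h2 := Nat.ascFactorial_eq_factorial_mul_choose (N*p) p
    rw [Nat.ascFactorial_eq_prod_range] at h2
    have e : N*p + p = (N+1)*p := by ring
    rw [e] at h2
    have h3 := congrArg (Nat.cast : ℕ → ℝ) h2
    push_cast at h3
    have h5 : Finset.Icc 1 p = Finset.Ico 1 (p+1) := by ext; simp
    rw [← h3, h5, Finset.prod_Ico_eq_prod_range, Nat.add_sub_cancel, eq_div_iff (pow_ne_zero _ hN')]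
    have h6 : (N:ℝ)^p = ∏ _i ∈ Finset.range p, (N:ℝ) := by simp
    rw [h6, ← Finset.prod_mul_distrib]
    refine Finset.prod_congr rfl fun i _ => ?_
    push_cast
    field_simp
    ring
  rw [betaN, h1, Nat.factorial_succ]
  have : (p.factorial : ℝ) ≠ 0 := by positivity
  push_cast
  field_simp

/-- The function `L_N(t) = t/(1 − Σ_p β_N(p)·t^{p+1})` has compositional inverse
`z·(1 − z/N)^{N}` near `0`: for `w` near `0`, `Σ_p β_N(p)·(w(1−w/N)^{N})^{p+1}`
converges to `1 − (1−w/N)^{N}`. -/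
theorem stmt10 (N : ℕ) (hN : 0 < N) :
    ∃ r : ℝ, 0 < r ∧ ∀ w : ℂ, ‖w‖ < r →
      HasSum (fun p : ℕ => (betaN N p : ℂ) * (w * (1 - w / (N : ℂ)) ^ N) ^ (p + 1))
        (1 - (1 - w / (N : ℂ)) ^ N) := by
  have hNr : (0:ℝ) < N := by exact_mod_cast hN
  have hNc : (N:ℂ) ≠ 0 := by exact_mod_cast hN.ne'
  refine ⟨1/4^(N+1) * N, by positivity, fun w hw => ?_⟩
  have hu : ‖w / (N:ℂ)‖ < 1/4^(N+1) := by
    rw [norm_div, Complex.norm_natCast, div_lt_iff₀ hNr]; exact hw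
  convert aux_main N _ hu using 2 with p
  rw [aux_beta N p hN]
  push_cast
  have : (p:ℂ)+1 ≠ 0 := by exact_mod_cast Nat.succ_ne_zero p
  rw [mul_pow, mul_pow, div_pow]
  field_simp
  ring
end

section
/- Define ρ : (0,π) → ℝ by ρ(v) = (sin v / v)·exp(v·cot v), and let ρ′ denote its derivative. Then for every p ∈ ℕ the function v ↦ sin v · exp(−v·cot v) · ρ(v)^p · ρ′(v) is integrable on (0,π), and −(1/π)·∫₀^π sin v · exp(−v·cot v) · ρ(v)^p · ρ′(v) dv = p^p/(p+1)!, with the convention 0⁰ = 1 (so the integral equals 1 when p = 0 and equals p^p/(p+1)! when p ≥ 1). (Equivalently, the probability measure on (0,e) obtained as the pushforward under ρ of the measure (1/π)·sin v·exp(−v·cot v)·(−ρ′(v))dv has p-th moment p^p/(p+1)! for all p; this is the distribution of T*T for a DT(δ₀,1)-operator T.) -/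
open Real MeasureTheory

/-- `ρ(v) = (sin v / v)·exp(v·cot v)`. -/
noncomputable def rhoFun (v : ℝ) : ℝ :=
  (Real.sin v / v) * Real.exp (v * (Real.cos v / Real.sin v))

open Filter Topology in
lemma aux_prim (p : ℕ) : ∀ n : ℕ, ∃ A : ℂ → ℂ,
    (∀ z : ℂ, z ≠ 0 → HasDerivAt A
      (Complex.exp (p * z) / z ^ (n + 1) - ((p : ℂ) ^ n / (n.factorial : ℂ)) / z) z) ∧
    ∀ x : ℝ, x ≠ 0 → (A x).im = 0 := by
  intro n
  induction n with
  | zero =>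
    set f : ℂ → ℂ := fun z => Complex.exp (p * z) with hf
    have hd : Differentiable ℂ f := by rw [hf]; fun_prop
    have hds : Differentiable ℂ (dslope f 0) := by
      rw [← differentiableOn_univ]
      exact (Complex.differentiableOn_dslope (by simp)).2 hd.differentiableOn
    obtain ⟨g, hg0, hg⟩ := (hds.isExactOn_univ).with_val_at 0 0
    have hg1 : ∀ z : ℂ, z ≠ 0 → HasDerivAt g
      (Complex.exp (p * z) / z ^ (0 + 1) - ((p : ℂ) ^ 0 / (Nat.factorial 0 : ℂ)) / z) z := by
      intro z hz
      refine HasDerivAt.congr_deriv (hg z (Set.mem_univ _)) (Eq.symm ?_)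
      rw [dslope_of_ne _ hz, slope_def_field]
      simp [hf]
      ring
    refine ⟨g, hg1, ?_⟩
    have hder : ∀ x : ℝ, HasDerivAt (fun x : ℝ => (g x).im) ((dslope f 0 (x : ℂ)).im) x := by
      intro x
      have h1 := (hg (x : ℂ) (Set.mem_univ _)).comp_ofReal
      exact (Complex.imCLM.hasFDerivAt.comp_hasDerivAt x h1)
    have him : ∀ x : ℝ, (dslope f 0 (x : ℂ)).im = 0 := by
      intro x
      by_cases hx : x = 0
      · subst hx
        have : deriv f 0 = p := by
          have : HasDerivAt f (Complex.exp (p * 0) * (p * 1)) 0 :=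
            ((hasDerivAt_id (0 : ℂ)).const_mul (p : ℂ)).cexp
          rw [this.deriv]; simp
        simp [this]
      · have hx' : (x : ℂ) ≠ 0 := by exact_mod_cast hx
        rw [dslope_of_ne _ hx', slope_def_field]
        have : (f x - f 0) / ((x : ℂ) - 0) = ((Real.exp (p * x) - 1) / x : ℝ) := by
          simp [hf]
        rw [this, Complex.ofReal_im]
    intro x _
    have := is_const_of_deriv_eq_zero (f := fun x : ℝ => (g x).im)
      (fun x => (hder x).differentiableAt) (fun x => by rw [(hder x).deriv, him]) x 0
    simpa [hg0] using this
  | succ n ih =>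
    obtain ⟨A, hA, hr⟩ := ih
    refine ⟨fun z => -(Complex.exp (p * z) / z ^ (n + 1) / (n + 1 : ℂ)) + (p : ℂ) / (n + 1 : ℂ) * A z,
      ?_, ?_⟩
    · intro z hz
      have h1 : HasDerivAt (fun z : ℂ => Complex.exp (p * z)) (Complex.exp (p * z) * (p * 1)) z :=
        ((hasDerivAt_id z).const_mul (p : ℂ)).cexp
      have h2 := hasDerivAt_pow (n + 1) z
      have h3 := ((((h1.div h2 (pow_ne_zero _ hz)).div_const (n + 1 : ℂ)).neg).add
        ((hA z hz).const_mul ((p : ℂ) / (n + 1 : ℂ))))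
      refine HasDerivAt.congr_deriv (h3) (Eq.symm ?_)
      have hn : (n + 1 : ℂ) ≠ 0 := by exact_mod_cast Nat.succ_ne_zero n
      have hn' : (n.factorial : ℂ) ≠ 0 := by exact_mod_cast Nat.factorial_ne_zero n
      rw [Nat.factorial_succ]
      push_cast
      field_simp
      ring
    · intro x hx
      have h := hr x hx
      have hA' : A x = ((A x).re : ℂ) := by
        apply Complex.ext <;> simp [h]
      simp only []
      rw [hA']
      have : -(Complex.exp (p * (x : ℂ)) / (x : ℂ) ^ (n + 1) / (n + 1 : ℂ)) +
          (p : ℂ) / (n + 1 : ℂ) * ((A x).re : ℂ) =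
          ((-(Real.exp (p * x) / x ^ (n + 1) / (n + 1)) + p / (n + 1) * (A x).re : ℝ) : ℂ) := by
        push_cast; rfl
      rw [this, Complex.ofReal_im]

lemma aux_sin {v : ℝ} (hv : v ∈ Set.Ioo 0 π) : 0 < Real.sin v :=
  Real.sin_pos_of_pos_of_lt_pi hv.1 hv.2

lemma aux_x {v : ℝ} (hv : v ∈ Set.Ioo 0 π) :
    HasDerivAt (fun v : ℝ => v * (Real.cos v / Real.sin v))
      (Real.cos v / Real.sin v - v / Real.sin v ^ 2) v := by
  have hs := (aux_sin hv).ne'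
  have h := (hasDerivAt_id v).mul ((Real.hasDerivAt_cos v).div (Real.hasDerivAt_sin v) hs)
  refine HasDerivAt.congr_deriv (h) (Eq.symm ?_)
  have := Real.sin_sq_add_cos_sq v
  simp only [id, Pi.div_apply]
  field_simp
  linear_combination v * this

lemma aux_rho_pos {v : ℝ} (hv : v ∈ Set.Ioo 0 π) : 0 < rhoFun v := by
  have := aux_sin hv
  have := hv.1
  unfold rhoFun
  positivity

lemma aux_sinc {v : ℝ} (hv : v ∈ Set.Ioo 0 π) : Real.sin v / v ≤ 1 := by
  rw [div_le_one hv.1]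
  exact (Real.sin_lt hv.1).le

lemma aux_rho_le {v : ℝ} (hv : v ∈ Set.Ioo 0 π) : rhoFun v ≤ Real.exp 1 := by
  have hs := aux_sin hv
  have hx : v * (Real.cos v / Real.sin v) ≤ 1 := by
    rcases lt_or_ge v (π / 2) with h | h
    · have h1 := Real.le_tan hv.1.le h
      have hc := Real.cos_pos_of_mem_Ioo (x := v) ⟨by linarith [hv.1, Real.pi_pos], h⟩
      rw [Real.tan_eq_sin_div_cos, le_div_iff₀ hc] at h1
      rw [← mul_div_assoc, div_le_one hs]
      exact h1
    · have hc := Real.cos_nonpos_of_pi_div_two_le_of_le h (by linarith [hv.2, Real.pi_pos])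
      have : v * (Real.cos v / Real.sin v) ≤ 0 :=
        mul_nonpos_of_nonneg_of_nonpos hv.1.le (div_nonpos_of_nonpos_of_nonneg hc hs.le)
      linarith
  unfold rhoFun
  calc _ ≤ 1 * Real.exp 1 := by
        gcongr
        exact aux_sinc hv
    _ = _ := one_mul _

lemma aux_rho_deriv {v : ℝ} (hv : v ∈ Set.Ioo 0 π) :
    HasDerivAt rhoFun (rhoFun v * (2 * (Real.cos v / Real.sin v) - 1 / v - v / Real.sin v ^ 2)) v := by
  have hs := (aux_sin hv).ne'
  have hv0 := hv.1.ne'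
  have h := ((Real.hasDerivAt_sin v).div (hasDerivAt_id v) hv0).mul (aux_x hv).exp
  refine HasDerivAt.congr_deriv (h) (Eq.symm ?_)
  unfold rhoFun
  simp only [id, Pi.div_apply]
  field_simp
  ring

lemma aux_integrand (p : ℕ) {v : ℝ} (hv : v ∈ Set.Ioo 0 π) :
    Real.sin v * Real.exp (-(v * (Real.cos v / Real.sin v))) * rhoFun v ^ p * deriv rhoFun v
      = rhoFun v ^ p * (2 * Real.cos v * (Real.sin v / v) - (Real.sin v / v) ^ 2 - 1) := by
  have hs := (aux_sin hv).ne'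
  have hv0 := hv.1.ne'
  rw [(aux_rho_deriv hv).deriv]
  have : Real.exp (-(v * (Real.cos v / Real.sin v))) * rhoFun v = Real.sin v / v := by
    unfold rhoFun
    rw [Real.exp_neg]
    have := (Real.exp_pos (v * (Real.cos v / Real.sin v))).ne'
    field_simp
  calc _ = rhoFun v ^ p * Real.sin v * (Real.exp (-(v * (Real.cos v / Real.sin v))) * rhoFun v) *
        (2 * (Real.cos v / Real.sin v) - 1 / v - v / Real.sin v ^ 2) := by ring
    _ = _ := by
      rw [this]
      field_simp

/-- the antiderivative's first part -/
lemma aux_H (p : ℕ) {v : ℝ} (hv : v ∈ Set.Ioo 0 π) :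
    HasDerivAt (fun v => rhoFun v ^ p * (Real.sin v * (Real.sin v / v)))
      ((p + 1) * (rhoFun v ^ p * (2 * Real.cos v * (Real.sin v / v) - (Real.sin v / v) ^ 2 - 1))
        + rhoFun v ^ p) v := by
  have hs := (aux_sin hv).ne'
  have hv0 := hv.1.ne'
  have h := ((aux_rho_deriv hv).pow p).mul ((Real.hasDerivAt_sin v).mul
    ((Real.hasDerivAt_sin v).div (hasDerivAt_id v) hv0))
  refine HasDerivAt.congr_deriv (h) (Eq.symm ?_)
  simp only [id, Pi.div_apply, Pi.mul_apply, Pi.pow_apply]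
  rcases p with _ | p
  · simp
    field_simp
    ring
  · simp only [Nat.add_sub_cancel, pow_succ]
    push_cast
    field_simp
    ring

lemma aux_G (p : ℕ) (A : ℂ → ℂ) (c : ℝ)
    (hA : ∀ z : ℂ, z ≠ 0 → HasDerivAt A (Complex.exp (p * z) / z ^ (p + 1) - (c : ℂ) / z) z)
    {v : ℝ} (hv : v ∈ Set.Ioo 0 π) :
    HasDerivAt (fun v : ℝ => c * v +
      (A (((v * (Real.cos v / Real.sin v) : ℝ) : ℂ) + (v : ℂ) * Complex.I)).im)
      (rhoFun v ^ p) v := by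
  have hs := (aux_sin hv).ne'
  have hv0 := hv.1.ne'
  have hsC : (Real.sin v : ℂ) ≠ 0 := by exact_mod_cast hs
  have hvC : (v : ℂ) ≠ 0 := by exact_mod_cast hv0
  set z : ℂ := ((v * (Real.cos v / Real.sin v) : ℝ) : ℂ) + (v : ℂ) * Complex.I with hz
  have hz0 : z ≠ 0 := by
    intro h
    have : z.im = v := by rw [hz]; simp [-Complex.ofReal_cos, -Complex.ofReal_sin, -Complex.ofReal_mul]
    rw [h] at this
    exact hv0 (by simpa using this.symm)
  have hexp : Complex.exp z = (rhoFun v : ℂ) * z := by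
    rw [hz, Complex.exp_add, Complex.exp_mul_I, ← Complex.ofReal_exp, ← Complex.ofReal_cos,
      ← Complex.ofReal_sin]
    unfold rhoFun
    generalize Real.exp (v * (Real.cos v / Real.sin v)) = E
    push_cast [-Complex.ofReal_cos, -Complex.ofReal_sin]
    field_simp
  have hder := ((aux_x hv).ofReal_comp).add (((hasDerivAt_id v).ofReal_comp).mul_const Complex.I)
  have hc := HasDerivAt.comp v (hA z hz0) hder
  have him := Complex.imCLM.hasFDerivAt.comp_hasDerivAt v hc
  have h := ((hasDerivAt_id v).const_mul c).add him
  refine HasDerivAt.congr_deriv (h) (Eq.symm ?_)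
  have key : (Complex.exp (p * z) / z ^ (p + 1) - (c : ℂ) / z) *
      ((((Real.cos v / Real.sin v - v / Real.sin v ^ 2 : ℝ)) : ℂ) + ((1 : ℝ) : ℂ) * Complex.I)
      = ((rhoFun v ^ p - c : ℝ) : ℂ) * (((1 / v - Real.cos v / Real.sin v : ℝ) : ℂ) + Complex.I) := by
    have e1 : ((((Real.cos v / Real.sin v - v / Real.sin v ^ 2 : ℝ)) : ℂ) + ((1 : ℝ) : ℂ) * Complex.I)
        = z * (((1 / v - Real.cos v / Real.sin v : ℝ) : ℂ) + Complex.I) := by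
      have := Real.sin_sq_add_cos_sq v
      rw [hz]
      apply Complex.ext
      · simp [-Complex.ofReal_cos, -Complex.ofReal_sin, -Complex.ofReal_mul, -Complex.ofReal_sub, -Complex.ofReal_div]
        field_simp
        linear_combination v * this
      · simp [-Complex.ofReal_cos, -Complex.ofReal_sin, -Complex.ofReal_mul, -Complex.ofReal_sub, -Complex.ofReal_div]
        field_simp
        ring
    rw [e1, Complex.exp_nat_mul, hexp]
    push_cast [-Complex.ofReal_cos, -Complex.ofReal_sin]
    rw [mul_pow, pow_succ]
    field_simp
  rw [key]
  simp [-Complex.ofReal_cos, -Complex.ofReal_sin, -Complex.ofReal_mul, -Complex.ofReal_sub, -Complex.ofReal_div, -Complex.ofReal_pow]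

open Filter Topology in
lemma aux_lim0 (A : ℂ → ℂ) (hA : ContinuousAt A 1) (h1 : (A 1).im = 0) (c : ℝ) :
    Tendsto (fun v : ℝ => c * v +
      (A (((v * (Real.cos v / Real.sin v) : ℝ) : ℂ) + (v : ℂ) * Complex.I)).im) (𝓝[>] 0) (𝓝 0) := by
  have hx : Tendsto (fun v : ℝ => v * (Real.cos v / Real.sin v)) (𝓝[>] 0) (𝓝 1) := by
    have h := (hasDerivAt_iff_tendsto_slope.1 (Real.hasDerivAt_sin 0)).mono_left
      (nhdsWithin_mono (0 : ℝ) (show Set.Ioi (0 : ℝ) ⊆ {0}ᶜ from fun x hx => ne_of_gt hx))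
    have hcos : Tendsto Real.cos (𝓝[>] 0) (𝓝 1) := by
      have := (Real.continuous_cos.tendsto 0).mono_left (nhdsWithin_le_nhds (s := Set.Ioi 0))
      simpa using this
    rw [Real.cos_zero] at h
    have := hcos.mul (h.inv₀ one_ne_zero)
    simp only [inv_one, mul_one] at this
    refine this.congr fun v => ?_
    simp [slope_def_field]
    ring
  have hid : Tendsto (fun v : ℝ => v) (𝓝[>] 0) (𝓝 0) := nhdsWithin_le_nhds
  have hz : Tendsto (fun v : ℝ => ((v * (Real.cos v / Real.sin v) : ℝ) : ℂ) + (v : ℂ) * Complex.I)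
      (𝓝[>] 0) (𝓝 1) := by
    have := ((Complex.continuous_ofReal.tendsto 1).comp hx).add
      (((Complex.continuous_ofReal.tendsto 0).comp hid).mul_const Complex.I)
    simpa using this
  have := (hid.const_mul c).add ((Complex.continuous_im.tendsto _).comp (hA.tendsto.comp hz))
  simpa [h1] using this

open Filter Topology in
lemma aux_limpi (p : ℕ) (A : ℂ → ℂ) (c : ℝ) (hc : 0 ≤ c)
    (hA : ∀ z : ℂ, z ≠ 0 → HasDerivAt A (Complex.exp (p * z) / z ^ (p + 1) - (c : ℂ) / z) z)
    (hr : ∀ x : ℝ, x ≠ 0 → (A x).im = 0) :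
    Tendsto (fun v : ℝ => c * v +
      (A (((v * (Real.cos v / Real.sin v) : ℝ) : ℂ) + (v : ℂ) * Complex.I)).im)
      (𝓝[<] π) (𝓝 (c * π)) := by
  have hid : Tendsto (fun v : ℝ => v) (𝓝[<] π) (𝓝 π) := nhdsWithin_le_nhds
  have hIoo : ∀ᶠ v in 𝓝[<] π, v ∈ Set.Ioo 0 π := Ioo_mem_nhdsLT Real.pi_pos
  have hx : Tendsto (fun v : ℝ => v * (Real.cos v / Real.sin v)) (𝓝[<] π) atBot := by
    have hsin : Tendsto Real.sin (𝓝[<] π) (𝓝[>] 0) := by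
      refine tendsto_nhdsWithin_iff.2 ⟨?_, ?_⟩
      · have := (Real.continuous_sin.tendsto π).comp hid
        simpa [Function.comp_def] using this
      · filter_upwards [hIoo] with v hv using aux_sin hv
    have hvc : Tendsto (fun v => v * Real.cos v) (𝓝[<] π) (𝓝 (-π)) := by
      have := hid.mul ((Real.continuous_cos.tendsto π).comp hid)
      simpa using this
    have := Filter.Tendsto.neg_mul_atTop (by linarith [Real.pi_pos]) hvc
      (tendsto_inv_nhdsGT_zero.comp hsin)
    refine this.congr fun v => ?_
    simp only [Function.comp]
    ring
  have hbound : ∀ z : ℂ, z.re ≤ -1 → ‖A z - A (z.re : ℂ)‖ ≤ (1 + c) / (-z.re) * |z.im| := by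
    intro z hz
    have hR : 0 < -z.re := by linarith
    have := Convex.norm_image_sub_le_of_norm_hasDerivWithin_le (s := {w : ℂ | w.re ≤ z.re})
      (f := A) (f' := fun w => Complex.exp (p * w) / w ^ (p + 1) - (c : ℂ) / w)
      (C := (1 + c) / (-z.re)) (x := (z.re : ℂ)) (y := z) ?_ ?_ (convex_halfSpace_re_le _)
      (by simp) (by simp)
    · refine this.trans_eq ?_
      congr 1
      have : z - (z.re : ℂ) = (z.im : ℂ) * Complex.I := by
        apply Complex.ext <;> simp
      rw [this]; simp
    · intro w hw
      have hw' : w.re ≤ z.re := hw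
      refine (hA w ?_).hasDerivWithinAt
      rintro rfl
      simp at hw'
      linarith
    · intro w hw
      have hw' : w.re ≤ z.re := hw
      have hn : -z.re ≤ ‖w‖ := by
        have := Complex.abs_re_le_norm w
        have := neg_abs_le w.re
        linarith
      have hn1 : 1 ≤ ‖w‖ := by linarith
      have hn0 : 0 < ‖w‖ := by linarith
      have he : ‖Complex.exp (p * w)‖ ≤ 1 := by
        rw [Complex.norm_exp]
        apply Real.exp_le_one_iff.2
        simp
        exact mul_nonpos_of_nonneg_of_nonpos (Nat.cast_nonneg _) (by linarith)
      calc _ ≤ ‖Complex.exp (p * w) / w ^ (p + 1)‖ + ‖(c : ℂ) / w‖ := norm_sub_le _ _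
        _ ≤ 1 / ‖w‖ + c / ‖w‖ := by
          rw [norm_div, norm_div, norm_pow, Complex.norm_real, Real.norm_of_nonneg hc]
          gcongr
          calc ‖w‖ = ‖w‖ ^ 1 := (pow_one _).symm
            _ ≤ ‖w‖ ^ (p + 1) := pow_le_pow_right₀ hn1 (by omega)
        _ = (1 + c) / ‖w‖ := by ring
        _ ≤ _ := by gcongr
  have him : Tendsto (fun v : ℝ =>
      (A (((v * (Real.cos v / Real.sin v) : ℝ) : ℂ) + (v : ℂ) * Complex.I)).im)
      (𝓝[<] π) (𝓝 0) := by
    have hlim : Tendsto (fun v : ℝ => (1 + c) / (-(v * (Real.cos v / Real.sin v))) * π)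
        (𝓝[<] π) (𝓝 0) := by
      have := ((tendsto_neg_atBot_atTop.comp hx).const_div_atTop (1 + c)).mul_const π
      simpa using this
    refine squeeze_zero_norm' ?_ hlim
    filter_upwards [hIoo, hx.eventually_le_atBot (-1)] with v hv hv1
    set x := v * (Real.cos v / Real.sin v)
    have h := hbound ((x : ℂ) + (v : ℂ) * Complex.I) (by simpa using hv1)
    have hre : ((x : ℂ) + (v : ℂ) * Complex.I).re = x := by simp
    have him : ((x : ℂ) + (v : ℂ) * Complex.I).im = v := by simp
    rw [hre, him] at h
    have h2 := Complex.abs_im_le_norm (A ((x : ℂ) + (v : ℂ) * Complex.I) - A (x : ℂ))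
    rw [Complex.sub_im, hr x (by linarith), sub_zero] at h2
    rw [Real.norm_eq_abs]
    refine (h2.trans h).trans ?_
    have : 0 < -x := by linarith
    rw [abs_of_pos hv.1]
    gcongr
    exact hv.2.le
  simpa using (hid.const_mul c).add him

open Filter Topology in
lemma aux_H0 (p : ℕ) (a : ℝ) (l : Filter ℝ) (hl : ∀ᶠ v in l, v ∈ Set.Ioo 0 π)
    (hs : Tendsto Real.sin l (𝓝 0)) :
    Tendsto (fun v => rhoFun v ^ p * (Real.sin v * (Real.sin v / v))) l (𝓝 0) := by
  have hlim : Tendsto (fun v => Real.exp 1 ^ p * (Real.sin v * 1)) l (𝓝 0) := by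
    simpa using (hs.mul_const 1).const_mul (Real.exp 1 ^ p)
  refine squeeze_zero_norm' ?_ hlim
  filter_upwards [hl] with v hv
  have h1 := aux_rho_pos hv
  have h2 := aux_sin hv
  have h3 := hv.1
  rw [Real.norm_of_nonneg (by positivity)]
  gcongr
  · exact aux_rho_le hv
  · exact aux_sinc hv

open Filter Topology in
theorem stmt13 (p : ℕ) :
    IntegrableOn
      (fun v => Real.sin v * Real.exp (-(v * (Real.cos v / Real.sin v))) *
        rhoFun v ^ p * deriv rhoFun v) (Set.Ioo 0 π) ∧
    -(1 / π) * ∫ v in Set.Ioo 0 π,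
        Real.sin v * Real.exp (-(v * (Real.cos v / Real.sin v))) *
          rhoFun v ^ p * deriv rhoFun v
      = (p : ℝ) ^ p / ((p + 1).factorial : ℝ) := by
  set F : ℝ → ℝ := fun v =>
    rhoFun v ^ p * (2 * Real.cos v * (Real.sin v / v) - (Real.sin v / v) ^ 2 - 1) with hF
  have hint : IntegrableOn F (Set.Ioo 0 π) := by
    refine IntegrableOn.of_bound (by simp) ?_ (Real.exp 1 ^ p * 4) ?_
    · apply Measurable.aestronglyMeasurable
      rw [hF]
      unfold rhoFun
      fun_prop
    · refine (ae_restrict_iff' measurableSet_Ioo).2 (Eventually.of_forall fun v hv => ?_)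
      have h1 := aux_rho_pos hv
      have h2 := aux_sin hv
      have h3 := hv.1
      have h4 := aux_sinc hv
      have h5 : 0 < Real.sin v / v := by positivity
      have h6 := Real.cos_le_one v
      have h7 := Real.neg_one_le_cos v
      rw [hF]
      simp only [norm_mul, norm_pow]
      rw [Real.norm_of_nonneg h1.le, Real.norm_eq_abs]
      gcongr
      · exact aux_rho_le hv
      · rw [abs_le]
        constructor <;> nlinarith
  have hEq : Set.EqOn F (fun v => Real.sin v * Real.exp (-(v * (Real.cos v / Real.sin v))) *
        rhoFun v ^ p * deriv rhoFun v) (Set.Ioo 0 π) := fun v hv => (aux_integrand p hv).symm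
  refine ⟨hint.congr_fun hEq measurableSet_Ioo, ?_⟩
  rw [← setIntegral_congr_fun measurableSet_Ioo hEq, ← integral_Ioc_eq_integral_Ioo,
    ← intervalIntegral.integral_of_le Real.pi_pos.le]
  obtain ⟨A, hA, hr⟩ := aux_prim p p
  set c : ℝ := (p : ℝ) ^ p / (p.factorial : ℝ) with hc
  have hcC : (p : ℂ) ^ p / (p.factorial : ℂ) = (c : ℂ) := by rw [hc]; push_cast; rfl
  rw [hcC] at hA
  have hc0 : 0 ≤ c := by positivity
  have hp : (p + 1 : ℝ) ≠ 0 := by positivity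
  have hI := intervalIntegral.integral_eq_sub_of_hasDerivAt_of_tendsto (f' := F) Real.pi_pos
    (fun v hv => by
      have h := ((aux_H p hv).sub (aux_G p A c hA hv)).div_const (p + 1 : ℝ)
      refine HasDerivAt.congr_deriv (h) (Eq.symm ?_)
      rw [hF]
      field_simp
      ring)
    ((intervalIntegrable_iff_integrableOn_Ioo_of_le Real.pi_pos.le).2 hint)
    (((aux_H0 p 0 _ (Ioo_mem_nhdsGT Real.pi_pos) (by
      have := (Real.continuous_sin.tendsto 0).mono_left (nhdsWithin_le_nhds (s := Set.Ioi 0))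
      simpa using this)).sub (aux_lim0 A (hA 1 one_ne_zero).continuousAt
        (by simpa using hr 1 one_ne_zero) c)).div_const _)
    (((aux_H0 p 0 _ (Ioo_mem_nhdsLT Real.pi_pos) (by
      have := (Real.continuous_sin.tendsto π).mono_left (nhdsWithin_le_nhds (s := Set.Iio π))
      simpa using this)).sub (aux_limpi p A c hc0 hA hr)).div_const _)
  rw [hI, hc, Nat.factorial_succ]
  have := Real.pi_ne_zero
  have : (p.factorial : ℝ) ≠ 0 := by positivity
  push_cast
  field_simp
  ring
end
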